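/- Channels of energy for the even part around the ground state: there exists C > 0 such that every radial finite-energy solution u of ∂_t²u − Δu + Vu = 0 on ℝ × ℝ⁶, for which both limits lim_{t→±∞} ∫_{|x|≥|t|} |∇_{t,x}u|² dx exist, satisfies ‖∇(Π⊥_{Ḣ¹} u₀)‖²_{Z_{−3}} ≤ C Σ_± lim_{t→±∞} ∫_{|x|≥|t|} |∇_{t,x}u(t,x)|² dx, where u₀ = u(0,·). -/

import Mathlib

open MeasureTheory Real Filter Set Topology ENNReal RealInnerProductSpace

noncomputable section

abbrev E6 := EuclideanSpace ℝ (Fin 6)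

/-- The ground state `W(x) = (1+|x|²/24)⁻²` on `ℝ⁶`. -/
def W6 (x : E6) : ℝ := ((1 + ‖x‖ ^ 2 / 24) ^ 2)⁻¹

/-- The potential `V = -2W` of the linearized equation. -/
def V6 (x : E6) : ℝ := -2 * W6 x

/-- `ΛW(x) = x·∇W(x) + 2W(x)`. -/
def LW6 (x : E6) : ℝ := fderiv ℝ W6 x x + 2 * W6 x

/-- The Laplacian of `f : ℝ⁶ → ℝ`. -/
def lap6 (f : E6 → ℝ) (x : E6) : ℝ :=
  ∑ i : Fin 6, fderiv ℝ (fun y => fderiv ℝ f y (EuclideanSpace.single i 1)) x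
    (EuclideanSpace.single i 1)

/-- `∂ₜ u`. -/
def dtu (u : ℝ → E6 → ℝ) (t : ℝ) (x : E6) : ℝ := deriv (fun s => u s x) t

/-- `∂ₜ² u`. -/
def dttu (u : ℝ → E6 → ℝ) (t : ℝ) (x : E6) : ℝ := deriv (fun s => dtu u s x) t

/-- `|∇_{t,x} u|² = (∂ₜ u)² + |∇u|²`. -/
def eDensity (u : ℝ → E6 → ℝ) (t : ℝ) (x : E6) : ℝ :=
  dtu u t x ^ 2 + ‖gradient (u t) x‖ ^ 2

/-- `u` is a radial finite-energy solution of `∂ₜ²u - Δu + P·u = 0` on `ℝ × ℝ⁶`. -/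
def IsRadSolOf (P : E6 → ℝ) (u : ℝ → E6 → ℝ) : Prop :=
  ContDiff ℝ 2 (fun p : ℝ × E6 => u p.1 p.2) ∧
  (∀ t x y, ‖x‖ = ‖y‖ → u t x = u t y) ∧
  (∀ t x, dttu u t x - lap6 (u t) x + P x * u t x = 0) ∧
  Integrable (fun x => eDensity u 0 x)

/-- The annulus `{R < |x| < 2R}`. -/
def ann (R : ℝ) : Set E6 := {x | R < ‖x‖ ∧ ‖x‖ < 2 * R}

/-- The `Z₋₃` norm: `sup_{R>0} ⟨log R⟩⁻¹ (∫_{R<|x|<2R} f²)^{1/2}`. -/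
def Zm3 (f : E6 → ℝ) : ℝ≥0∞ :=
  ⨆ R : {R : ℝ // 0 < R}, ENNReal.ofReal
    ((Real.sqrt (1 + Real.log R.1 ^ 2))⁻¹ * Real.sqrt (∫ x in ann R.1, f x ^ 2))

/-- Orthogonal projection onto `(span ΛW)^⊥` in `Ḣ¹(ℝ⁶)`. -/
def PiH1perp (f : E6 → ℝ) : E6 → ℝ :=
  fun x => f x -
    ((∫ y, ⟪gradient f y, gradient LW6 y⟫) / (∫ y, ‖gradient LW6 y‖ ^ 2)) * LW6 x

/-- Integrand of the Legendre-type integrals. -/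
def legInt (n : ℕ) (x θ : ℝ) : ℝ :=
  sin θ ^ (2 * n) * (1 + x * sin θ ^ 2) ^ (-((n : ℝ) + 1 / 2))

/-- Derivatives (up to constants) of the complete elliptic integral. -/
def legG (n : ℕ) (x : ℝ) : ℝ := (2 / π) * ∫ θ in (0 : ℝ)..(π / 2), legInt n x θ

lemma legDelta_ge {x θ : ℝ} {δ : ℝ} (h1 : δ ≤ 1) (hx : δ ≤ 1 + x) :
    δ ≤ 1 + x * sin θ ^ 2 := by
  have h0 := sq_nonneg (sin θ)
  have h2 := sin_sq_le_one θ
  nlinarith [mul_nonneg h0 (sub_nonneg.2 hx), mul_nonneg (sub_nonneg.2 h2) (sub_nonneg.2 h1)]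

lemma legDelta_pos {x θ : ℝ} (hx : -1 < x) : 0 < 1 + x * sin θ ^ 2 := by
  have : 0 < min 1 (1 + x) := lt_min one_pos (by linarith)
  exact this.trans_le (legDelta_ge (min_le_left _ _) (min_le_right _ _))

lemma continuous_legInt (n : ℕ) {x : ℝ} (hx : -1 < x) : Continuous (legInt n x) := by
  unfold legInt
  refine ((continuous_sin.pow _)).mul ?_
  exact Continuous.rpow_const (by fun_prop) fun θ => Or.inl (legDelta_pos hx).ne'

lemma legInt_hasDerivAt (n : ℕ) {x : ℝ} (θ : ℝ) (hx : -1 < x) :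
    HasDerivAt (fun x => legInt n x θ) (-((n : ℝ) + 1 / 2) * legInt (n + 1) x θ) x := by
  unfold legInt
  have h1 : HasDerivAt (fun x => 1 + x * sin θ ^ 2) (sin θ ^ 2) x := by
    simpa using ((hasDerivAt_id x).mul_const (sin θ ^ 2)).const_add 1
  have h2 := (h1.rpow_const (p := -((n : ℝ) + 1 / 2)) (Or.inl (legDelta_pos hx).ne')).const_mul
    (sin θ ^ (2 * n))
  refine h2.congr_deriv ?_
  push_cast
  rw [show -((n : ℝ) + 1 / 2) - 1 = -((n : ℝ) + 1 + 1 / 2) by ring]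
  ring

lemma legG_hasDerivAt (n : ℕ) {x : ℝ} (hx : -1 < x) :
    HasDerivAt (legG n) (-((n : ℝ) + 1 / 2) * legG (n + 1) x) x := by
  set δ : ℝ := min 1 ((1 + x) / 2) with hδ
  have hδ0 : 0 < δ := lt_min one_pos (by linarith)
  have hs : Ioi ((x - 1) / 2) ∈ 𝓝 x := Ioi_mem_nhds (by linarith)
  have hge : ∀ z ∈ Ioi ((x - 1) / 2), ∀ θ, δ ≤ 1 + z * sin θ ^ 2 := fun z hz θ =>
    legDelta_ge (min_le_left _ _) ((min_le_right _ _).trans (by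
      have : (x - 1) / 2 < z := hz
      linarith))
  have hgt : ∀ z ∈ Ioi ((x - 1) / 2), -1 < z := fun z hz => by
    have : (x - 1) / 2 < z := hz
    linarith
  have key := (intervalIntegral.hasDerivAt_integral_of_dominated_loc_of_deriv_le
    (μ := volume) (a := 0) (b := π / 2) (F := fun z θ => legInt n z θ)
    (F' := fun z θ => -((n : ℝ) + 1 / 2) * legInt (n + 1) z θ) (x₀ := x)
    (bound := fun _ => ((n : ℝ) + 1 / 2) * δ ^ (-(((n + 1 : ℕ) : ℝ) + 1 / 2))) hs
    (by
      filter_upwards [hs] with z hz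
      exact (continuous_legInt n (hgt z hz)).aestronglyMeasurable)
    ((continuous_legInt n hx).intervalIntegrable _ _)
    (((continuous_legInt (n + 1) hx).const_mul _).aestronglyMeasurable)
    (by
      refine Eventually.of_forall fun θ _ z hz => ?_
      have hb := hge z hz θ
      have h3 : legInt (n + 1) z θ ≤ δ ^ (-(((n + 1 : ℕ) : ℝ) + 1 / 2)) := by
        unfold legInt
        have h4 : (1 + z * sin θ ^ 2) ^ (-(((n + 1 : ℕ) : ℝ) + 1 / 2)) ≤
            δ ^ (-(((n + 1 : ℕ) : ℝ) + 1 / 2)) :=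
          rpow_le_rpow_of_nonpos hδ0 hb (by push_cast; linarith [Nat.cast_nonneg (α := ℝ) n])
        have h5 : sin θ ^ (2 * (n + 1)) ≤ 1 := by
          rw [pow_mul]; exact pow_le_one₀ (sq_nonneg _) (sin_sq_le_one θ)
        calc _ ≤ 1 * (1 + z * sin θ ^ 2) ^ (-(((n + 1 : ℕ) : ℝ) + 1 / 2)) := by
              gcongr
              exact rpow_nonneg (hδ0.le.trans hb) _
          _ ≤ _ := by rwa [one_mul]
      have h0 : 0 ≤ legInt (n + 1) z θ := by
        unfold legInt
        refine mul_nonneg ?_ (rpow_nonneg (hδ0.le.trans hb) _)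
        rw [pow_mul]; positivity
      rw [norm_mul, norm_neg, Real.norm_of_nonneg h0, Real.norm_of_nonneg (by positivity)]
      gcongr)
    intervalIntegrable_const
    (Eventually.of_forall fun θ _ z hz => legInt_hasDerivAt n θ (hgt z hz))).2
  have h := key.const_mul (2 / π)
  refine h.congr_deriv ?_
  rw [intervalIntegral.integral_const_mul]
  unfold legG; ring

lemma legG_nonneg (n : ℕ) {x : ℝ} (hx : -1 < x) : 0 ≤ legG n x := by
  unfold legG
  refine mul_nonneg (by positivity) (intervalIntegral.integral_nonneg (by positivity) ?_)
  intro θ _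
  unfold legInt
  refine mul_nonneg ?_ (rpow_nonneg (legDelta_pos hx).le _)
  rw [pow_mul]; positivity

lemma legG_le (n : ℕ) {x : ℝ} (hx : 0 ≤ x) : legG n x ≤ ((1 + x) ^ n)⁻¹ := by
  have hx' : -1 < x := by linarith
  have hb : ∀ θ, legInt n x θ ≤ ((1 + x) ^ n)⁻¹ := by
    intro θ
    unfold legInt
    set D := 1 + x * sin θ ^ 2 with hD
    have hD1 : 1 ≤ D := by rw [hD]; nlinarith [mul_nonneg hx (sq_nonneg (sin θ))]
    have hD0 : 0 < D := by linarith
    have h1 : D ^ (-((n : ℝ) + 1 / 2)) ≤ (D ^ n)⁻¹ := by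
      rw [← Real.rpow_natCast, ← Real.rpow_neg hD0.le]
      exact rpow_le_rpow_of_exponent_le hD1 (by linarith)
    have h2 : sin θ ^ 2 * (1 + x) ≤ D := by
      rw [hD]; nlinarith [sin_sq_le_one θ]
    calc sin θ ^ (2 * n) * D ^ (-((n : ℝ) + 1 / 2)) ≤ (sin θ ^ 2) ^ n * (D ^ n)⁻¹ := by
          rw [pow_mul]; gcongr
      _ = (sin θ ^ 2 / D) ^ n := by rw [div_pow, div_eq_mul_inv]
      _ ≤ ((1 + x)⁻¹) ^ n := by
          gcongr
          rw [div_le_iff₀ hD0, inv_mul_eq_div, le_div_iff₀ (by linarith)]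
          exact h2
      _ = _ := by rw [inv_pow]
  unfold legG
  have h := intervalIntegral.integral_mono_on (μ := volume) (a := 0) (b := π / 2) (by positivity)
    ((continuous_legInt n hx').intervalIntegrable _ _) intervalIntegrable_const
    (g := fun _ => ((1 + x) ^ n)⁻¹) (fun θ _ => hb θ)
  rw [intervalIntegral.integral_const, sub_zero, smul_eq_mul] at h
  calc _ ≤ 2 / π * (π / 2 * ((1 + x) ^ n)⁻¹) := by gcongr
    _ = _ := by field_simp

lemma legG_ode {x : ℝ} (hx : -1 < x) :
    x * (1 + x) * (3 / 4 * legG 2 x) - (1 + 2 * x) * (1 / 2 * legG 1 x) + 1 / 4 * legG 0 x = 0 := by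
  have hi : ∀ n, IntervalIntegrable (legInt n x) volume 0 (π / 2) := fun n =>
    (continuous_legInt n hx).intervalIntegrable _ _
  have hd : ∀ θ ∈ uIcc 0 (π / 2), HasDerivAt
      (fun θ => 1 / 4 * (sin θ * cos θ * (1 + x * sin θ ^ 2) ^ (-(3 / 2) : ℝ)))
      (x * (1 + x) * (3 / 4) * legInt 2 x θ - (1 + 2 * x) * (1 / 2) * legInt 1 x θ +
        1 / 4 * legInt 0 x θ) θ := by
    intro θ _
    have hD := legDelta_pos (θ := θ) hx
    have h1 : HasDerivAt (fun θ => 1 + x * sin θ ^ 2) (x * (2 * sin θ * cos θ)) θ := by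
      simpa using (((hasDerivAt_sin θ).pow 2).const_mul x).const_add 1
    have h2 := h1.rpow_const (p := -(3 / 2)) (Or.inl hD.ne')
    have h3 := ((((hasDerivAt_sin θ).mul (hasDerivAt_cos θ)).mul h2)).const_mul (1 / 4)
    refine h3.congr_deriv ?_
    unfold legInt
    have e : ∀ k : ℕ, (1 + x * sin θ ^ 2) ^ (-((5 : ℝ) / 2) + k) =
        (1 + x * sin θ ^ 2) ^ (-((5 : ℝ) / 2)) * (1 + x * sin θ ^ 2) ^ k := fun k => by
      rw [Real.rpow_add hD, Real.rpow_natCast]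
    have e1 := e 1
    have e2 := e 2
    have hc : cos θ ^ 2 = 1 - sin θ ^ 2 := cos_sq' θ
    norm_num at e1 e2 ⊢
    rw [e1, e2]
    ring_nf
    rw [hc]
    ring
  have key := intervalIntegral.integral_eq_sub_of_hasDerivAt hd
    ((((hi 2).const_mul _).sub ((hi 1).const_mul _)).add ((hi 0).const_mul _))
  rw [intervalIntegral.integral_add (((hi 2).const_mul _).sub ((hi 1).const_mul _))
      ((hi 0).const_mul _),
    intervalIntegral.integral_sub ((hi 2).const_mul _) ((hi 1).const_mul _)] at key
  simp only [intervalIntegral.integral_const_mul, cos_pi_div_two, sin_zero] at key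
  unfold legG
  linear_combination (2 / π) * key

lemma legG_zero_zero : legG 0 0 = 1 := by
  simp [legG, legInt]

lemma legG_one_zero : legG 1 0 = 1 / 2 := by
  simp [legG, legInt, integral_sin_sq]
  field_simp

/-- The radial kernel function and its derivatives in terms of `z`. -/
def Lg0 (z : ℝ) : ℝ := legG 0 ((z - 1) / 2)
def Lg1 (z : ℝ) : ℝ := -(1 / 4) * legG 1 ((z - 1) / 2)
def Lg2 (z : ℝ) : ℝ := 3 / 16 * legG 2 ((z - 1) / 2)
def Lg3 (z : ℝ) : ℝ := -(15 / 64) * legG 3 ((z - 1) / 2)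

lemma legG_comp_hasDerivAt (n : ℕ) {z : ℝ} (hz : -1 < z) :
    HasDerivAt (fun z => legG n ((z - 1) / 2))
      (-((n : ℝ) + 1 / 2) / 2 * legG (n + 1) ((z - 1) / 2)) z := by
  have h1 : HasDerivAt (fun z : ℝ => (z - 1) / 2) (1 / 2) z :=
    ((hasDerivAt_id z).sub_const 1).div_const 2
  refine HasDerivAt.congr_deriv (HasDerivAt.comp z (h₂ := legG n)
    (legG_hasDerivAt n (x := (z - 1) / 2) (by linarith)) h1) ?_
  ring

lemma Lg0_hasDerivAt {z : ℝ} (hz : -1 < z) : HasDerivAt Lg0 (Lg1 z) z :=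
  (legG_comp_hasDerivAt 0 hz).congr_deriv (by unfold Lg1; push_cast; ring)

lemma Lg1_hasDerivAt {z : ℝ} (hz : -1 < z) : HasDerivAt Lg1 (Lg2 z) z :=
  ((legG_comp_hasDerivAt 1 hz).const_mul _).congr_deriv (by unfold Lg2; push_cast; ring)

lemma Lg2_hasDerivAt {z : ℝ} (hz : -1 < z) : HasDerivAt Lg2 (Lg3 z) z :=
  ((legG_comp_hasDerivAt 2 hz).const_mul _).congr_deriv (by unfold Lg3; push_cast; ring)

lemma Lg_ode {z : ℝ} (hz : -1 < z) :
    (z ^ 2 - 1) * Lg2 z + 2 * z * Lg1 z + 1 / 4 * Lg0 z = 0 := by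
  have h := legG_ode (x := (z - 1) / 2) (by linarith)
  unfold Lg2 Lg1 Lg0
  linear_combination h

lemma Lg_ode' {z : ℝ} (hz : -1 < z) :
    (z ^ 2 - 1) * Lg3 z + 4 * z * Lg2 z + 9 / 4 * Lg1 z = 0 := by
  have h0 : HasDerivAt (fun z => (z ^ 2 - 1) * Lg2 z + 2 * z * Lg1 z + 1 / 4 * Lg0 z) 0 z := by
    refine (hasDerivAt_const z (0 : ℝ)).congr_of_eventuallyEq ?_
    filter_upwards [Ioi_mem_nhds hz] with w hw using Lg_ode hw
  have h1 : HasDerivAt (fun z : ℝ => z ^ 2 - 1) (2 * z) z := by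
    simpa using (hasDerivAt_pow 2 z).sub_const 1
  have h2 : HasDerivAt (fun z : ℝ => 2 * z) 2 z := by
    simpa using (hasDerivAt_id z).const_mul 2
  have h3 := ((h1.mul (Lg2_hasDerivAt hz)).add (h2.mul (Lg1_hasDerivAt hz))).add
    ((Lg0_hasDerivAt hz).const_mul (1 / 4))
  have := h0.unique h3
  linear_combination -this

lemma legG_comp_le (n : ℕ) {z : ℝ} (hz : 1 ≤ z) :
    |legG n ((z - 1) / 2)| ≤ 2 ^ n * (z ^ n)⁻¹ := by
  rw [abs_of_nonneg (legG_nonneg n (by linarith))]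
  refine (legG_le n (by linarith)).trans ?_
  rw [show (2 : ℝ) ^ n * (z ^ n)⁻¹ = ((z / 2) ^ n)⁻¹ by rw [div_pow, inv_div, div_eq_mul_inv]]
  gcongr
  linarith

def LB0 (z : ℝ) : ℝ := z * Lg1 z + 1 / 2 * Lg0 z
def LB1 (z : ℝ) : ℝ := z * Lg2 z + 3 / 2 * Lg1 z
def LB2 (z : ℝ) : ℝ := z * Lg3 z + 5 / 2 * Lg2 z
def LP1 (z : ℝ) : ℝ := z * Lg0 z + 2 * (z ^ 2 - 1) * Lg1 z
def LA0 (z : ℝ) : ℝ := z * LB0 z + 3 / 2 * LP1 z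
def LA1 (z : ℝ) : ℝ := z * LB1 z + 5 / 2 * LB0 z
def LA2 (z : ℝ) : ℝ := z * LB2 z + 7 / 2 * LB1 z

section
variable {z : ℝ}

lemma LB0_hasDerivAt (hz : -1 < z) : HasDerivAt LB0 (LB1 z) z :=
  (((hasDerivAt_id' z).mul (Lg1_hasDerivAt hz)).add
    ((Lg0_hasDerivAt hz).const_mul (1 / 2))).congr_deriv (by unfold LB1; ring)

lemma LB1_hasDerivAt (hz : -1 < z) : HasDerivAt LB1 (LB2 z) z :=
  (((hasDerivAt_id' z).mul (Lg2_hasDerivAt hz)).add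
    ((Lg1_hasDerivAt hz).const_mul (3 / 2))).congr_deriv (by unfold LB2; ring)

lemma LP1_hasDerivAt (hz : -1 < z) : HasDerivAt LP1 (LB0 z) z := by
  have h1 : HasDerivAt (fun z : ℝ => 2 * (z ^ 2 - 1)) (4 * z) z :=
    (((hasDerivAt_pow 2 z).sub_const 1).const_mul 2).congr_deriv (by norm_num; ring)
  refine (((hasDerivAt_id' z).mul (Lg0_hasDerivAt hz)).add
    (h1.mul (Lg1_hasDerivAt hz))).congr_deriv ?_
  have := Lg_ode hz
  unfold LB0; linear_combination 2 * this

lemma LA0_hasDerivAt (hz : -1 < z) : HasDerivAt LA0 (LA1 z) z :=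
  (((hasDerivAt_id' z).mul (LB0_hasDerivAt hz)).add
    ((LP1_hasDerivAt hz).const_mul (3 / 2))).congr_deriv (by unfold LA1; ring)

lemma LA1_hasDerivAt (hz : -1 < z) : HasDerivAt LA1 (LA2 z) z :=
  (((hasDerivAt_id' z).mul (LB1_hasDerivAt hz)).add
    ((LB0_hasDerivAt hz).const_mul (5 / 2))).congr_deriv (by unfold LA2; ring)

lemma LB_ode (hz : -1 < z) : (z ^ 2 - 1) * LB2 z + 4 * z * LB1 z + 5 / 4 * LB0 z = 0 := by
  have h0 := Lg_ode hz
  have h1 := Lg_ode' hz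
  unfold LB2 LB1 LB0
  linear_combination z * h1 + 5 / 2 * h0

lemma LP_rel (hz : -1 < z) : 3 / 4 * LP1 z = (z ^ 2 - 1) * LB1 z + 2 * z * LB0 z := by
  have h0 := Lg_ode hz
  unfold LP1 LB1 LB0
  linear_combination (-z) * h0

lemma LA_ode (hz : -1 < z) : (z ^ 2 - 1) * LA2 z + 4 * z * LA1 z - 7 / 4 * LA0 z = 0 := by
  have h0 := LB_ode hz
  have h1 := LP_rel hz
  unfold LA2 LA1 LA0
  linear_combination z * h0 - 7 / 2 * h1

lemma LA_rel (hz : -1 < z) : 2 * z * LA1 z = LA0 z + 2 * LB1 z := by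
  have h1 := LP_rel hz
  unfold LA1 LA0
  linear_combination -2 * h1

lemma LB_rel (hz : -1 < z) : z * LB1 z + 1 / 2 * LB0 z = Lg2 z := by
  have h0 := Lg_ode hz
  unfold LB1 LB0
  linear_combination h0

lemma LB_rel' (hz : -1 < z) : z * LB2 z + 3 / 2 * LB1 z = Lg3 z := by
  have h0 := Lg_ode' hz
  unfold LB2 LB1
  linear_combination h0

lemma LA_rel' (hz : -1 < z) : 2 * z * LA2 z = 2 * LB2 z - LA1 z := by
  have h0 := LB_ode hz
  unfold LA2 LA1
  linear_combination 2 * h0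

end

lemma Lg0_abs_le {z : ℝ} (hz : 1 ≤ z) : |Lg0 z| ≤ 1 := by
  simpa [Lg0] using legG_comp_le 0 hz

lemma Lg1_abs_le {z : ℝ} (hz : 1 ≤ z) : |Lg1 z| ≤ 1 / 2 * z⁻¹ := by
  have := legG_comp_le 1 hz
  simp only [pow_one] at this
  rw [Lg1, abs_mul, abs_of_neg (by norm_num : (-(1 / 4) : ℝ) < 0)]; linarith

lemma Lg2_abs_le {z : ℝ} (hz : 1 ≤ z) : |Lg2 z| ≤ 3 / 4 * (z⁻¹) ^ 2 := by
  have := legG_comp_le 2 hz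
  rw [inv_pow, Lg2, abs_mul, abs_of_pos (by norm_num : (3 / 16 : ℝ) > 0)]; linarith

lemma Lg3_abs_le {z : ℝ} (hz : 1 ≤ z) : |Lg3 z| ≤ 15 / 8 * (z⁻¹) ^ 3 := by
  have := legG_comp_le 3 hz
  rw [inv_pow, Lg3, abs_mul, abs_of_neg (by norm_num : (-(15 / 64) : ℝ) < 0)]; linarith

section
variable {z : ℝ}

lemma abs_mul_add_le {a b c x y X Y : ℝ} (hx : |x| ≤ X) (hy : |y| ≤ Y)
    (h : |a| * X + |b| * Y ≤ c) : |a * x + b * y| ≤ c := by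
  refine (abs_add_le _ _).trans ?_
  rw [abs_mul, abs_mul]
  have h1 := mul_le_mul_of_nonneg_left hx (abs_nonneg a)
  have h2 := mul_le_mul_of_nonneg_left hy (abs_nonneg b)
  linarith

lemma LB0_abs_le (hz : 1 ≤ z) : |LB0 z| ≤ 1 := by
  have hz0 : 0 < z := by linarith
  refine abs_mul_add_le (Lg1_abs_le hz) (Lg0_abs_le hz) ?_
  rw [abs_of_pos hz0, abs_of_pos (by norm_num)]
  field_simp; norm_num

lemma LB1_abs_le (hz : 1 ≤ z) : |LB1 z| ≤ 3 / 2 * z⁻¹ := by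
  have hz0 : 0 < z := by linarith
  refine abs_mul_add_le (Lg2_abs_le hz) (Lg1_abs_le hz) ?_
  rw [abs_of_pos hz0, abs_of_pos (by norm_num)]
  field_simp; norm_num

lemma LB2_abs_le (hz : 1 ≤ z) : |LB2 z| ≤ 15 / 4 * z⁻¹ ^ 2 := by
  have hz0 : 0 < z := by linarith
  refine abs_mul_add_le (Lg3_abs_le hz) (Lg2_abs_le hz) ?_
  rw [abs_of_pos hz0, abs_of_pos (by norm_num)]
  field_simp; norm_num

lemma LA1_abs_le (hz : 1 ≤ z) : |LA1 z| ≤ 4 := by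
  have hz0 : 0 < z := by linarith
  refine abs_mul_add_le (LB1_abs_le hz) (LB0_abs_le hz) ?_
  rw [abs_of_pos hz0, abs_of_pos (by norm_num)]
  field_simp; norm_num

lemma LA2_abs_le (hz : 1 ≤ z) : |LA2 z| ≤ 9 * z⁻¹ := by
  have hz0 : 0 < z := by linarith
  refine abs_mul_add_le (LB2_abs_le hz) (LB1_abs_le hz) ?_
  rw [abs_of_pos hz0, abs_of_pos (by norm_num)]
  field_simp; norm_num

end

lemma Lg0_one : Lg0 1 = 1 := by simp [Lg0, legG_zero_zero]
lemma Lg1_one : Lg1 1 = -(1 / 8) := by simp [Lg1, legG_one_zero]; norm_num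
lemma LB0_one : LB0 1 = 3 / 8 := by rw [LB0, Lg0_one, Lg1_one]; norm_num
lemma LA0_one : LA0 1 = 15 / 8 := by
  rw [LA0, LP1, LB0_one, Lg0_one, Lg1_one]; norm_num

/-- The argument of the kernel. -/
def zK (s p q : ℝ) : ℝ := (p * q + s ^ 2) / (s * (p + q))
def zKq (s p q : ℝ) : ℝ := (p ^ 2 - s ^ 2) / (s * (p + q) ^ 2)

/-- The kernel, a solution of `k_pq = (15/4)(p+q)⁻² k`. -/
def kK (s p q : ℝ) : ℝ := √s * (2 * LA0 (zK s p q) / (p + q) - LB0 (zK s p q) / s)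
def kKq (s p q : ℝ) : ℝ :=
  √s * (2 * (LA1 (zK s p q) * zKq s p q) / (p + q) - 2 * LA0 (zK s p q) / (p + q) ^ 2
    - LB1 (zK s p q) * zKq s p q / s)
/-- The derivatives of the kernel with respect to its parameter. -/
def kKs (s p q : ℝ) : ℝ :=
  √s * (4 * LA1 (zK s p q) / (p + q) ^ 2 - 4 * LB1 (zK s p q) / ((p + q) * s)
    + Lg2 (zK s p q) / s ^ 2)
def kKsq (s p q : ℝ) : ℝ :=
  √s * (4 * (LA2 (zK s p q) * zKq s p q) / (p + q) ^ 2 - 8 * LA1 (zK s p q) / (p + q) ^ 3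
    - 4 * (LB2 (zK s p q) * zKq s p q) / ((p + q) * s) + 4 * LB1 (zK s p q) / ((p + q) ^ 2 * s)
    + Lg3 (zK s p q) * zKq s p q / s ^ 2)

section
variable {s p q : ℝ}

lemma zK_pos (hs : 0 < s) (hp : 0 < p) (hq : 0 < q) : 0 < zK s p q := by
  unfold zK; positivity

lemma zK_gt (hs : 0 < s) (hp : 0 < p) (hq : 0 < q) : -1 < zK s p q := by
  linarith [zK_pos hs hp hq]

lemma zK_comm : zK s p q = zK s q p := by
  unfold zK; rw [mul_comm p q, add_comm p q]

lemma zK_hasDerivAt_q (hs : 0 < s) (hp : 0 < p) (hq : 0 < q) :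
    HasDerivAt (fun q => zK s p q) (zKq s p q) q := by
  have h1 : HasDerivAt (fun q => p * q + s ^ 2) p q := by
    simpa using ((hasDerivAt_id q).const_mul p).add_const (s ^ 2)
  have h2 : HasDerivAt (fun q => s * (p + q)) s q := by
    simpa using ((hasDerivAt_id q).const_add p).const_mul s
  have hpq : p + q ≠ 0 := by positivity
  refine (h1.div h2 (by positivity)).congr_deriv ?_
  unfold zKq; field_simp; ring

lemma zK_hasDerivAt_p (hs : 0 < s) (hp : 0 < p) (hq : 0 < q) :
    HasDerivAt (fun p => zK s p q) (zKq s q p) p := by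
  have := zK_hasDerivAt_q hs hq hp
  simpa only [zK_comm (p := q)] using this

lemma zK_hasDerivAt_s (hs : 0 < s) (hp : 0 < p) (hq : 0 < q) :
    HasDerivAt (fun s => zK s p q) (2 / (p + q) - zK s p q / s) s := by
  have h1 : HasDerivAt (fun s => p * q + s ^ 2) (2 * s) s := by
    simpa using (hasDerivAt_pow 2 s).const_add (p * q)
  have h2 : HasDerivAt (fun s => s * (p + q)) (p + q) s := by
    simpa using (hasDerivAt_id s).mul_const (p + q)
  have hpq : p + q ≠ 0 := by positivity
  refine (h1.div h2 (by positivity)).congr_deriv ?_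
  unfold zK; field_simp

lemma zKq_hasDerivAt_p (hs : 0 < s) (hp : 0 < p) (hq : 0 < q) :
    HasDerivAt (fun p => zKq s p q) (2 * zK s p q / (p + q) ^ 2) p := by
  have h1 : HasDerivAt (fun p => p ^ 2 - s ^ 2) (2 * p) p := by
    simpa using (hasDerivAt_pow 2 p).sub_const (s ^ 2)
  have h2 : HasDerivAt (fun p => s * (p + q) ^ 2) (s * (2 * (p + q))) p := by
    simpa using (((hasDerivAt_id p).add_const q).pow 2).const_mul s
  have hpq : p + q ≠ 0 := by positivity
  refine (h1.div h2 (by positivity)).congr_deriv ?_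
  unfold zK; field_simp; ring

lemma zKq_hasDerivAt_s (hs : 0 < s) (hp : 0 < p) (hq : 0 < q) :
    HasDerivAt (fun s => zKq s p q) (-zKq s p q / s - 2 / (p + q) ^ 2) s := by
  have h1 : HasDerivAt (fun s => p ^ 2 - s ^ 2) (-(2 * s)) s := by
    simpa using (hasDerivAt_pow 2 s).const_sub (p ^ 2)
  have h2 : HasDerivAt (fun s => s * (p + q) ^ 2) ((p + q) ^ 2) s := by
    simpa using (hasDerivAt_id s).mul_const ((p + q) ^ 2)
  have hpq : p + q ≠ 0 := by positivity
  refine (h1.div h2 (by positivity)).congr_deriv ?_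
  unfold zKq; field_simp; ring

lemma kK_hasDerivAt_q (hs : 0 < s) (hp : 0 < p) (hq : 0 < q) :
    HasDerivAt (fun q => kK s p q) (kKq s p q) q := by
  have hz := zK_hasDerivAt_q hs hp hq
  have hz1 := zK_gt hs hp hq
  have hA := (LA0_hasDerivAt hz1).comp q hz
  have hB := (LB0_hasDerivAt hz1).comp q hz
  have h2 : HasDerivAt (fun q => p + q) 1 q := (hasDerivAt_id q).const_add p
  have hpq : p + q ≠ 0 := by positivity
  refine ((((hA.const_mul 2).div h2 hpq).sub (hB.div_const s)).const_mul √s).congr_deriv ?_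
  simp only [Function.comp_apply]
  unfold kKq; field_simp

lemma kKq_hasDerivAt_p (hs : 0 < s) (hp : 0 < p) (hq : 0 < q) :
    HasDerivAt (fun p => kKq s p q) (15 / 4 / (p + q) ^ 2 * kK s p q) p := by
  have hz := zK_hasDerivAt_p hs hp hq
  have hzq := zKq_hasDerivAt_p hs hp hq
  have hz1 := zK_gt hs hp hq
  have hA := (LA0_hasDerivAt hz1).comp p hz
  have hA1 := (LA1_hasDerivAt hz1).comp p hz
  have hB1 := (LB1_hasDerivAt hz1).comp p hz
  have hpq : p + q ≠ 0 := by positivity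
  have h2 : HasDerivAt (fun p => p + q) 1 p := (hasDerivAt_id p).add_const q
  have h3 : HasDerivAt (fun p => (p + q) ^ 2) (2 * (p + q)) p := by
    simpa using h2.fun_pow 2
  refine ((((((hA1.mul hzq).const_mul 2).div h2 hpq).sub
    ((hA.const_mul 2).div h3 (by positivity))).sub
    ((hB1.mul hzq).div_const s)).const_mul √s).congr_deriv ?_
  simp only [Function.comp_apply, Pi.mul_apply]
  have e1 : zKq s q p * zKq s p q * (p + q) ^ 2 = zK s p q ^ 2 - 1 := by
    unfold zK zKq; rw [add_comm q p]; field_simp; ring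
  have e2 : zKq s q p + zKq s p q = 1 / s - 2 * zK s p q / (p + q) := by
    unfold zK zKq; rw [add_comm q p]; field_simp; ring
  have o1 := LA_ode hz1
  have o2 := LB_ode hz1
  have o3 : LA1 (zK s p q) = zK s p q * LB1 (zK s p q) + 5 / 2 * LB0 (zK s p q) := rfl
  unfold kK
  generalize zKq s q p = a at *
  generalize zKq s p q = b at *
  generalize zK s p q = z at *
  obtain ⟨i, hi⟩ : ∃ i, i = (p + q)⁻¹ := ⟨_, rfl⟩
  obtain ⟨j, hj⟩ : ∃ j, j = s⁻¹ := ⟨_, rfl⟩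
  have e1' : a * b = (z ^ 2 - 1) * i ^ 2 := by rw [hi]; field_simp; linarith
  have e2' : a + b = j - 2 * z * i := by rw [e2, hi, hj]; field_simp
  have hi1 : (p + q) * i = 1 := by rw [hi]; field_simp
  trans √s * (2 * (LA2 z * a * b + LA1 z * (2 * z * i ^ 2)) * i - 2 * LA1 z * b * i ^ 2
    - (2 * LA1 z * a * i ^ 2 - 4 * LA0 z * i ^ 3) - (LB2 z * a * b + LB1 z * (2 * z * i ^ 2)) * j)
  · rw [hi, hj]; field_simp; ring
  trans 15 / 4 * i ^ 2 * (√s * (2 * LA0 z * i - LB0 z * j))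
  · linear_combination √s * ((2 * LA2 z * i - LB2 z * j) * e1' - 2 * LA1 z * i ^ 2 * e2'
      + 2 * i ^ 3 * o1 - j * i ^ 2 * o2 - 2 * j * i ^ 2 * o3)
  · rw [hi, hj]; field_simp

lemma kK_hasDerivAt_s (hs : 0 < s) (hp : 0 < p) (hq : 0 < q) :
    HasDerivAt (fun s => kK s p q) (kKs s p q) s := by
  have hz := zK_hasDerivAt_s hs hp hq
  have hz1 := zK_gt hs hp hq
  have hA := (LA0_hasDerivAt hz1).comp s hz
  have hB := (LB0_hasDerivAt hz1).comp s hz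
  have hpq : p + q ≠ 0 := by positivity
  refine ((hasDerivAt_sqrt hs.ne').mul (((hA.const_mul 2).div_const (p + q)).sub
    (hB.div (hasDerivAt_id s) hs.ne'))).congr_deriv ?_
  simp only [Function.comp_apply, Pi.sub_apply, Pi.div_apply, id]
  have o1 := LA_rel hz1
  have o2 := LB_rel hz1
  unfold kKs
  generalize zK s p q = z at *
  obtain ⟨r, hr⟩ : ∃ r, r = √s := ⟨_, rfl⟩
  have hr0 : 0 < r := by rw [hr]; positivity
  have hrs : s = r ^ 2 := by rw [hr, sq_sqrt hs.le]
  rw [← hr, hrs, ← o2]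
  field_simp
  linear_combination -2 * r ^ 2 * (p + q) * o1

lemma kKq_hasDerivAt_s (hs : 0 < s) (hp : 0 < p) (hq : 0 < q) :
    HasDerivAt (fun s => kKq s p q) (kKsq s p q) s := by
  have hz := zK_hasDerivAt_s hs hp hq
  have hzq := zKq_hasDerivAt_s hs hp hq
  have hz1 := zK_gt hs hp hq
  have hA := (LA0_hasDerivAt hz1).comp s hz
  have hA1 := (LA1_hasDerivAt hz1).comp s hz
  have hB1 := (LB1_hasDerivAt hz1).comp s hz
  have hpq : p + q ≠ 0 := by positivity
  refine ((hasDerivAt_sqrt hs.ne').mul (((((hA1.mul hzq).const_mul 2).div_const (p + q)).sub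
    ((hA.const_mul 2).div_const ((p + q) ^ 2))).sub
    ((hB1.mul hzq).div (hasDerivAt_id s) hs.ne'))).congr_deriv ?_
  simp only [Function.comp_apply, Pi.sub_apply, Pi.div_apply, Pi.mul_apply, id]
  have o1 := LA_rel hz1
  have o2 := LB_rel' hz1
  have o3 := LA_rel' hz1
  unfold kKsq
  generalize zK s p q = z at *
  generalize zKq s p q = b at *
  obtain ⟨r, hr⟩ : ∃ r, r = √s := ⟨_, rfl⟩
  have hr0 : 0 < r := by rw [hr]; positivity
  have hrs : s = r ^ 2 := by rw [hr, sq_sqrt hs.le]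
  rw [← hr, hrs, ← o2]
  field_simp
  linear_combination -2 * b * (p + q) ^ 2 * r ^ 2 * o3 + 2 * (p + q) * r ^ 2 * o1

end

section
variable {s p q : ℝ}

lemma one_le_zK (hs : 0 < s) (hsp : s ≤ p) (hpq : p ≤ q) : 1 ≤ zK s p q := by
  unfold zK
  rw [one_le_div (by nlinarith)]
  nlinarith [mul_nonneg (sub_nonneg.2 hsp) (sub_nonneg.2 (hsp.trans hpq))]

lemma inv_zK_le (hs : 0 < s) (hsp : s ≤ p) (hpq : p ≤ q) : (zK s p q)⁻¹ ≤ 2 * s / p := by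
  have hp := hs.trans_le hsp
  have hq := hp.trans_le hpq
  unfold zK
  rw [inv_div, div_le_div_iff₀ (by positivity) hp]
  nlinarith [mul_nonneg hp.le (sub_nonneg.2 hpq), mul_pos hs hp, pow_pos hs 3,
    mul_nonneg (mul_nonneg hs.le hp.le) (sub_nonneg.2 hpq)]

lemma zKq_nonneg (hs : 0 < s) (hsp : s ≤ p) : 0 ≤ zKq s p q := by
  unfold zKq
  have : s ^ 2 ≤ p ^ 2 := by gcongr
  exact div_nonneg (by linarith) (by positivity)

lemma zKq_le (hs : 0 < s) (hsp : s ≤ p) (hpq : p ≤ q) : zKq s p q ≤ p ^ 2 / (s * q ^ 2) := by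
  have hp := hs.trans_le hsp
  have hq := hp.trans_le hpq
  unfold zKq
  gcongr
  · nlinarith
  · linarith

lemma kKs_abs_le (hs : 0 < s) (hsp : s ≤ p) (hpq : p ≤ q) :
    |kKs s p q| ≤ 31 * √s / p ^ 2 := by
  have hp := hs.trans_le hsp
  have hq := hp.trans_le hpq
  have hz := one_le_zK hs hsp hpq
  have hi := inv_zK_le hs hsp hpq
  have hz0 : 0 < (zK s p q)⁻¹ := by positivity
  have h1 := LA1_abs_le hz
  have h2 := (LB1_abs_le hz).trans (mul_le_mul_of_nonneg_left hi (by norm_num))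
  have h3 := (Lg2_abs_le hz).trans (mul_le_mul_of_nonneg_left
    (pow_le_pow_left₀ hz0.le hi 2) (by norm_num))
  have hpq' : p ≤ p + q := by linarith
  unfold kKs
  rw [abs_mul, abs_of_nonneg (sqrt_nonneg s)]
  have t1 : |4 * LA1 (zK s p q) / (p + q) ^ 2| ≤ 16 / p ^ 2 := by
    rw [abs_div, abs_mul, abs_of_pos (by positivity : 0 < (p + q) ^ 2),
      abs_of_pos (by norm_num : (0 : ℝ) < 4)]
    gcongr; linarith
  have t2 : |4 * LB1 (zK s p q) / ((p + q) * s)| ≤ 12 / p ^ 2 := by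
    rw [abs_div, abs_mul, abs_of_pos (by positivity : 0 < (p + q) * s),
      abs_of_pos (by norm_num : (0 : ℝ) < 4)]
    calc _ ≤ 4 * (3 / 2 * (2 * s / p)) / (p * s) := by gcongr
      _ = _ := by field_simp; norm_num
  have t3 : |Lg2 (zK s p q) / s ^ 2| ≤ 3 / p ^ 2 := by
    rw [abs_div, abs_of_pos (by positivity : 0 < s ^ 2)]
    calc _ ≤ 3 / 4 * (2 * s / p) ^ 2 / s ^ 2 := by gcongr
      _ = _ := by field_simp; norm_num
  have t4 : |4 * LA1 (zK s p q) / (p + q) ^ 2 - 4 * LB1 (zK s p q) / ((p + q) * s)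
    + Lg2 (zK s p q) / s ^ 2| ≤ 31 / p ^ 2 := by
    have := (abs_add_le _ (Lg2 (zK s p q) / s ^ 2)).trans (add_le_add (abs_sub
      (4 * LA1 (zK s p q) / (p + q) ^ 2) (4 * LB1 (zK s p q) / ((p + q) * s))) le_rfl)
    refine this.trans ?_
    calc _ ≤ 16 / p ^ 2 + 12 / p ^ 2 + 3 / p ^ 2 := by linarith
      _ = _ := by ring
  calc _ ≤ √s * (31 / p ^ 2) := by gcongr
    _ = _ := by ring

lemma kKsq_abs_le (hs : 0 < s) (hsp : s ≤ p) (hpq : p ≤ q) :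
    |kKsq s p q| ≤ 191 * √s / (p * q ^ 2) := by
  have hp := hs.trans_le hsp
  have hq := hp.trans_le hpq
  have hz := one_le_zK hs hsp hpq
  have hi := inv_zK_le hs hsp hpq
  have hz0 : 0 < (zK s p q)⁻¹ := by positivity
  have hb0 := zKq_nonneg (q := q) hs hsp
  have hb := zKq_le hs hsp hpq
  have h1 := LA1_abs_le hz
  have h2 := (LB1_abs_le hz).trans (mul_le_mul_of_nonneg_left hi (by norm_num))
  have h3 := (Lg3_abs_le hz).trans (mul_le_mul_of_nonneg_left
    (pow_le_pow_left₀ hz0.le hi 3) (by norm_num))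
  have h4 := (LA2_abs_le hz).trans (mul_le_mul_of_nonneg_left hi (by norm_num))
  have h5 := (LB2_abs_le hz).trans (mul_le_mul_of_nonneg_left
    (pow_le_pow_left₀ hz0.le hi 2) (by norm_num))
  have hpq' : q ≤ p + q := by linarith
  unfold kKsq
  rw [abs_mul, abs_of_nonneg (sqrt_nonneg s)]
  generalize LA1 (zK s p q) = a1 at *
  generalize LA2 (zK s p q) = a2 at *
  generalize LB1 (zK s p q) = b1 at *
  generalize LB2 (zK s p q) = b2 at *
  generalize Lg3 (zK s p q) = l3 at *
  generalize zKq s p q = b at *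
  have a4 : |(4 : ℝ)| = 4 := abs_of_pos (by norm_num)
  have a8 : |(8 : ℝ)| = 8 := abs_of_pos (by norm_num)
  have t1 : |4 * (a2 * b) / (p + q) ^ 2| ≤ 72 / (p * q ^ 2) := by
    rw [abs_div, abs_mul, abs_mul, a4, abs_of_nonneg hb0, abs_of_pos (by positivity : 0 < (p + q) ^ 2)]
    calc _ ≤ 4 * (9 * (2 * s / p) * (p ^ 2 / (s * q ^ 2))) / q ^ 2 := by gcongr
      _ = 72 / (q * q) * (p / q ^ 2) := by field_simp; norm_num
      _ ≤ 72 / (p * p) * (p / q ^ 2) := by gcongr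
      _ = _ := by field_simp
  have t2 : |8 * a1 / (p + q) ^ 3| ≤ 32 / (p * q ^ 2) := by
    rw [abs_div, abs_mul, a8, abs_of_pos (by positivity : 0 < (p + q) ^ 3)]
    calc _ ≤ 8 * 4 / q ^ 3 := by gcongr
      _ = 32 / (q * q ^ 2) := by field_simp; norm_num
      _ ≤ _ := by gcongr
  have t3 : |4 * (b2 * b) / ((p + q) * s)| ≤ 60 / (p * q ^ 2) := by
    rw [abs_div, abs_mul, abs_mul, a4, abs_of_nonneg hb0, abs_of_pos (by positivity : 0 < (p + q) * s)]
    calc _ ≤ 4 * (15 / 4 * (2 * s / p) ^ 2 * (p ^ 2 / (s * q ^ 2))) / (q * s) := by gcongr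
      _ = 60 / (q * q ^ 2) := by field_simp; norm_num
      _ ≤ _ := by gcongr
  have t4 : |4 * b1 / ((p + q) ^ 2 * s)| ≤ 12 / (p * q ^ 2) := by
    rw [abs_div, abs_mul, a4, abs_of_pos (by positivity : 0 < (p + q) ^ 2 * s)]
    calc _ ≤ 4 * (3 / 2 * (2 * s / p)) / (q ^ 2 * s) := by gcongr
      _ = _ := by field_simp; norm_num
  have t5 : |l3 * b / s ^ 2| ≤ 15 / (p * q ^ 2) := by
    rw [abs_div, abs_mul, abs_of_nonneg hb0, abs_of_pos (by positivity : 0 < s ^ 2)]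
    calc _ ≤ 15 / 8 * (2 * s / p) ^ 3 * (p ^ 2 / (s * q ^ 2)) / s ^ 2 := by gcongr
      _ = _ := by field_simp; norm_num
  have t6 : |4 * (a2 * b) / (p + q) ^ 2 - 8 * a1 / (p + q) ^ 3
    - 4 * (b2 * b) / ((p + q) * s) + 4 * b1 / ((p + q) ^ 2 * s) + l3 * b / s ^ 2| ≤
      191 / (p * q ^ 2) := by
    rw [abs_le] at t1 t2 t3 t4 t5 ⊢
    have : 191 / (p * q ^ 2) = 72 / (p * q ^ 2) + 32 / (p * q ^ 2) + 60 / (p * q ^ 2) +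
      12 / (p * q ^ 2) + 15 / (p * q ^ 2) := by ring
    constructor <;> linarith [t1.1, t2.1, t3.1, t4.1, t5.1, t1.2, t2.2, t3.2, t4.2, t5.2]
  calc _ ≤ √s * (191 / (p * q ^ 2)) := by gcongr
    _ = _ := by ring

variable {s1 : ℝ}

lemma kK_sub_abs_le (hs : 0 < s) (h1 : s ≤ s1) (hsp : s1 ≤ p) (hpq : p ≤ q) :
    |kK s p q - kK s1 p q| ≤ 31 * (s1 * √s1) / p ^ 2 := by
  have hp : 0 < p := by linarith
  have hq : 0 < q := by linarith
  have := (convex_Icc s s1).norm_image_sub_le_of_norm_hasDerivWithin_le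
    (f := fun s => kK s p q) (f' := fun s => kKs s p q) (C := 31 * √s1 / p ^ 2)
    (fun x hx => (kK_hasDerivAt_s (hs.trans_le hx.1) hp hq).hasDerivWithinAt)
    (fun x hx => (kKs_abs_le (hs.trans_le hx.1) (hx.2.trans hsp) hpq).trans (by
      gcongr; exact hx.2)) (right_mem_Icc.2 h1) (left_mem_Icc.2 h1)
  refine this.trans ?_
  rw [Real.norm_eq_abs, abs_sub_comm, abs_of_nonneg (sub_nonneg.2 h1)]
  calc _ ≤ 31 * √s1 / p ^ 2 * s1 := by gcongr; linarith
    _ = _ := by ring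

lemma kKq_sub_abs_le (hs : 0 < s) (h1 : s ≤ s1) (hsp : s1 ≤ p) (hpq : p ≤ q) :
    |kKq s p q - kKq s1 p q| ≤ 191 * (s1 * √s1) / (p * q ^ 2) := by
  have hp : 0 < p := by linarith
  have hq : 0 < q := by linarith
  have := (convex_Icc s s1).norm_image_sub_le_of_norm_hasDerivWithin_le
    (f := fun s => kKq s p q) (f' := fun s => kKsq s p q) (C := 191 * √s1 / (p * q ^ 2))
    (fun x hx => (kKq_hasDerivAt_s (hs.trans_le hx.1) hp hq).hasDerivWithinAt)
    (fun x hx => (kKsq_abs_le (hs.trans_le hx.1) (hx.2.trans hsp) hpq).trans (by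
      gcongr; exact hx.2)) (right_mem_Icc.2 h1) (left_mem_Icc.2 h1)
  refine this.trans ?_
  rw [Real.norm_eq_abs, abs_sub_comm, abs_of_nonneg (sub_nonneg.2 h1)]
  calc _ ≤ 191 * √s1 / (p * q ^ 2) * s1 := by gcongr; linarith
    _ = _ := by ring

lemma zK_edge (hp : 0 < p) (hq : 0 < q) : zK p p q = 1 := by
  unfold zK; field_simp; ring

lemma kK_edge (hp : 0 < p) (hq : 0 < q) :
    kK p p q = √p * (15 / 4 / (p + q) - 3 / 8 / p) := by
  rw [kK, zK_edge hp hq, LA0_one, LB0_one]; ring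

lemma kKq_edge (hp : 0 < p) (hq : 0 < q) :
    kKq p p q = -(√p * (15 / 4 / (p + q) ^ 2)) := by
  have : zKq p p q = 0 := by simp [zKq]
  rw [kKq, zK_edge hp hq, LA0_one, this]; ring

lemma kK_corner (hp : 0 < p) : kK p p p = 3 / 2 / √p := by
  rw [kK_edge hp hp]
  obtain ⟨r, hr⟩ : ∃ r, r = √p := ⟨_, rfl⟩
  have hr0 : 0 < r := by rw [hr]; positivity
  have hrs : p = r ^ 2 := by rw [hr, sq_sqrt hp.le]
  rw [← hr, hrs]; field_simp; norm_num

lemma kK_abs_le (hs : 0 < s) (hsp : s ≤ p) (hpq : p ≤ q) : |kK s p q| ≤ 36 / √p := by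
  have hp : 0 < p := by linarith
  have hq : 0 < q := by linarith
  have h1 := kK_sub_abs_le hs hsp le_rfl hpq
  have h2 : |kK p p q| ≤ 5 / √p := by
    rw [kK_edge hp hq, abs_mul, abs_of_nonneg (sqrt_nonneg p)]
    have : |15 / 4 / (p + q) - 3 / 8 / p| ≤ 5 / p := by
      refine (abs_sub _ _).trans ?_
      rw [abs_of_pos (by positivity), abs_of_pos (by positivity)]
      have : 15 / 4 / (p + q) ≤ 15 / 4 / p := by gcongr; linarith
      calc _ ≤ 15 / 4 / p + 3 / 8 / p := by linarith
        _ = (33 / 8) / p := by ring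
        _ ≤ _ := by gcongr; norm_num
    calc _ ≤ √p * (5 / p) := by gcongr
      _ = 5 * (√p / p) := by ring
      _ = _ := by rw [sqrt_div_self]; ring
  have h3 : 31 * (p * √p) / p ^ 2 = 31 / √p := by
    calc _ = 31 * (√p / p) := by field_simp
      _ = _ := by rw [sqrt_div_self]; ring
  have := abs_add_le (kK s p q - kK p p q) (kK p p q)
  rw [sub_add_cancel] at this
  calc _ ≤ 31 / √p + 5 / √p := by linarith
    _ = _ := by ring

lemma kKq_abs_le (hs : 0 < s) (hsp : s ≤ p) (hpq : p ≤ q) : |kKq s p q| ≤ 195 * √p / q ^ 2 := by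
  have hp : 0 < p := by linarith
  have hq : 0 < q := by linarith
  have h1 := kKq_sub_abs_le hs hsp le_rfl hpq
  have h2 : |kKq p p q| ≤ 4 * √p / q ^ 2 := by
    rw [kKq_edge hp hq, abs_neg, abs_of_nonneg (by positivity)]
    have : 15 / 4 / (p + q) ^ 2 ≤ 4 / q ^ 2 := by gcongr <;> linarith
    calc _ ≤ √p * (4 / q ^ 2) := by gcongr
      _ = _ := by ring
  have h3 : 191 * (p * √p) / (p * q ^ 2) = 191 * √p / q ^ 2 := by
    field_simp
  have := abs_add_le (kKq s p q - kKq p p q) (kKq p p q)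
  rw [sub_add_cancel] at this
  calc _ ≤ 191 * √p / q ^ 2 + 4 * √p / q ^ 2 := by linarith
    _ = _ := by ring

lemma kK_diag_hasDerivAt (hs : 0 < s) (hp : 0 < p) :
    HasDerivAt (fun p => kK s p p) (2 * kKq s p p) p := by
  have h0 : HasDerivAt (fun p => p * p + s ^ 2) (2 * p) p := by
    refine (((hasDerivAt_id' p).mul (hasDerivAt_id' p)).add_const (s ^ 2)).congr_deriv ?_
    ring
  have h2 : HasDerivAt (fun p : ℝ => p + p) 2 p :=
    ((hasDerivAt_id' p).add (hasDerivAt_id' p)).congr_deriv (by norm_num)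
  have h3 : HasDerivAt (fun p => s * (p + p)) (s * 2) p := h2.const_mul s
  have hz : HasDerivAt (fun p => zK s p p) (2 * zKq s p p) p := by
    refine (h0.div h3 (by positivity)).congr_deriv ?_
    unfold zKq; field_simp; ring
  have hz1 := zK_gt hs hp hp
  have hA := HasDerivAt.comp (h₂ := LA0) (h := fun p => zK s p p) p (LA0_hasDerivAt hz1) hz
  have hB := HasDerivAt.comp (h₂ := LB0) (h := fun p => zK s p p) p (LB0_hasDerivAt hz1) hz
  refine ((((hA.const_mul 2).div h2 (by positivity)).sub (hB.div_const s)).const_mul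
    √s).congr_deriv ?_
  simp only [Function.comp_apply]
  unfold kKq; field_simp

end

/-- The open quadrant of null coordinates. -/
def quad : Set (ℝ × ℝ) := Ioi 0 ×ˢ Ioi 0

lemma continuousOn_comp_zK {f : ℝ → ℝ} (hf : ∀ z, -1 < z → ContinuousAt f z) {s : ℝ} (hs : 0 < s) :
    ContinuousOn (fun x : ℝ × ℝ => f (zK s x.1 x.2)) quad := by
  intro x hx
  have h1 : 0 < x.1 := hx.1
  have h2 : 0 < x.2 := hx.2
  have hz : ContinuousAt (fun x : ℝ × ℝ => zK s x.1 x.2) x := by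
    unfold zK
    exact ContinuousAt.div (by fun_prop) (by fun_prop) (by positivity)
  exact (ContinuousAt.comp (g := f) (f := fun x : ℝ × ℝ => zK s x.1 x.2) (x := x) (hf _ (zK_gt hs h1 h2)) hz).continuousWithinAt

lemma kK_continuousOn {s : ℝ} (hs : 0 < s) :
    ContinuousOn (fun x : ℝ × ℝ => kK s x.1 x.2) quad := by
  have hA := continuousOn_comp_zK (fun z hz => (LA0_hasDerivAt hz).continuousAt) hs
  have hB := continuousOn_comp_zK (fun z hz => (LB0_hasDerivAt hz).continuousAt) hs
  unfold kK
  refine continuousOn_const.mul (((continuousOn_const.mul hA).div (by fun_prop) ?_).sub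
    (hB.div_const s))
  intro x hx
  have h1 : 0 < x.1 := hx.1
  have h2 : 0 < x.2 := hx.2
  positivity

lemma kKq_continuousOn {s : ℝ} (hs : 0 < s) :
    ContinuousOn (fun x : ℝ × ℝ => kKq s x.1 x.2) quad := by
  have hA := continuousOn_comp_zK (fun z hz => (LA0_hasDerivAt hz).continuousAt) hs
  have hA1 := continuousOn_comp_zK (fun z hz => (LA1_hasDerivAt hz).continuousAt) hs
  have hB1 := continuousOn_comp_zK (fun z hz => (LB1_hasDerivAt hz).continuousAt) hs
  have h0 : ∀ x ∈ quad, x.1 + x.2 ≠ 0 := by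
    intro x hx
    have h1 : 0 < x.1 := hx.1
    have h2 : 0 < x.2 := hx.2
    positivity
  have hq : ContinuousOn (fun x : ℝ × ℝ => zKq s x.1 x.2) quad := by
    unfold zKq
    refine ContinuousOn.div (by fun_prop) (by fun_prop) fun x hx => ?_
    have := h0 x hx
    positivity
  unfold kKq
  refine continuousOn_const.mul ((((continuousOn_const.mul (hA1.mul hq)).div (by fun_prop) h0).sub
    ((continuousOn_const.mul hA).div (by fun_prop) fun x hx => pow_ne_zero 2 (h0 x hx))).sub
    ((hB1.mul hq).div_const s))

lemma quad_mem_nhds {p q : ℝ} (hp : 0 < p) (hq : 0 < q) : quad ∈ 𝓝 (p, q) :=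
  prod_mem_nhds (Ioi_mem_nhds hp) (Ioi_mem_nhds hq)

lemma ContinuousOn.quad_right {f : ℝ → ℝ → ℝ}
    (hf : ContinuousOn (fun x : ℝ × ℝ => f x.1 x.2) quad) {p : ℝ} (hp : 0 < p) :
    ContinuousOn (f p) (Ioi 0) :=
  hf.comp (f := fun q => (p, q)) (by fun_prop) fun _ hq => ⟨hp, hq⟩

lemma uIcc_subset_Ioi {a b : ℝ} (ha : 0 < a) (hb : 0 < b) : uIcc a b ⊆ Ioi 0 := fun _ hx =>
  (lt_min ha hb).trans_le hx.1

lemma ContinuousOn.intervalIntegrable_Ioi {f : ℝ → ℝ} (hf : ContinuousOn f (Ioi 0)) {a b : ℝ}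
    (ha : 0 < a) (hb : 0 < b) : IntervalIntegrable f volume a b :=
  (hf.mono (uIcc_subset_Ioi ha hb)).intervalIntegrable

lemma hasDerivAt_integral_endpoint {f : ℝ → ℝ → ℝ}
    (hf : ContinuousOn (fun x : ℝ × ℝ => f x.1 x.2) quad) {p a : ℝ} (hp : 0 < p) (ha : 0 < a) :
    HasDerivAt (fun x => ∫ q in a..(a + (x - p)), f x q) (f p a) p := by
  rw [hasDerivAt_iff_isLittleO, Asymptotics.isLittleO_iff]
  intro ε hε
  have hc : ContinuousAt (fun x : ℝ × ℝ => f x.1 x.2) (p, a) :=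
    hf.continuousAt (quad_mem_nhds hp ha)
  have hev : ∀ᶠ x in 𝓝 ((p, a) : ℝ × ℝ), ‖f x.1 x.2 - f p a‖ < ε ∧ x ∈ quad := by
    refine Filter.Eventually.and ?_ (quad_mem_nhds hp ha)
    have := Metric.tendsto_nhds.1 hc ε hε
    simpa only [dist_eq_norm] using this
  obtain ⟨δ, hδ, hb⟩ := Metric.eventually_nhds_iff.1 hev
  filter_upwards [Metric.ball_mem_nhds p hδ] with x hx
  have hx' : |x - p| < δ := by simpa [Real.dist_eq] using hx
  have hmem : ∀ q ∈ uIcc a (a + (x - p)), ‖f x q - f p a‖ < ε ∧ (x, q) ∈ quad := by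
    intro q hq
    apply hb (y := (x, q))
    rw [Prod.dist_eq, Real.dist_eq, Real.dist_eq]
    refine max_lt hx' (lt_of_le_of_lt ?_ hx')
    have := abs_sub_left_of_mem_uIcc hq
    simpa using this
  have hcx : ContinuousOn (f x) (uIcc a (a + (x - p))) := by
    have h0 : 0 < x := (hmem a left_mem_uIcc).2.1
    exact (hf.quad_right h0).mono fun q hq => (hmem q hq).2.2
  have e : (∫ q in a..(a + (x - p)), f x q) - (∫ q in a..(a + (p - p)), f p q)
      - (x - p) • f p a = ∫ q in a..(a + (x - p)), (f x q - f p a) := by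
    rw [intervalIntegral.integral_sub hcx.intervalIntegrable (by simp),
      intervalIntegral.integral_const]
    simp
  rw [e]
  have := intervalIntegral.norm_integral_le_of_norm_le_const (C := ε)
    (f := fun q => f x q - f p a) (a := a) (b := a + (x - p))
    fun q hq => ((hmem q (uIoc_subset_uIcc hq)).1).le
  simpa [Real.norm_eq_abs] using this

lemma hasDerivAt_integral_fixed {f fp : ℝ → ℝ → ℝ}
    (hf : ContinuousOn (fun x : ℝ × ℝ => f x.1 x.2) quad)
    (hfp : ContinuousOn (fun x : ℝ × ℝ => fp x.1 x.2) quad)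
    (hd : ∀ p q, 0 < p → 0 < q → HasDerivAt (fun p => f p q) (fp p q) p)
    {p a b : ℝ} (hp : 0 < p) (ha : 0 < a) (hb : 0 < b) :
    HasDerivAt (fun x => ∫ q in a..b, f x q) (∫ q in a..b, fp p q) p := by
  have hK : IsCompact (Icc (p / 2) (2 * p) ×ˢ uIcc a b) := isCompact_Icc.prod isCompact_uIcc
  have hsub : Icc (p / 2) (2 * p) ×ˢ uIcc a b ⊆ quad :=
    prod_mono (fun x hx => lt_of_lt_of_le (by linarith) hx.1) (uIcc_subset_Ioi ha hb)
  obtain ⟨C, hC⟩ := hK.exists_bound_of_continuousOn (hfp.mono hsub)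
  have hs : Icc (p / 2) (2 * p) ∈ 𝓝 p := Icc_mem_nhds (by linarith) (by linarith)
  have hmeas : ∀ g : ℝ → ℝ → ℝ, ContinuousOn (fun x : ℝ × ℝ => g x.1 x.2) quad → ∀ x, 0 < x →
      IntervalIntegrable (g x) volume a b := fun g hg x hx =>
    (hg.quad_right hx).intervalIntegrable_Ioi ha hb
  refine (intervalIntegral.hasDerivAt_integral_of_dominated_loc_of_deriv_le
    (μ := volume) (F := f) (F' := fp) (bound := fun _ => C) hs ?_ (hmeas f hf p hp)
    (hmeas fp hfp p hp).aestronglyMeasurable_restrict_uIoc ?_ intervalIntegrable_const ?_).2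
  · filter_upwards [Ioi_mem_nhds hp] with x hx
    exact (hmeas f hf x hx).aestronglyMeasurable_restrict_uIoc
  · exact Eventually.of_forall fun q hq x hx => hC (x, q) ⟨hx, uIoc_subset_uIcc hq⟩
  · exact Eventually.of_forall fun q hq x hx => hd x q (lt_of_lt_of_le (by linarith) hx.1)
      (uIcc_subset_Ioi ha hb (uIoc_subset_uIcc hq))

lemma hasDerivAt_integral_moving {f fp : ℝ → ℝ → ℝ}
    (hf : ContinuousOn (fun x : ℝ × ℝ => f x.1 x.2) quad)
    (hfp : ContinuousOn (fun x : ℝ × ℝ => fp x.1 x.2) quad)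
    (hd : ∀ p q, 0 < p → 0 < q → HasDerivAt (fun p => f p q) (fp p q) p)
    {p L : ℝ} (hp : 0 < p) (hL : 0 ≤ L) :
    HasDerivAt (fun x => ∫ q in x..(x + L), f x q)
      (f p (p + L) - f p p + ∫ q in p..(p + L), fp p q) p := by
  have hpL : 0 < p + L := by linarith
  have h1 := hasDerivAt_integral_fixed hf hfp hd hp hp hpL
  have h2 := hasDerivAt_integral_endpoint hf hp hpL
  have h3 := hasDerivAt_integral_endpoint hf hp hp
  refine (((h2.sub h3).add h1)).congr_of_eventuallyEq ?_ 
  filter_upwards [Ioi_mem_nhds hp] with x hx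
  have hx0 : 0 < x := hx
  have hc := hf.quad_right hx0
  have hi : ∀ {a b : ℝ}, 0 < a → 0 < b → IntervalIntegrable (f x) volume a b := fun ha hb =>
    hc.intervalIntegrable_Ioi ha hb
  simp only [Pi.add_apply, Pi.sub_apply]
  rw [show p + L + (x - p) = x + L by ring, show p + (x - p) = x by ring]
  have e1 := intervalIntegral.integral_add_adjacent_intervals (hi hp hx0) (hi hx0 (show 0 < x + L by linarith))
  have e2 := intervalIntegral.integral_add_adjacent_intervals (hi hp hpL) (hi hpL (show 0 < x + L by linarith))
  linarith

lemma continuousOn_integral_moving {g : ℝ → ℝ → ℝ}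
    (hg : ContinuousOn (fun x : ℝ × ℝ => g x.1 x.2) quad) {L : ℝ} (hL : 0 ≤ L) :
    ContinuousOn (fun p => ∫ q in p..(p + L), g p q) (Ioi 0) := by
  have e : (fun p => ∫ q in p..(p + L), g p q) = fun p => ∫ τ in 0..L, g p (p + τ) := by
    funext p
    rw [intervalIntegral.integral_comp_add_left (fun q => g p q), add_zero]
  rw [e]
  intro p hp
  have hp : 0 < p := hp
  refine ContinuousAt.continuousWithinAt ?_
  have hcont : ∀ τ, 0 ≤ τ → ∀ x, 0 < x → ContinuousAt (fun x => g x (x + τ)) x := fun τ hτ x hx =>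
    ContinuousAt.comp (g := fun x : ℝ × ℝ => g x.1 x.2) (f := fun x => (x, x + τ))
      (hg.continuousAt (quad_mem_nhds hx (show 0 < x + τ by linarith))) (by fun_prop)
  have hK : IsCompact (Icc (p / 2) (2 * p) ×ˢ Icc 0 L) := isCompact_Icc.prod isCompact_Icc
  have hG : ContinuousOn (fun x : ℝ × ℝ => g x.1 (x.1 + x.2)) (Icc (p / 2) (2 * p) ×ˢ Icc 0 L) :=
    hg.comp (f := fun x : ℝ × ℝ => (x.1, x.1 + x.2)) (by fun_prop) fun x hx => by
      have h1 : 0 < x.1 := lt_of_lt_of_le (by linarith) hx.1.1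
      exact ⟨h1, show 0 < x.1 + x.2 by linarith [hx.2.1]⟩
  obtain ⟨C, hC⟩ := hK.exists_bound_of_continuousOn hG
  have hs : Icc (p / 2) (2 * p) ∈ 𝓝 p := Icc_mem_nhds (by linarith) (by linarith)
  refine intervalIntegral.continuousAt_of_dominated_interval (bound := fun _ => C) ?_ ?_
    intervalIntegrable_const ?_
  · filter_upwards [hs] with x hx
    refine (ContinuousOn.mono (s := Icc 0 L) ?_ ?_).aestronglyMeasurable measurableSet_uIoc
    · exact hG.comp (f := fun τ => (x, τ)) (by fun_prop) fun τ hτ => ⟨hx, hτ⟩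
    · rw [uIoc_of_le hL]; exact Ioc_subset_Icc_self
  · filter_upwards [hs] with x hx
    refine Eventually.of_forall fun τ hτ => ?_
    rw [uIoc_of_le hL] at hτ
    exact hC (x, τ) ⟨hx, Ioc_subset_Icc_self hτ⟩
  · refine Eventually.of_forall fun τ hτ => ?_
    rw [uIoc_of_le hL] at hτ
    exact hcont τ hτ.1.le p hp

/-- A `C²` function on the quadrant solving the reduced equation in null coordinates. -/
structure NullSol (y yp yq σ : ℝ → ℝ → ℝ) : Prop where
  hp : ∀ p q, 0 < p → 0 < q → HasDerivAt (fun p => y p q) (yp p q) p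
  hq : ∀ p q, 0 < p → 0 < q → HasDerivAt (fun q => y p q) (yq p q) q
  hpq : ∀ p q, 0 < p → 0 < q →
    HasDerivAt (fun q => yp p q) (15 / 4 / (p + q) ^ 2 * y p q + σ p q) q
  hqp : ∀ p q, 0 < p → 0 < q →
    HasDerivAt (fun p => yq p q) (15 / 4 / (p + q) ^ 2 * y p q + σ p q) p
  diag : ∀ r, 0 < r → HasDerivAt (fun r => y r r) (yp r r + yq r r) r
  cy : ContinuousOn (fun x : ℝ × ℝ => y x.1 x.2) quad
  cyp : ContinuousOn (fun x : ℝ × ℝ => yp x.1 x.2) quad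
  cyq : ContinuousOn (fun x : ℝ × ℝ => yq x.1 x.2) quad
  cσ : ContinuousOn (fun x : ℝ × ℝ => σ x.1 x.2) quad

/-- Kernel flux. -/
def thetaK (y : ℝ → ℝ → ℝ) (L s p : ℝ) : ℝ :=
  (∫ q in p..(p + L), y p q * kKq s p q) + 1 / 2 * (y p p * kK s p p)

def fluxK (y yp σ : ℝ → ℝ → ℝ) (L s p : ℝ) : ℝ :=
  y p (p + L) * kKq s p (p + L) + kK s p (p + L) * yp p (p + L)
    - ∫ q in p..(p + L), σ p q * kK s p q

section
variable {y yp yq σ : ℝ → ℝ → ℝ}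

lemma quad_add_ne {x : ℝ × ℝ} (hx : x ∈ quad) : x.1 + x.2 ≠ 0 := by
  have h1 : 0 < x.1 := hx.1
  have h2 : 0 < x.2 := hx.2
  positivity

lemma thetaK_hasDerivAt (h : NullSol y yp yq σ) (hsym : ∀ r, 0 < r → yp r r = yq r r)
    {L s p : ℝ} (hL : 0 ≤ L) (hs : 0 < s) (hp : 0 < p) :
    HasDerivAt (thetaK y L s) (fluxK y yp σ L s p) p := by
  have hpL : 0 < p + L := by linarith
  have ck := kK_continuousOn hs
  have ckq := kKq_continuousOn hs
  have hw : ContinuousOn (fun x : ℝ × ℝ => 15 / 4 / (x.1 + x.2) ^ 2) quad :=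
    ContinuousOn.div (by fun_prop) (by fun_prop) fun x hx => pow_ne_zero 2 (quad_add_ne hx)
  have h1 := hasDerivAt_integral_moving (f := fun p q => y p q * kKq s p q)
    (fp := fun p q => yp p q * kKq s p q + y p q * (15 / 4 / (p + q) ^ 2 * kK s p q))
    (h.cy.mul ckq) ((h.cyp.mul ckq).add (h.cy.mul (hw.mul ck)))
    (fun p q hp hq => (h.hp p q hp hq).mul (kKq_hasDerivAt_p hs hp hq)) hp hL
  have h2 := ((h.diag p hp).mul (kK_diag_hasDerivAt hs hp)).const_mul (1 / 2)
  have hsubq : ∀ q ∈ uIcc p (p + L), 0 < q := fun q hq => uIcc_subset_Ioi hp hpL hq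
  have i1 : IntervalIntegrable (fun q => yp p q * kKq s p q +
      y p q * (15 / 4 / (p + q) ^ 2 * kK s p q)) volume p (p + L) :=
    (ContinuousOn.quad_right (f := fun p q => yp p q * kKq s p q +
      y p q * (15 / 4 / (p + q) ^ 2 * kK s p q))
      ((h.cyp.mul ckq).add (h.cy.mul (hw.mul ck))) hp).intervalIntegrable_Ioi hp hpL
  have i2 : IntervalIntegrable (fun q => σ p q * kK s p q) volume p (p + L) :=
    (ContinuousOn.quad_right (f := fun p q => σ p q * kK s p q)
      (h.cσ.mul ck) hp).intervalIntegrable_Ioi hp hpL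
  have h3 := intervalIntegral.integral_eq_sub_of_hasDerivAt (a := p) (b := p + L)
    (f := fun q => yp p q * kK s p q)
    (f' := fun q => (yp p q * kKq s p q +
      y p q * (15 / 4 / (p + q) ^ 2 * kK s p q)) + σ p q * kK s p q)
    (fun q hq => ((h.hpq p q hp (hsubq q hq)).mul
      (kK_hasDerivAt_q hs hp (hsubq q hq))).congr_deriv (by ring)) (i1.add i2)
  rw [intervalIntegral.integral_add i1 i2] at h3
  refine (h1.add h2).congr_deriv ?_
  unfold fluxK
  rw [← hsym p hp]
  linear_combination h3

lemma fluxK_continuousOn (h : NullSol y yp yq σ) {L s : ℝ} (hL : 0 ≤ L) (hs : 0 < s) :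
    ContinuousOn (fluxK y yp σ L s) (Ioi 0) := by
  have ck := kK_continuousOn hs
  have ckq := kKq_continuousOn hs
  have hm : ContinuousOn (fun p : ℝ => (p, p + L)) (Ioi 0) := by fun_prop
  have hmap : MapsTo (fun p : ℝ => (p, p + L)) (Ioi 0) quad := fun p hp =>
    ⟨hp, show 0 < p + L by have : 0 < p := hp; linarith⟩
  have c1 : ∀ f : ℝ → ℝ → ℝ, ContinuousOn (fun x : ℝ × ℝ => f x.1 x.2) quad →
      ContinuousOn (fun p => f p (p + L)) (Ioi 0) := fun f hf => hf.comp hm hmap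
  unfold fluxK
  refine (((c1 _ h.cy).mul (c1 _ ckq)).add ((c1 _ ck).mul (c1 _ h.cyp))).sub ?_
  exact continuousOn_integral_moving (g := fun p q => σ p q * kK s p q) (h.cσ.mul ck) hL

/-- The quantity controlled by the channel estimate, the function
`s⁻¹ d/ds (s^{3/2} y(s,s))` of `s`. -/
def bK (y yp : ℝ → ℝ → ℝ) (s : ℝ) : ℝ := 2 * √s * yp s s + 3 / 2 * y s s / √s

lemma thetaK_edge (h : NullSol y yp yq σ) {L s : ℝ} (hL : 0 ≤ L) (hs : 0 < s) :
    thetaK y L s s = 1 / 2 * bK y yp s - √s * yp s (s + L)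
      + √s * ∫ q in s..(s + L), σ s q := by
  have hsL : 0 < s + L := by linarith
  have hsub : ∀ q ∈ uIcc s (s + L), 0 < q := fun q hq => uIcc_subset_Ioi hs hsL hq
  have i1 : IntervalIntegrable (fun q => 15 / 4 / (s + q) ^ 2 * y s q) volume s (s + L) := by
    refine (ContinuousOn.quad_right (f := fun p q => 15 / 4 / (p + q) ^ 2 * y p q)
      (ContinuousOn.mul ?_ h.cy) hs).intervalIntegrable_Ioi hs hsL
    exact ContinuousOn.div (by fun_prop) (by fun_prop) fun x hx => pow_ne_zero 2 (quad_add_ne hx)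
  have i2 : IntervalIntegrable (σ s) volume s (s + L) :=
    (h.cσ.quad_right hs).intervalIntegrable_Ioi hs hsL
  have h1 := intervalIntegral.integral_eq_sub_of_hasDerivAt
    (fun q hq => h.hpq s q hs (hsub q hq)) (i1.add i2)
  rw [intervalIntegral.integral_add i1 i2] at h1
  have h2 : ∫ q in s..(s + L), y s q * kKq s s q =
      -√s * ∫ q in s..(s + L), 15 / 4 / (s + q) ^ 2 * y s q := by
    rw [← intervalIntegral.integral_const_mul]
    refine intervalIntegral.integral_congr fun q hq => ?_
    simp only [kKq_edge hs (hsub q hq)]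
    ring
  unfold thetaK bK
  rw [h2, kK_corner hs]
  linear_combination -√s * h1

lemma bK_identity (h : NullSol y yp yq σ) (hsym : ∀ r, 0 < r → yp r r = yq r r)
    {L s X : ℝ} (hL : 0 ≤ L) (hs : 0 < s) (hX : 0 < X) :
    1 / 2 * bK y yp s = √s * yp s (s + L) - √s * (∫ q in s..(s + L), σ s q)
      + thetaK y L s X - ∫ p in s..X, fluxK y yp σ L s p := by
  have h1 := intervalIntegral.integral_eq_sub_of_hasDerivAt (a := s) (b := X)
    (fun p hp => thetaK_hasDerivAt h hsym hL hs (uIcc_subset_Ioi hs hX hp))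
    ((fluxK_continuousOn h hL hs).intervalIntegrable_Ioi hs hX)
  rw [thetaK_edge h hL hs] at h1
  linarith

end

lemma hasDerivAt_mul_sqrt_inv {p : ℝ} (hp : 0 < p) :
    HasDerivAt (fun p => -(2 / 3) / (p * √p)) (1 / (p ^ 2 * √p)) p := by
  have h1 := (hasDerivAt_id' p).mul (hasDerivAt_sqrt hp.ne')
  have h2 := (hasDerivAt_const p (-(2 / 3) : ℝ)).div h1 (by simp only [Pi.mul_apply]; positivity)
  refine h2.congr_deriv ?_
  simp only [Pi.mul_apply]
  obtain ⟨r, hr⟩ : ∃ r, r = √p := ⟨_, rfl⟩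
  have hr0 : 0 < r := by rw [hr]; positivity
  have hrs : p = r ^ 2 := by rw [hr, sq_sqrt hp.le]
  rw [← hr, hrs]; field_simp; norm_num

section
variable {a b : ℝ}

lemma integral_of_hasDerivAt_pos {F f : ℝ → ℝ} (ha : 0 < a) (hb : 0 < b)
    (hd : ∀ x, 0 < x → HasDerivAt F (f x) x) (hc : ContinuousOn f (Ioi 0)) :
    IntervalIntegrable f volume a b ∧ ∫ x in a..b, f x = F b - F a :=
  ⟨hc.intervalIntegrable_Ioi ha hb, intervalIntegral.integral_eq_sub_of_hasDerivAt
    (fun x hx => hd x (uIcc_subset_Ioi ha hb hx)) (hc.intervalIntegrable_Ioi ha hb)⟩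

lemma integral_p52 (ha : 0 < a) (hb : 0 < b) :
    IntervalIntegrable (fun p => 1 / (p ^ 2 * √p)) volume a b ∧
    ∫ p in a..b, 1 / (p ^ 2 * √p) = -(2 / 3) / (b * √b) - -(2 / 3) / (a * √a) :=
  integral_of_hasDerivAt_pos ha hb (fun x hx => hasDerivAt_mul_sqrt_inv hx)
    (ContinuousOn.div (by fun_prop) (by fun_prop) fun x (hx : 0 < x) => by positivity)

lemma integral_inv_pos (ha : 0 < a) (hb : 0 < b) :
    IntervalIntegrable (fun p : ℝ => 1 / p) volume a b ∧
    ∫ p in a..b, 1 / p = log b - log a :=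
  integral_of_hasDerivAt_pos ha hb
    (fun x hx => (hasDerivAt_log hx.ne').congr_deriv (by rw [one_div]))
    (ContinuousOn.div (by fun_prop) (by fun_prop) fun x (hx : 0 < x) => by positivity)

lemma integral_inv_sqrt (ha : 0 < a) (hb : 0 < b) :
    IntervalIntegrable (fun p : ℝ => 1 / √p) volume a b ∧
    ∫ p in a..b, 1 / √p = 2 * √b - 2 * √a :=
  integral_of_hasDerivAt_pos (F := fun x => 2 * √x) ha hb
    (fun x hx => ((hasDerivAt_sqrt hx.ne').const_mul 2).congr_deriv (by field_simp))
    (ContinuousOn.div (by fun_prop) (by fun_prop) fun x (hx : 0 < x) => by positivity)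

lemma integral_inv_pow (n : ℕ) (ha : 0 < a) (hb : 0 < b) :
    IntervalIntegrable (fun p : ℝ => 1 / p ^ (n + 2)) volume a b ∧
    ∫ p in a..b, 1 / p ^ (n + 2) =
      -(1 / (n + 1)) / b ^ (n + 1) - -(1 / (n + 1)) / a ^ (n + 1) :=
  integral_of_hasDerivAt_pos (F := fun x => -(1 / (n + 1)) / x ^ (n + 1)) ha hb
    (fun x hx => by
      refine ((hasDerivAt_const x (-(1 / ((n : ℝ) + 1)))).div (hasDerivAt_pow (n + 1) x)
        (by positivity)).congr_deriv ?_
      push_cast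
      field_simp
      ring_nf)
    (ContinuousOn.div (by fun_prop) (by fun_prop) fun x (hx : 0 < x) => by positivity)

end

section
variable {y yp yq σ : ℝ → ℝ → ℝ}

/-- The size of the data of a solution along the characteristic leaving `p`, at time `L/2`. -/
def sizeK (y yp σ : ℝ → ℝ → ℝ) (L p : ℝ) : ℝ :=
  |yp p (p + L)| + p / (p + L) ^ 2 * |y p (p + L)| + ∫ q in p..(p + L), |σ p q|

lemma integral_mul_abs_le {f g : ℝ → ℝ} {a b C : ℝ} (hab : a ≤ b)
    (hf : IntervalIntegrable f volume a b) (hg : ∀ q ∈ Icc a b, |g q| ≤ C) :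
    |∫ q in a..b, f q * g q| ≤ C * ∫ q in a..b, |f q| := by
  rw [← intervalIntegral.integral_const_mul]
  have := intervalIntegral.norm_integral_le_of_norm_le (μ := volume) (f := fun q => f q * g q)
    (g := fun q => C * |f q|) hab (Eventually.of_forall fun q hq => by
      rw [norm_mul, mul_comm, Real.norm_eq_abs, Real.norm_eq_abs]
      exact mul_le_mul_of_nonneg_right (hg q (Ioc_subset_Icc_self hq)) (abs_nonneg _))
    (hf.abs.const_mul C)
  simpa using this

lemma sizeK_terms (h : NullSol y yp yq σ) {L p α β : ℝ} (hL : 0 ≤ L) (hp : 0 < p) {k kq : ℝ → ℝ}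
    (hα : 0 ≤ α) (hβ : β ≤ α)
    (hk : ∀ q, p ≤ q → |k q| ≤ β) (hkq : |kq (p + L)| ≤ α * (p / (p + L) ^ 2)) :
    |y p (p + L) * kq (p + L) + k (p + L) * yp p (p + L) - ∫ q in p..(p + L), σ p q * k q|
      ≤ α * sizeK y yp σ L p := by
  have hpL : 0 < p + L := by linarith
  have hint : IntervalIntegrable (σ p) volume p (p + L) :=
    (h.cσ.quad_right hp).intervalIntegrable_Ioi hp hpL
  have h3 := integral_mul_abs_le (f := σ p) (g := k) (by linarith) hint
    fun q hq => (hk q hq.1).trans hβ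
  have h1 : |y p (p + L) * kq (p + L)| ≤ α * (p / (p + L) ^ 2) * |y p (p + L)| := by
    rw [abs_mul, mul_comm]; gcongr
  have h2 : |k (p + L) * yp p (p + L)| ≤ α * |yp p (p + L)| := by
    rw [abs_mul]; gcongr; exact (hk _ (by linarith)).trans hβ
  have := (abs_sub _ (∫ q in p..(p + L), σ p q * k q)).trans (add_le_add (abs_add_le
    (y p (p + L) * kq (p + L)) (k (p + L) * yp p (p + L))) le_rfl)
  unfold sizeK
  nlinarith

lemma fluxK_abs_le (h : NullSol y yp yq σ) {L s p : ℝ} (hL : 0 ≤ L) (hs : 0 < s) (hsp : s ≤ p) :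
    |fluxK y yp σ L s p| ≤ 195 / √p * sizeK y yp σ L p := by
  have hp := hs.trans_le hsp
  refine sizeK_terms h (k := kK s p) (kq := kKq s p) (β := 36 / √p) hL hp (by positivity)
    (by gcongr; norm_num) (fun q hq => kK_abs_le hs hsp hq) ?_
  refine (kKq_abs_le hs hsp (by linarith)).trans (le_of_eq ?_)
  have : √p * √p = p := mul_self_sqrt hp.le
  have : 0 < √p := by positivity
  have : 0 < p + L := by linarith
  field_simp
  linarith

lemma fluxK_sub_abs_le (h : NullSol y yp yq σ) {L s s1 p : ℝ} (hL : 0 ≤ L) (hs : 0 < s)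
    (h1 : s ≤ s1) (hsp : s1 ≤ p) :
    |fluxK y yp σ L s p - fluxK y yp σ L s1 p| ≤ 191 * (s1 * √s1) / p ^ 2 * sizeK y yp σ L p := by
  have hp : 0 < p := by linarith
  have hpL : 0 < p + L := by linarith
  have hi : ∀ s, 0 < s → IntervalIntegrable (fun q => σ p q * kK s p q) volume p (p + L) :=
    fun s hs => (ContinuousOn.quad_right (f := fun p q => σ p q * kK s p q)
      (h.cσ.mul (kK_continuousOn hs)) hp).intervalIntegrable_Ioi hp hpL
  have e : fluxK y yp σ L s p - fluxK y yp σ L s1 p =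
      y p (p + L) * (kKq s p (p + L) - kKq s1 p (p + L))
      + (kK s p (p + L) - kK s1 p (p + L)) * yp p (p + L)
      - ∫ q in p..(p + L), σ p q * (kK s p q - kK s1 p q) := by
    simp only [mul_sub]
    rw [intervalIntegral.integral_sub (hi s hs) (hi s1 (by linarith))]
    unfold fluxK; ring
  have hs1 : 0 < s1 := by linarith
  rw [e]
  refine sizeK_terms h (k := fun q => kK s p q - kK s1 p q)
    (kq := fun q => kKq s p q - kKq s1 p q) (β := 31 * (s1 * √s1) / p ^ 2) hL hp (by positivity)
    (by gcongr; norm_num) (fun q hq => kK_sub_abs_le hs h1 hsp hq) ?_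
  refine (kKq_sub_abs_le hs h1 hsp (by linarith)).trans (le_of_eq ?_)
  field_simp

lemma thetaK_sub_tendsto (h : NullSol y yp yq σ) {L s s1 K : ℝ} (hL : 0 ≤ L) (hs : 0 < s)
    (h1 : s ≤ s1) (hK : 0 ≤ K) (hy : ∀ p q, 1 ≤ p → p ≤ q → |y p q| ≤ K * q) :
    Tendsto (fun X => thetaK y L s X - thetaK y L s1 X) atTop (𝓝 0) := by
  have hs1 : 0 < s1 := by linarith
  set A := K * (s1 * √s1)
  refine squeeze_zero_norm' (a := fun X => (191 * A * L + 16 * A) * X⁻¹) ?_ ?_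
  · filter_upwards [eventually_ge_atTop s1, eventually_ge_atTop 1] with X hX hX1
    have hX0 : 0 < X := by linarith
    have hXL : 0 < X + L := by linarith
    have hi : ∀ s, 0 < s → IntervalIntegrable (fun q => y X q * kKq s X q) volume X (X + L) :=
      fun s hs => (ContinuousOn.quad_right (f := fun p q => y p q * kKq s p q)
        (h.cy.mul (kKq_continuousOn hs)) hX0).intervalIntegrable_Ioi hX0 hXL
    have e : thetaK y L s X - thetaK y L s1 X =
        (∫ q in X..(X + L), y X q * (kKq s X q - kKq s1 X q))
        + 1 / 2 * (y X X * (kK s X X - kK s1 X X)) := by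
      simp only [mul_sub]
      rw [intervalIntegral.integral_sub (hi s hs) (hi s1 (by linarith))]
      unfold thetaK; ring
    have b1 : |∫ q in X..(X + L), y X q * (kKq s X q - kKq s1 X q)| ≤ 191 * A / X * L := by
      have := intervalIntegral.norm_integral_le_of_norm_le_const (C := 191 * A / X)
        (f := fun q => y X q * (kKq s X q - kKq s1 X q)) (a := X) (b := X + L) fun q hq => by
          rw [uIoc_of_le (by linarith)] at hq
          have hq0 : 0 < q := by linarith [hq.1]
          have hq1 : 1 ≤ q := by linarith [hq.1]
          rw [norm_mul, Real.norm_eq_abs, Real.norm_eq_abs]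
          calc _ ≤ K * q * (191 * (s1 * √s1) / (X * q ^ 2)) := by
                gcongr
                · exact hy X q hX1 hq.1.le
                · exact kKq_sub_abs_le hs h1 hX hq.1.le
            _ = 191 * A / (X * q) := by simp only [A]; field_simp
            _ ≤ 191 * A / (X * 1) := by gcongr
            _ = _ := by rw [mul_one]
      rwa [add_sub_cancel_left, abs_of_nonneg hL] at this
    have b2 : |1 / 2 * (y X X * (kK s X X - kK s1 X X))| ≤ 16 * A / X := by
      rw [abs_mul, abs_mul, abs_of_pos (by norm_num : (0 : ℝ) < 1 / 2)]
      calc _ ≤ 1 / 2 * (K * X * (31 * (s1 * √s1) / X ^ 2)) := by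
            gcongr
            · exact hy X X hX1 le_rfl
            · exact kK_sub_abs_le hs h1 hX le_rfl
        _ = 31 / 2 * A / X := by simp only [A]; field_simp
        _ ≤ _ := by gcongr; norm_num
    rw [e, Real.norm_eq_abs]
    refine (abs_add_le _ _).trans ((add_le_add b1 b2).trans (le_of_eq ?_))
    field_simp
  · simpa using tendsto_inv_atTop_zero.const_mul (191 * A * L + 16 * A)

lemma bK_sub_abs_le (h : NullSol y yp yq σ) (hsym : ∀ r, 0 < r → yp r r = yq r r)
    {L s s1 K A₁ A₂ : ℝ} {J : ℝ → ℝ} (hL : 0 ≤ L) (hs : 0 < s) (h1 : s ≤ s1) (hK : 0 ≤ K)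
    (hy : ∀ p q, 1 ≤ p → p ≤ q → |y p q| ≤ K * q)
    (hJc : ContinuousOn J (Ioi 0)) (hJ : ∀ p, s ≤ p → sizeK y yp σ L p ≤ J p)
    (hA₁ : ∫ p in s..s1, 1 / √p * J p ≤ A₁)
    (hA₂ : ∀ X, s1 ≤ X → ∫ p in s1..X, s1 * √s1 / p ^ 2 * J p ≤ A₂) :
    |bK y yp s - bK y yp s1| ≤ 2 * (√s * J s) + 2 * (√s1 * J s1) + 390 * A₁ + 390 * A₂ := by
  have hs1 : 0 < s1 := by linarith
  have edge : ∀ s, 0 < s → sizeK y yp σ L s ≤ J s →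
      |√s * yp s (s + L) - √s * ∫ q in s..(s + L), σ s q| ≤ √s * J s := by
    intro s hs hJs
    rw [← mul_sub, abs_mul, abs_of_nonneg (sqrt_nonneg s)]
    refine mul_le_mul_of_nonneg_left (le_trans ?_ hJs) (sqrt_nonneg s)
    have h2 : |∫ q in s..(s + L), σ s q| ≤ ∫ q in s..(s + L), |σ s q| :=
      intervalIntegral.abs_integral_le_integral_abs (by linarith)
    have h3 : 0 ≤ s / (s + L) ^ 2 * |y s (s + L)| := by positivity
    unfold sizeK
    linarith [abs_sub (yp s (s + L)) (∫ q in s..(s + L), σ s q)]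
  have e0 := edge s hs (hJ s le_rfl)
  have e1 := edge s1 hs1 (hJ s1 h1)
  have key : ∀ᶠ X in atTop, |bK y yp s - bK y yp s1| ≤
      2 * |thetaK y L s X - thetaK y L s1 X| +
      (2 * (√s * J s) + 2 * (√s1 * J s1) + 390 * A₁ + 390 * A₂) := by
    filter_upwards [eventually_ge_atTop s1] with X hX
    have hX0 : 0 < X := by linarith
    have i0 := bK_identity h hsym hL hs hX0
    have i1 := bK_identity h hsym hL hs1 hX0
    have c0 := fluxK_continuousOn h hL hs
    have c1 := fluxK_continuousOn h hL hs1
    have sp := intervalIntegral.integral_add_adjacent_intervals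
      (c0.intervalIntegrable_Ioi hs hs1) (c0.intervalIntegrable_Ioi hs1 hX0)
    have sb := intervalIntegral.integral_sub (c0.intervalIntegrable_Ioi hs1 hX0)
      (c1.intervalIntegrable_Ioi hs1 hX0)
    have cJ1 : ContinuousOn (fun p => 1 / √p * J p) (Ioi 0) :=
      (ContinuousOn.div (by fun_prop) (by fun_prop) fun x (hx : 0 < x) => by positivity).mul hJc
    have cJ2 : ContinuousOn (fun p => s1 * √s1 / p ^ 2 * J p) (Ioi 0) :=
      (ContinuousOn.div (by fun_prop) (by fun_prop) fun x (hx : 0 < x) => by positivity).mul hJc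
    have n1 : |∫ p in s..s1, fluxK y yp σ L s p| ≤ 195 * A₁ := by
      have := intervalIntegral.norm_integral_le_of_norm_le (μ := volume)
        (f := fluxK y yp σ L s) (g := fun p => 195 * (1 / √p * J p)) h1
        (Eventually.of_forall fun p hp => by
          have hp0 : 0 < p := hs.trans hp.1
          refine (fluxK_abs_le h hL hs hp.1.le).trans ?_
          have := mul_le_mul_of_nonneg_left (hJ p hp.1.le) (show 0 ≤ 195 / √p by positivity)
          refine this.trans (le_of_eq (by ring)))
        ((cJ1.intervalIntegrable_Ioi hs hs1).const_mul _)
      rw [intervalIntegral.integral_const_mul, Real.norm_eq_abs] at this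
      linarith
    have n2 : |∫ p in s1..X, (fluxK y yp σ L s p - fluxK y yp σ L s1 p)| ≤ 195 * A₂ := by
      have := intervalIntegral.norm_integral_le_of_norm_le (μ := volume)
        (f := fun p => fluxK y yp σ L s p - fluxK y yp σ L s1 p)
        (g := fun p => 195 * (s1 * √s1 / p ^ 2 * J p)) hX
        (Eventually.of_forall fun p hp => by
          have hp0 : 0 < p := hs1.trans hp.1
          have hJp := hJ p (h1.trans hp.1.le)
          refine (fluxK_sub_abs_le h hL hs h1 hp.1.le).trans ?_
          have h0 : 0 ≤ sizeK y yp σ L p := by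
            have : 0 ≤ ∫ q in p..(p + L), |σ p q| :=
              intervalIntegral.integral_nonneg (by linarith) fun _ _ => abs_nonneg _
            unfold sizeK; positivity
          calc _ ≤ 195 * (s1 * √s1) / p ^ 2 * J p := by gcongr; norm_num
            _ = _ := by ring)
        ((cJ2.intervalIntegrable_Ioi hs1 hX0).const_mul _)
      rw [intervalIntegral.integral_const_mul, Real.norm_eq_abs] at this
      linarith [hA₂ X hX]
    rw [abs_le] at e0 e1 n1 n2
    have n3 := abs_le.1 (le_refl |thetaK y L s X - thetaK y L s1 X|)
    rw [abs_le]
    constructor <;> linarith [e0.1, e0.2, e1.1, e1.2, n1.1, n1.2, n2.1, n2.2, n3.1, n3.2]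
  have lim := ((thetaK_sub_tendsto h hL hs h1 hK hy).abs.const_mul 2).add_const
    (2 * (√s * J s) + 2 * (√s1 * J s1) + 390 * A₁ + 390 * A₂)
  have := ge_of_tendsto lim key
  simpa using this

end

section
variable {y yp yq σ : ℝ → ℝ → ℝ}

/-- Admissible majorant of `sizeK`. -/
def majK (j : ℝ → ℝ) (M η H p : ℝ) : ℝ := j p + M / √p + η + H / p ^ 2

structure L2Bound (j : ℝ → ℝ) (M : ℝ) : Prop where
  cont : ContinuousOn j (Ioi 0)
  nonneg : ∀ p, 0 < p → 0 ≤ j p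
  pos : 0 < M
  le : ∀ a b, 0 < a → a ≤ b → ∫ p in a..b, j p ^ 2 ≤ M ^ 2

lemma majK_continuousOn {j : ℝ → ℝ} {M η H : ℝ} (hj : ContinuousOn j (Ioi 0)) :
    ContinuousOn (majK j M η H) (Ioi 0) := by
  have h1 : ContinuousOn (fun p : ℝ => M / √p) (Ioi 0) :=
    ContinuousOn.div (by fun_prop) (by fun_prop) fun x (hx : 0 < x) => by positivity
  have h2 : ContinuousOn (fun p : ℝ => H / p ^ 2) (Ioi 0) :=
    ContinuousOn.div (by fun_prop) (by fun_prop) fun x (hx : 0 < x) => by positivity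
  exact ((hj.add h1).add continuousOn_const).add h2

lemma bK_sub_abs_le_majK (h : NullSol y yp yq σ) (hsym : ∀ r, 0 < r → yp r r = yq r r)
    {L s s1 K M η H : ℝ} {j : ℝ → ℝ} (hL : 0 ≤ L) (hs : 0 < s) (h1 : s ≤ s1) (hK : 0 ≤ K)
    (hy : ∀ p q, 1 ≤ p → p ≤ q → |y p q| ≤ K * q) (hj : L2Bound j M)
    (hη : 0 ≤ η) (hH : 0 ≤ H) (hJ : ∀ p, s ≤ p → sizeK y yp σ L p ≤ majK j M η H p) :
    |bK y yp s - bK y yp s1| ≤ 2 * (√s * j s) + 2 * (√s1 * j s1)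
      + 1200 * (M * (1 + log (s1 / s)) + η * √s1 + H / (s * √s)) := by
  have hs1 : 0 < s1 := by linarith
  have hM := hj.pos
  have cj2 : ContinuousOn (fun p => j p ^ 2) (Ioi 0) := hj.cont.pow 2
  have hlog : 0 ≤ log (s1 / s) := log_nonneg (by rw [le_div_iff₀ hs]; linarith)
  have hlog' : log (s1 / s) = log s1 - log s := log_div hs1.ne' hs.ne'
  have cc : ContinuousOn (fun p : ℝ => 1 / √p) (Ioi 0) :=
    ContinuousOn.div (by fun_prop) (by fun_prop) fun x (hx : 0 < x) => by positivity
  have cd : ContinuousOn (fun p => s1 * √s1 / p ^ 2) (Ioi 0) :=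
    ContinuousOn.div (by fun_prop) (by fun_prop) fun x (hx : 0 < x) => by positivity
  have hHs : 0 ≤ H / (s * √s) := by positivity
  have hHs1 : H / (s1 * √s1) ≤ H / (s * √s) := by gcongr
  have hη1 : η * √s ≤ η * √s1 := by gcongr
  have hη0 : 0 ≤ η * √s1 := by positivity
  have A1 : ∫ p in s..s1, 1 / √p * majK j M η H p ≤
      1 / 2 * M + 3 / 2 * (M * log (s1 / s)) + 2 * (η * √s1) + 2 / 3 * (H / (s * √s)) := by
    have i0 := cj2.intervalIntegrable_Ioi hs hs1
    obtain ⟨i1, e1⟩ := integral_inv_pos hs hs1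
    obtain ⟨i2, e2⟩ := integral_inv_sqrt hs hs1
    obtain ⟨i3, e3⟩ := integral_p52 hs hs1
    have hle := intervalIntegral.integral_mono_on (μ := volume) h1
      (f := fun p => 1 / √p * majK j M η H p)
      (g := fun p => 1 / (2 * M) * j p ^ 2 + 3 / 2 * M * (1 / p) + η * (1 / √p)
        + H * (1 / (p ^ 2 * √p)))
      ((cc.mul (majK_continuousOn hj.cont)).intervalIntegrable_Ioi hs hs1)
      ((((i0.const_mul _).add (i1.const_mul _)).add (i2.const_mul _)).add (i3.const_mul _))
      (fun p hp => by
        have hp0 : 0 < p := hs.trans_le hp.1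
        have hr : √p * √p = p := mul_self_sqrt hp0.le
        have hr0 : 0 < √p := by positivity
        have am : j p / √p ≤ 1 / (2 * M) * j p ^ 2 + 1 / 2 * M * (1 / p) := by
          have : 1 / (2 * M) * j p ^ 2 + 1 / 2 * M * (1 / p) - j p / √p =
              (j p - M / √p) ^ 2 / (2 * M) := by
            rw [← hr]; field_simp; rw [sqrt_sq hr0.le]; ring
          have : 0 ≤ (j p - M / √p) ^ 2 / (2 * M) := by positivity
          linarith
        have e : 1 / √p * majK j M η H p =
            j p / √p + M * (1 / p) + η * (1 / √p) + H * (1 / (p ^ 2 * √p)) := by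
          unfold majK
          rw [show M * (1 / p) = M / √p / √p by rw [div_div, hr]; ring]
          field_simp
        rw [e]; linarith)
    refine hle.trans ?_
    rw [intervalIntegral.integral_add (((i0.const_mul _).add (i1.const_mul _)).add (i2.const_mul _)) (i3.const_mul _),
      intervalIntegral.integral_add ((i0.const_mul _).add (i1.const_mul _)) (i2.const_mul _),
      intervalIntegral.integral_add (i0.const_mul _) (i1.const_mul _)]
    simp only [intervalIntegral.integral_const_mul]
    rw [e1, e2, e3, hlog']
    have t0 : 1 / (2 * M) * ∫ p in s..s1, j p ^ 2 ≤ 1 / 2 * M := by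
      calc _ ≤ 1 / (2 * M) * M ^ 2 := by gcongr; exact hj.le s s1 hs h1
        _ = _ := by field_simp
    have t1 : η * (2 * √s1 - 2 * √s) ≤ 2 * (η * √s1) := by
      have : 0 ≤ η * √s := by positivity
      linarith
    have t2 : H * (-(2 / 3) / (s1 * √s1) - -(2 / 3) / (s * √s)) ≤ 2 / 3 * (H / (s * √s)) := by
      have : 0 ≤ 2 / 3 * (H / (s1 * √s1)) := by positivity
      have : H * (-(2 / 3) / (s1 * √s1) - -(2 / 3) / (s * √s)) =
        2 / 3 * (H / (s * √s)) - 2 / 3 * (H / (s1 * √s1)) := by ring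
      linarith
    linarith
  have A2 : ∀ X, s1 ≤ X → ∫ p in s1..X, s1 * √s1 / p ^ 2 * majK j M η H p ≤
      4 / 3 * M + η * √s1 + 1 / 3 * (H / (s * √s)) := by
    intro X hX
    have hX0 : 0 < X := by linarith
    have i0 := cj2.intervalIntegrable_Ioi hs1 hX0
    obtain ⟨i1, e1⟩ := integral_inv_pow 2 hs1 hX0
    obtain ⟨i2, e2⟩ := integral_p52 hs1 hX0
    obtain ⟨i3, e3⟩ := integral_inv_pow 0 hs1 hX0
    have hr1 : √s1 * √s1 = s1 := mul_self_sqrt hs1.le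
    have hr10 : 0 < √s1 := by positivity
    have hle := intervalIntegral.integral_mono_on (μ := volume) hX
      (f := fun p => s1 * √s1 / p ^ 2 * majK j M η H p)
      (g := fun p => 1 / (2 * M) * j p ^ 2 + (1 / 2 * M * s1 ^ 3 + H * (s1 * √s1)) * (1 / p ^ (2 + 2))
        + M * (s1 * √s1) * (1 / (p ^ 2 * √p)) + η * (s1 * √s1) * (1 / p ^ (0 + 2)))
      ((cd.mul (majK_continuousOn hj.cont)).intervalIntegrable_Ioi hs1 hX0)
      ((((i0.const_mul _).add (i1.const_mul _)).add (i2.const_mul _)).add (i3.const_mul _))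
      (fun p hp => by
        have hp0 : 0 < p := hs1.trans_le hp.1
        have hr0 : 0 < √p := by positivity
        have am : s1 * √s1 / p ^ 2 * j p ≤
            1 / (2 * M) * j p ^ 2 + 1 / 2 * M * s1 ^ 3 * (1 / p ^ (2 + 2)) := by
          have : 1 / (2 * M) * j p ^ 2 + 1 / 2 * M * s1 ^ 3 * (1 / p ^ (2 + 2))
              - s1 * √s1 / p ^ 2 * j p = (j p - M * (s1 * √s1) / p ^ 2) ^ 2 / (2 * M) := by
            have : s1 ^ 3 = (s1 * √s1) ^ 2 := by rw [mul_pow, sq_sqrt hs1.le]; ring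
            rw [this]; field_simp; ring
          have : 0 ≤ (j p - M * (s1 * √s1) / p ^ 2) ^ 2 / (2 * M) := by positivity
          linarith
        have e : s1 * √s1 / p ^ 2 * majK j M η H p = s1 * √s1 / p ^ 2 * j p
            + M * (s1 * √s1) * (1 / (p ^ 2 * √p)) + η * (s1 * √s1) * (1 / p ^ (0 + 2))
            + H * (s1 * √s1) * (1 / p ^ (2 + 2)) := by
          unfold majK; field_simp; ring
        rw [e]; linarith)
    refine hle.trans ?_
    rw [intervalIntegral.integral_add (((i0.const_mul _).add (i1.const_mul _)).add (i2.const_mul _)) (i3.const_mul _),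
      intervalIntegral.integral_add ((i0.const_mul _).add (i1.const_mul _)) (i2.const_mul _),
      intervalIntegral.integral_add (i0.const_mul _) (i1.const_mul _)]
    simp only [intervalIntegral.integral_const_mul]
    rw [e1, e2, e3]
    have t0 : 1 / (2 * M) * ∫ p in s1..X, j p ^ 2 ≤ 1 / 2 * M := by
      calc _ ≤ 1 / (2 * M) * M ^ 2 := by gcongr; exact hj.le s1 X hs1 hX
        _ = _ := by field_simp
    have drop : ∀ A B D : ℝ, 0 ≤ A → 0 ≤ B → A * (-B - -D) ≤ A * D := fun A B D hA hB => by
      have := mul_nonneg hA hB; linarith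
    have t1 := drop (1 / 2 * M * s1 ^ 3 + H * (s1 * √s1)) (1 / (((2 : ℕ) : ℝ) + 1) / X ^ (2 + 1))
      (1 / (((2 : ℕ) : ℝ) + 1) / s1 ^ (2 + 1)) (by positivity) (by positivity)
    have t2 := drop (M * (s1 * √s1)) (2 / 3 / (X * √X)) (2 / 3 / (s1 * √s1)) (by positivity)
      (by positivity)
    have t3 := drop (η * (s1 * √s1)) (1 / (((0 : ℕ) : ℝ) + 1) / X ^ (0 + 1))
      (1 / (((0 : ℕ) : ℝ) + 1) / s1 ^ (0 + 1)) (by positivity) (by positivity)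
    have u1 : (1 / 2 * M * s1 ^ 3 + H * (s1 * √s1)) * (1 / (((2 : ℕ) : ℝ) + 1) / s1 ^ (2 + 1)) =
        1 / 6 * M + 1 / 3 * (H / (s1 * √s1)) := by
      have : H / (s1 * √s1) = H * √s1 / s1 ^ 2 := by
        rw [div_eq_div_iff (by positivity) (by positivity)]
        linear_combination -(H * s1) * hr1
      rw [this]; push_cast; field_simp; ring
    have u2 : M * (s1 * √s1) * (2 / 3 / (s1 * √s1)) = 2 / 3 * M := by field_simp
    have u3 : η * (s1 * √s1) * (1 / (((0 : ℕ) : ℝ) + 1) / s1 ^ (0 + 1)) = η * √s1 := by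
      push_cast; field_simp; norm_num
    simp only [neg_div] at *
    linarith
  have key := bK_sub_abs_le h hsym hL hs h1 hK hy (majK_continuousOn hj.cont) hJ A1 A2
  have ms : ∀ s, 0 < s → √s * majK j M η H s = √s * j s + M + η * √s + H / (s * √s) := by
    intro s hs
    have hr : √s * √s = s := mul_self_sqrt hs.le
    have hr0 : 0 < √s := by positivity
    have : H / (s * √s) = √s * (H / s ^ 2) := by
      rw [← mul_div_assoc, div_eq_div_iff (by positivity) (by positivity)]
      linear_combination -(H * s) * hr
    rw [this]; unfold majK; field_simp
  rw [ms s hs, ms s1 hs1] at key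
  have := mul_nonneg hM.le hlog
  linarith

lemma bK_continuousOn (h : NullSol y yp yq σ) : ContinuousOn (bK y yp) (Ioi 0) := by
  have c1 : ∀ f : ℝ → ℝ → ℝ, ContinuousOn (fun x : ℝ × ℝ => f x.1 x.2) quad →
      ContinuousOn (fun p => f p p) (Ioi 0) := fun f hf =>
    hf.comp (f := fun p => (p, p)) (by fun_prop) fun p hp => ⟨hp, hp⟩
  unfold bK
  refine ContinuousOn.add (ContinuousOn.mul (by fun_prop) (c1 _ h.cyp)) ?_
  exact ((c1 _ h.cy).const_smul (3 / 2 : ℝ)).div (by fun_prop)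
    fun x (hx : 0 < x) => by positivity

lemma bK_anchored (h : NullSol y yp yq σ) (hsym : ∀ r, 0 < r → yp r r = yq r r)
    {L s r₁ K M η H p₀ Q : ℝ} {j : ℝ → ℝ} (hL : 0 ≤ L) (hp₀ : 0 < p₀) (hs : p₀ ≤ s)
    (hr : p₀ ≤ r₁) (hK : 0 ≤ K)
    (hy : ∀ p q, 1 ≤ p → p ≤ q → |y p q| ≤ K * q) (hj : L2Bound j M)
    (hη : 0 ≤ η) (hH : 0 ≤ H)
    (hJ : ∀ p, s ≤ p ∨ r₁ ≤ p → sizeK y yp σ L p ≤ majK j M η H p)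
    (hQ : |∫ s in r₁..(2 * r₁), s * bK y yp s| ≤ Q * r₁ ^ 2) :
    |bK y yp s| ≤ Q + 5000 * (√s * j s + M * (1 + |log (s / r₁)|) + η * (√s + √r₁)
      + H * (1 / (s * √s) + 1 / (r₁ * √r₁))) := by
  have hs0 : 0 < s := by linarith
  have hr0 : 0 < r₁ := by linarith
  have h2r0 : 0 < 2 * r₁ := by linarith
  have hM := hj.pos
  have hjs := hj.nonneg s hs0
  set Λ := |log (s / r₁)|
  have hΛ : 0 ≤ Λ := abs_nonneg _
  set B := M * (2 + Λ) + η * (√s + 2 * √r₁) + H * (1 / (s * √s) + 1 / (r₁ * √r₁)) with hB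
  have hB0 : 0 ≤ B := by positivity
  have pw : ∀ s₁ ∈ Icc r₁ (2 * r₁), |bK y yp s - bK y yp s₁| ≤
      2 * (√s * j s) + 2 * (√s₁ * j s₁) + 1200 * B := by
    intro s₁ hs₁
    have hs₁0 : 0 < s₁ := hr0.trans_le hs₁.1
    have l1 : log (s₁ / r₁) ≤ 1 := by
      have : s₁ / r₁ ≤ 2 := by rw [div_le_iff₀ hr0]; exact hs₁.2
      have := log_le_log (by positivity) this
      linarith [log_two_lt_d9]
    have l0 : 0 ≤ log (s₁ / r₁) := log_nonneg (by rw [le_div_iff₀ hr0]; linarith [hs₁.1])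
    have ls : log (s₁ / s) = log (s₁ / r₁) - log (s / r₁) := by
      rw [log_div hs₁0.ne' hs0.ne', log_div hs₁0.ne' hr0.ne', log_div hs0.ne' hr0.ne']; ring
    have ls' : log (s / s₁) = log (s / r₁) - log (s₁ / r₁) := by
      rw [log_div hs0.ne' hs₁0.ne', log_div hs₁0.ne' hr0.ne', log_div hs0.ne' hr0.ne']; ring
    have sq : √s₁ ≤ 2 * √r₁ := by
      rw [sqrt_le_left (by positivity), mul_pow, sq_sqrt hr0.le]; linarith [hs₁.2]
    have hr1' : H / (s₁ * √s₁) ≤ H * (1 / (r₁ * √r₁)) := by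
      rw [mul_one_div]; gcongr <;> exact hs₁.1
    have hHs : 0 ≤ H * (1 / (s * √s)) := by positivity
    have hHr : 0 ≤ H * (1 / (r₁ * √r₁)) := by positivity
    have el := neg_abs_le (log (s / r₁))
    have eu := le_abs_self (log (s / r₁))
    have hηs : 0 ≤ η * √s := by positivity
    have hηr : 0 ≤ η * √r₁ := by positivity
    have hηq : η * √s₁ ≤ η * (2 * √r₁) := by gcongr
    rcases le_total s s₁ with hle | hle
    · have := bK_sub_abs_le_majK h hsym hL hs0 hle hK hy hj hη hH fun p hp => hJ p (Or.inl hp)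
      have e1 : M * (1 + log (s₁ / s)) ≤ M * (2 + Λ) := by
        gcongr ?_ * ?_; simp only [Λ]; linarith
      have e2 : H / (s * √s) = H * (1 / (s * √s)) := by ring
      rw [hB]; linarith
    · have := bK_sub_abs_le_majK h hsym hL hs₁0 hle hK hy hj hη hH
        fun p hp => hJ p (Or.inr (hs₁.1.trans hp))
      rw [abs_sub_comm] at this
      have e1 : M * (1 + log (s / s₁)) ≤ M * (2 + Λ) := by
        gcongr ?_ * ?_; simp only [Λ]; linarith
      rw [hB]; linarith
  have cb := bK_continuousOn h
  have i0 : IntervalIntegrable (fun x => x * bK y yp x) volume r₁ (2 * r₁) :=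
    (continuousOn_id.mul cb).intervalIntegrable_Ioi hr0 h2r0
  have i1 : IntervalIntegrable (fun x : ℝ => x * bK y yp s) volume r₁ (2 * r₁) :=
    Continuous.intervalIntegrable (by fun_prop) _ _
  have i2 : IntervalIntegrable (fun x : ℝ => x) volume r₁ (2 * r₁) :=
    Continuous.intervalIntegrable (by fun_prop) _ _
  have i4 : IntervalIntegrable (fun x : ℝ => x ^ 3) volume r₁ (2 * r₁) :=
    Continuous.intervalIntegrable (by fun_prop) _ _
  have i3 : IntervalIntegrable (fun x => j x ^ 2) volume r₁ (2 * r₁) :=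
    (hj.cont.pow 2).intervalIntegrable_Ioi hr0 h2r0
  have n := intervalIntegral.norm_integral_le_of_norm_le (μ := volume)
    (f := fun x => x * bK y yp s - x * bK y yp x)
    (g := fun x => (2 * (√s * j s) + 1200 * B) * x + (r₁ ^ 2 / M * j x ^ 2 + M / r₁ ^ 2 * x ^ 3))
    (a := r₁) (b := 2 * r₁) (by linarith)
    (Eventually.of_forall fun x hx => by
      have hx0 : 0 < x := hr0.trans hx.1
      rw [← mul_sub, norm_mul, Real.norm_eq_abs, Real.norm_eq_abs, abs_of_pos hx0]
      have := mul_le_mul_of_nonneg_left (pw x (Ioc_subset_Icc_self hx)) hx0.le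
      have am : x * (2 * (√x * j x)) ≤ r₁ ^ 2 / M * j x ^ 2 + M / r₁ ^ 2 * x ^ 3 := by
        have e : r₁ ^ 2 / M * j x ^ 2 + M / r₁ ^ 2 * x ^ 3 - x * (2 * (√x * j x)) =
            (r₁ * j x - M * (x * √x) / r₁) ^ 2 / M := by
          have : x ^ 3 = (x * √x) ^ 2 := by rw [mul_pow, sq_sqrt hx0.le]; ring
          rw [this]; field_simp; ring
        have : 0 ≤ (r₁ * j x - M * (x * √x) / r₁) ^ 2 / M := by positivity
        linarith
      linarith)
    ((i2.const_mul _).add ((i3.const_mul _).add (i4.const_mul _)))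
  rw [intervalIntegral.integral_sub i1 i0, intervalIntegral.integral_add (i2.const_mul _)
    ((i3.const_mul _).add (i4.const_mul _)), intervalIntegral.integral_add (i3.const_mul _)
    (i4.const_mul _)] at n
  simp only [intervalIntegral.integral_const_mul, intervalIntegral.integral_mul_const,
    integral_id, integral_pow] at n
  have ex : ∫ x in r₁..(2 * r₁), (2 * (√s * j s) + 1200 * B) * x =
      (2 * (√s * j s) + 1200 * B) * (3 / 2 * r₁ ^ 2) := by
    rw [intervalIntegral.integral_const_mul, integral_id]; ring
  rw [ex] at n
  have hj2 : r₁ ^ 2 / M * ∫ x in r₁..(2 * r₁), j x ^ 2 ≤ r₁ ^ 2 * M := by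
    calc _ ≤ r₁ ^ 2 / M * M ^ 2 := by gcongr; exact hj.le _ _ hr0 (by linarith)
      _ = _ := by field_simp
  have e4 : M / r₁ ^ 2 * (((2 * r₁) ^ (3 + 1) - r₁ ^ (3 + 1)) / ((3 : ℕ) + 1)) =
      15 / 4 * M * r₁ ^ 2 := by push_cast; field_simp; ring
  rw [e4] at n
  have tri : ((2 * r₁) ^ 2 - r₁ ^ 2) / 2 * |bK y yp s| ≤
      ‖((2 * r₁) ^ 2 - r₁ ^ 2) / 2 * bK y yp s - ∫ x in r₁..(2 * r₁), x * bK y yp x‖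
      + |∫ x in r₁..(2 * r₁), x * bK y yp x| := by
    have h0 : 0 ≤ ((2 * r₁) ^ 2 - r₁ ^ 2) / 2 := by nlinarith
    rw [Real.norm_eq_abs]
    have := abs_sub_abs_le_abs_sub (((2 * r₁) ^ 2 - r₁ ^ 2) / 2 * bK y yp s)
      (∫ x in r₁..(2 * r₁), x * bK y yp x)
    rw [abs_mul, abs_of_nonneg h0] at this
    linarith
  have fin : r₁ ^ 2 * (3 / 2 * |bK y yp s|) ≤ r₁ ^ 2 * (3 / 2 * (2 * (√s * j s) + 1200 * B)
      + M + 15 / 4 * M + Q) := by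
    have : ((2 * r₁) ^ 2 - r₁ ^ 2) / 2 = 3 / 2 * r₁ ^ 2 := by ring
    rw [this] at tri n
    linarith
  have fin' := le_of_mul_le_mul_left fin (by positivity)
  have hQ0 : 0 ≤ Q := by
    by_contra hneg
    have := (abs_nonneg _).trans hQ
    have : Q * r₁ ^ 2 < 0 := mul_neg_of_neg_of_pos (by linarith) (by positivity)
    linarith
  rw [hB] at fin'
  have g1 : 0 ≤ √s * j s := by positivity
  have g2 : 0 ≤ M * Λ := by positivity
  have g3 : 0 ≤ η * √s := by positivity
  have g4 : 0 ≤ η * √r₁ := by positivity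
  have g5 : 0 ≤ H * (1 / (s * √s) + 1 / (r₁ * √r₁)) := by positivity
  linarith

end

/-- Radial profile of the potential. -/
def Vrad (r : ℝ) : ℝ := -2 * ((1 + r ^ 2 / 24) ^ 2)⁻¹

lemma Vrad_continuous : Continuous Vrad := by
  unfold Vrad
  exact continuous_const.mul (Continuous.inv₀ (by fun_prop) fun r => by positivity)

def lin2 (a b : ℝ) : ℝ × ℝ →L[ℝ] ℝ :=
  a • ContinuousLinearMap.fst ℝ ℝ ℝ + b • ContinuousLinearMap.snd ℝ ℝ ℝ

@[simp] lemma lin2_apply (a b : ℝ) (x : ℝ × ℝ) : lin2 a b x = a * x.1 + b * x.2 := by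
  simp [lin2]

/-- A function `g(t,r)`, `r > 0`, with partial derivatives `gt, gr`. -/
def HasGrad (g gt gr : ℝ → ℝ → ℝ) : Prop :=
  ∀ t r, 0 < r → HasFDerivAt (fun x : ℝ × ℝ => g x.1 x.2) (lin2 (gt t r) (gr t r)) (t, r)

section
variable {g gt gr k kt kr : ℝ → ℝ → ℝ}

lemma HasGrad.along (h : HasGrad g gt gr) {α β : ℝ → ℝ} {α' β' x : ℝ} (hα : HasDerivAt α α' x)
    (hβ : HasDerivAt β β' x) (hx : 0 < β x) :
    HasDerivAt (fun x => g (α x) (β x)) (gt (α x) (β x) * α' + gr (α x) (β x) * β') x := by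
  have := (h (α x) (β x) hx).comp_hasDerivAt x (hα.prodMk hβ)
  exact this.congr_deriv (by simp)

lemma HasGrad.deriv_t (h : HasGrad g gt gr) {t r : ℝ} (hr : 0 < r) :
    HasDerivAt (fun t => g t r) (gt t r) t := by
  simpa using h.along (hasDerivAt_id' t) (hasDerivAt_const t r) hr

lemma HasGrad.deriv_r (h : HasGrad g gt gr) {t r : ℝ} (hr : 0 < r) :
    HasDerivAt (fun r => g t r) (gr t r) r := by
  simpa using h.along (hasDerivAt_const r t) (hasDerivAt_id' r) hr

lemma HasGrad.continuousOn (h : HasGrad g gt gr) :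
    ContinuousOn (fun x : ℝ × ℝ => g x.1 x.2) (univ ×ˢ Ioi 0) := fun x hx =>
  (h x.1 x.2 hx.2).continuousAt.continuousWithinAt

lemma HasGrad.continuousOn_r (h : HasGrad g gt gr) (t : ℝ) :
    ContinuousOn (fun r => g t r) (Ioi 0) :=
  h.continuousOn.comp (f := fun r => (t, r)) (by fun_prop) fun _ hr => ⟨mem_univ _, hr⟩

lemma HasGrad.continuousOn_null (h : HasGrad g gt gr) :
    ContinuousOn (fun x : ℝ × ℝ => g ((x.2 - x.1) / 2) ((x.1 + x.2) / 2)) quad :=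
  h.continuousOn.comp (f := fun x : ℝ × ℝ => ((x.2 - x.1) / 2, (x.1 + x.2) / 2)) (by fun_prop)
    fun x hx => ⟨mem_univ _, half_pos (add_pos (show 0 < x.1 from hx.1) hx.2)⟩

lemma HasGrad.null_q (h : HasGrad g gt gr) {p q : ℝ} (hp : 0 < p) (hq : 0 < q) :
    HasDerivAt (fun q => g ((q - p) / 2) ((p + q) / 2))
      ((gt ((q - p) / 2) ((p + q) / 2) + gr ((q - p) / 2) ((p + q) / 2)) / 2) q := by
  have h1 : HasDerivAt (fun q : ℝ => (q - p) / 2) (1 / 2) q :=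
    ((hasDerivAt_id' q).sub_const p).div_const 2
  have h2 : HasDerivAt (fun q : ℝ => (p + q) / 2) (1 / 2) q :=
    ((hasDerivAt_id' q).const_add p).div_const 2
  exact (h.along h1 h2 (by positivity)).congr_deriv (by ring)

lemma HasGrad.null_p (h : HasGrad g gt gr) {p q : ℝ} (hp : 0 < p) (hq : 0 < q) :
    HasDerivAt (fun p => g ((q - p) / 2) ((p + q) / 2))
      ((gr ((q - p) / 2) ((p + q) / 2) - gt ((q - p) / 2) ((p + q) / 2)) / 2) p := by
  have h1 : HasDerivAt (fun p : ℝ => (q - p) / 2) (-1 / 2) p :=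
    ((hasDerivAt_id' p).const_sub q).div_const 2
  have h2 : HasDerivAt (fun p : ℝ => (p + q) / 2) (1 / 2) p :=
    ((hasDerivAt_id' p).add_const q).div_const 2
  exact (h.along h1 h2 (by positivity)).congr_deriv (by ring)

lemma HasGrad.sub (h : HasGrad g gt gr) (h' : HasGrad k kt kr) :
    HasGrad (fun t r => g t r - k t r) (fun t r => gt t r - kt t r)
      (fun t r => gr t r - kr t r) := fun t r hr => by
  refine ((h t r hr).sub (h' t r hr)).congr_fderiv ?_
  ext <;> simp

lemma HasGrad.add (h : HasGrad g gt gr) (h' : HasGrad k kt kr) :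
    HasGrad (fun t r => g t r + k t r) (fun t r => gt t r + kt t r)
      (fun t r => gr t r + kr t r) := fun t r hr => by
  refine ((h t r hr).add (h' t r hr)).congr_fderiv ?_
  ext <;> simp

lemma HasGrad.const_mul (h : HasGrad g gt gr) (c : ℝ) :
    HasGrad (fun t r => c * g t r) (fun t r => c * gt t r) (fun t r => c * gr t r) :=
  fun t r hr => by
  refine ((h t r hr).const_mul c).congr_fderiv ?_
  ext <;> simp

lemma hasGrad_mul {α α' β β' : ℝ → ℝ} (hα : ∀ t, HasDerivAt α (α' t) t)
    (hβ : ∀ r, 0 < r → HasDerivAt β (β' r) r) :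
    HasGrad (fun t r => α t * β r) (fun t r => α' t * β r) (fun t r => α t * β' r) :=
  fun t r hr => by
  have h1 : HasFDerivAt (fun x : ℝ × ℝ => α x.1) (α' t • ContinuousLinearMap.fst ℝ ℝ ℝ) (t, r) :=
    (hα t).comp_hasFDerivAt (h₂ := α) (f := Prod.fst) (t, r) hasFDerivAt_fst
  have h2 : HasFDerivAt (fun x : ℝ × ℝ => β x.2) (β' r • ContinuousLinearMap.snd ℝ ℝ ℝ) (t, r) :=
    (hβ r hr).comp_hasFDerivAt (h₂ := β) (f := Prod.snd) (t, r) hasFDerivAt_snd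
  refine (h1.mul h2).congr_fderiv ?_
  ext <;> simp; ring

end

/-- `f + c` is a radial solution of the linearized equation for `r > 0`. -/
structure RadWave (c : ℝ) (f ft fr ftt ftr frr : ℝ → ℝ → ℝ) : Prop where
  d0 : HasGrad f ft fr
  d1 : HasGrad ft ftt ftr
  d2 : HasGrad fr ftr frr
  pde : ∀ t r, 0 < r → ftt t r = frr t r + 5 / r * fr t r - Vrad r * (f t r + c)

def wY (f : ℝ → ℝ → ℝ) (p q : ℝ) : ℝ :=
  ((p + q) / 2) ^ 2 * √((p + q) / 2) * f ((q - p) / 2) ((p + q) / 2)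

def wYp (f ft fr : ℝ → ℝ → ℝ) (p q : ℝ) : ℝ :=
  1 / 2 * (((p + q) / 2) ^ 2 * √((p + q) / 2) *
      (fr ((q - p) / 2) ((p + q) / 2) - ft ((q - p) / 2) ((p + q) / 2))
    + 5 / 2 * (((p + q) / 2) * √((p + q) / 2) * f ((q - p) / 2) ((p + q) / 2)))

def wYq (f ft fr : ℝ → ℝ → ℝ) (p q : ℝ) : ℝ :=
  1 / 2 * (((p + q) / 2) ^ 2 * √((p + q) / 2) *
      (fr ((q - p) / 2) ((p + q) / 2) + ft ((q - p) / 2) ((p + q) / 2))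
    + 5 / 2 * (((p + q) / 2) * √((p + q) / 2) * f ((q - p) / 2) ((p + q) / 2)))

def wσ (c : ℝ) (f : ℝ → ℝ → ℝ) (p q : ℝ) : ℝ :=
  Vrad ((p + q) / 2) / 4 * (wY f p q + c * (((p + q) / 2) ^ 2 * √((p + q) / 2)))

lemma hasDerivAt_sq_sqrt {r : ℝ} (hr : 0 < r) :
    HasDerivAt (fun r => r ^ 2 * √r) (5 / 2 * (r * √r)) r := by
  refine ((hasDerivAt_pow 2 r).mul (hasDerivAt_sqrt hr.ne')).congr_deriv ?_
  have h : √r * √r = r := mul_self_sqrt hr.le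
  have h0 : 0 < √r := by positivity
  field_simp
  push_cast
  nlinarith

lemma hasDerivAt_mul_sqrt {r : ℝ} (hr : 0 < r) :
    HasDerivAt (fun r => r * √r) (3 / 2 * √r) r := by
  refine ((hasDerivAt_id' r).mul (hasDerivAt_sqrt hr.ne')).congr_deriv ?_
  have h : √r * √r = r := mul_self_sqrt hr.le
  have h0 : 0 < √r := by positivity
  field_simp
  nlinarith

section
variable {c : ℝ} {f ft fr ftt ftr frr : ℝ → ℝ → ℝ}

lemma HasGrad.nullSol {S : ℝ → ℝ → ℝ} (d0 : HasGrad f ft fr) (d1 : HasGrad ft ftt ftr)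
    (d2 : HasGrad fr ftr frr)
    (cS : ContinuousOn (fun x : ℝ × ℝ => S ((x.2 - x.1) / 2) ((x.1 + x.2) / 2)) quad)
    (pde : ∀ t r, 0 < r → ftt t r = frr t r + 5 / r * fr t r + S t r) :
    NullSol (wY f) (wYp f ft fr) (wYq f ft fr) (fun p q => -(1 / 4) *
      (((p + q) / 2) ^ 2 * √((p + q) / 2) * S ((q - p) / 2) ((p + q) / 2))) := by
  have hRq : ∀ p q : ℝ, HasDerivAt (fun q : ℝ => (p + q) / 2) (1 / 2) q := fun p q =>
    ((hasDerivAt_id' q).const_add p).div_const 2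
  have hRp : ∀ p q : ℝ, HasDerivAt (fun p : ℝ => (p + q) / 2) (1 / 2) p := fun p q =>
    ((hasDerivAt_id' p).add_const q).div_const 2
  have c0 := d0.continuousOn_null
  have c1 := d1.continuousOn_null
  have c2 := d2.continuousOn_null
  have cy : ContinuousOn (fun x : ℝ × ℝ => wY f x.1 x.2) quad := by
    unfold wY; exact ContinuousOn.mul (by fun_prop) c0
  have hpos : ∀ {p q : ℝ}, 0 < p → 0 < q → 0 < (p + q) / 2 := fun hp hq => by positivity
  refine ⟨?_, ?_, ?_, ?_, ?_, cy, ?_, ?_, ?_⟩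
  · intro p q hp hq
    refine (((hasDerivAt_sq_sqrt (hpos hp hq)).comp (h₂ := fun r => r ^ 2 * √r) p (hRp p q)).mul
      (d0.null_p hp hq)).congr_deriv ?_
    simp only [wYp, Function.comp]; ring
  · intro p q hp hq
    refine (((hasDerivAt_sq_sqrt (hpos hp hq)).comp (h₂ := fun r => r ^ 2 * √r) q (hRq p q)).mul
      (d0.null_q hp hq)).congr_deriv ?_
    simp only [wYq, Function.comp]; ring
  · intro p q hp hq
    have e1 := ((hasDerivAt_sq_sqrt (hpos hp hq)).comp (h₂ := fun r => r ^ 2 * √r) q (hRq p q)).mul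
      ((d2.null_q hp hq).sub (d1.null_q hp hq))
    have e2 := ((hasDerivAt_mul_sqrt (hpos hp hq)).comp (h₂ := fun r => r * √r) q (hRq p q)).mul
      (d0.null_q hp hq)
    refine ((e1.add (e2.const_mul (5 / 2))).const_mul (1 / 2)).congr_deriv ?_
    have e := pde ((q - p) / 2) ((p + q) / 2) (hpos hp hq)
    have hpq : p + q ≠ 0 := by positivity
    simp only [wY, Function.comp, Pi.sub_apply]
    rw [e]
    field_simp
    ring
  · intro p q hp hq
    have e1 := ((hasDerivAt_sq_sqrt (hpos hp hq)).comp (h₂ := fun r => r ^ 2 * √r) p (hRp p q)).mul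
      ((d2.null_p hp hq).add (d1.null_p hp hq))
    have e2 := ((hasDerivAt_mul_sqrt (hpos hp hq)).comp (h₂ := fun r => r * √r) p (hRp p q)).mul
      (d0.null_p hp hq)
    refine ((e1.add (e2.const_mul (5 / 2))).const_mul (1 / 2)).congr_deriv ?_
    have e := pde ((q - p) / 2) ((p + q) / 2) (hpos hp hq)
    have hpq : p + q ≠ 0 := by positivity
    simp only [wY, Function.comp, Pi.add_apply]
    rw [e]
    field_simp
    ring
  · intro r hr
    have e : (fun r => wY f r r) = fun r => r ^ 2 * √r * f 0 r := by
      funext r; simp [wY]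
    rw [e]
    refine ((hasDerivAt_sq_sqrt hr).mul (d0.deriv_r (t := 0) hr)).congr_deriv ?_
    simp only [wYp, wYq, sub_self, zero_div, add_self_div_two]; ring
  · unfold wYp
    exact continuousOn_const.mul ((ContinuousOn.mul (by fun_prop) (c2.sub c1)).add
      (continuousOn_const.mul (ContinuousOn.mul (by fun_prop) c0)))
  · unfold wYq
    exact continuousOn_const.mul ((ContinuousOn.mul (by fun_prop) (c2.add c1)).add
      (continuousOn_const.mul (ContinuousOn.mul (by fun_prop) c0)))
  · exact continuousOn_const.mul (ContinuousOn.mul (by fun_prop) cS)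

lemma RadWave.nullSol (h : RadWave c f ft fr ftt ftr frr) :
    NullSol (wY f) (wYp f ft fr) (wYq f ft fr) (wσ c f) := by
  have := Vrad_continuous
  have e : wσ c f = fun p q => -(1 / 4) * (((p + q) / 2) ^ 2 * √((p + q) / 2) *
      (-(Vrad ((p + q) / 2) * (f ((q - p) / 2) ((p + q) / 2) + c)))) := by
    funext p q; simp only [wσ, wY]; ring
  rw [e]
  refine h.d0.nullSol (S := fun t r => -(Vrad r * (f t r + c))) h.d1 h.d2
    (ContinuousOn.neg (ContinuousOn.mul (by fun_prop)
      (h.d0.continuousOn_null.add continuousOn_const))) fun t r hr => ?_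
  rw [h.pde t r hr]; ring

lemma RadWave.sym (h : RadWave c f ft fr ftt ftr frr) (he : ∀ t r, f (-t) r = f t r) {r : ℝ}
    (hr : 0 < r) : wYp f ft fr r r = wYq f ft fr r r := by
  have h0 : ft 0 r = 0 := by
    have d := h.d0.deriv_t (t := 0) hr
    have d' : HasDerivAt (fun t => f (-t) r) (ft (-0) r * (-1)) 0 :=
      HasDerivAt.comp (h₂ := fun t => f t r) (h := fun t => -t) 0
        (h.d0.deriv_t hr) (hasDerivAt_neg 0)
    simp only [he] at d'
    have := d.unique d'
    simp at this
    linarith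
  simp [wYp, wYq, h0]

lemma wY_diag (r : ℝ) : wY f r r = r ^ 2 * √r * f 0 r := by simp [wY]

lemma bK_wave {s : ℝ} (hs : 0 < s) :
    bK (wY f) (wYp f ft fr) s = s ^ 3 * (fr 0 s - ft 0 s) + 4 * s ^ 2 * f 0 s := by
  have h : √s * √s = s := mul_self_sqrt hs.le
  have h0 : 0 < √s := by positivity
  simp only [bK, wY_diag, wYp, sub_self, zero_div, add_self_div_two]
  field_simp
  linear_combination (2 * s * (fr 0 s - ft 0 s) + 5 * f 0 s) * h

lemma RadWave.hasDerivAt_quartic (h : RadWave c f ft fr ftt ftr frr)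
    (he : ∀ t r, f (-t) r = f t r) {s : ℝ} (hs : 0 < s) :
    HasDerivAt (fun s => s ^ 4 * f 0 s) (s * bK (wY f) (wYp f ft fr) s) s := by
  have h0 : ft 0 s = 0 := by
    have := h.sym he hs
    simp only [wYp, wYq, sub_self, zero_div, add_self_div_two] at this
    have h1 : s ^ 2 * √s * ft 0 s = 0 := by linarith
    have h2 : s ^ 2 * √s ≠ 0 := by positivity
    exact (mul_eq_zero.1 h1).resolve_left h2
  refine ((hasDerivAt_pow 4 s).mul (h.d0.deriv_r (t := 0) hs)).congr_deriv ?_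
  rw [bK_wave hs, h0]
  push_cast; ring

end

/-- Weight for the contraction on characteristic triangles. -/
def wedgeΦ (p q : ℝ) : ℝ := √q * rexp (-12 * √p / √q)

def wedgeΦq (p q : ℝ) : ℝ := rexp (-12 * √p / √q) * (1 / (2 * √q) + 6 * √p / q)

lemma wedgeΦ_hasDerivAt {p q : ℝ} (hq : 0 < q) :
    HasDerivAt (fun q => wedgeΦ p q) (wedgeΦq p q) q := by
  have h1 := hasDerivAt_sqrt hq.ne'
  have h0 : 0 < √q := by positivity
  have h2 := ((hasDerivAt_const q (-12 * √p)).div h1 h0.ne').exp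
  refine (h1.mul h2).congr_deriv ?_
  simp only [wedgeΦq, Pi.div_apply]
  obtain ⟨z, hz⟩ : ∃ z, z = √q := ⟨_, rfl⟩
  have h : q = z ^ 2 := by rw [hz, sq_sqrt hq.le]
  rw [← hz] at h0 ⊢
  rw [h]
  field_simp
  ring

lemma wedgeΦq_hasDerivAt {p q : ℝ} (hp : 0 < p) (hq : 0 < q) :
    HasDerivAt (fun p => wedgeΦq p q) (-(36 / q ^ 2 * wedgeΦ p q)) p := by
  have h1 := hasDerivAt_sqrt hp.ne'
  have h0 : 0 < √q := by positivity
  have hp0 : 0 < √p := by positivity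
  have h2 := ((h1.const_mul (-12)).div_const (√q)).exp
  have h3 := ((h1.const_mul 6).div_const q).const_add (1 / (2 * √q))
  refine (h2.mul h3).congr_deriv ?_
  simp only [wedgeΦ]
  obtain ⟨z, hz⟩ : ∃ z, z = √q := ⟨_, rfl⟩
  have h : q = z ^ 2 := by rw [hz, sq_sqrt hq.le]
  rw [← hz] at h0 ⊢
  rw [h]
  field_simp
  ring

lemma wedgeΦ_pos {p q : ℝ} (hq : 0 < q) : 0 < wedgeΦ p q := by
  unfold wedgeΦ; positivity

lemma wedgeΦq_nonneg {p q : ℝ} (hq : 0 < q) : 0 ≤ wedgeΦq p q := by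
  unfold wedgeΦq; positivity

lemma wedgeΦ_continuousOn : ContinuousOn (fun x : ℝ × ℝ => wedgeΦ x.1 x.2) quad := by
  unfold wedgeΦ
  refine ContinuousOn.mul (by fun_prop) (ContinuousOn.rexp (ContinuousOn.div (by fun_prop)
    (by fun_prop) fun x hx => ?_))
  have : 0 < x.2 := hx.2
  positivity

lemma sqrt_le_wedgeΦ {p q : ℝ} (hp : 0 < p) (hpq : p ≤ q) : √q ≤ rexp 12 * wedgeΦ p q := by
  have hq : 0 < q := hp.trans_le hpq
  have h0 : 0 < √q := by positivity
  have : √p ≤ √q := sqrt_le_sqrt hpq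
  have h1 : 1 ≤ rexp (12 + -12 * √p / √q) := by
    rw [one_le_exp_iff]
    rw [← sub_nonneg] at this
    have : 12 + -12 * √p / √q = 12 * (√q - √p) / √q := by field_simp; ring
    rw [this]; positivity
  unfold wedgeΦ
  rw [mul_left_comm, ← Real.exp_add]
  nlinarith

lemma wedgeΦ_le {p q : ℝ} (hq : 0 < q) : wedgeΦ p q ≤ √q := by
  unfold wedgeΦ
  have : rexp (-12 * √p / √q) ≤ 1 := by
    rw [exp_le_one_iff]
    have : 0 ≤ 12 * √p / √q := by positivity
    rw [neg_mul, neg_div]; linarith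
  exact mul_le_of_le_one_right (sqrt_nonneg q) this

def Cwedge : ℝ := 2 * rexp 12

lemma Cwedge_pos : 0 < Cwedge := by unfold Cwedge; positivity

section
variable {y yp yq σ : ℝ → ℝ → ℝ}

lemma NullSol.cdiag (h : NullSol y yp yq σ) : ContinuousOn (fun r => yq r r) (Ioi 0) :=
  h.cyq.comp (f := fun r => (r, r)) (by fun_prop) fun _ hr => ⟨hr, hr⟩

lemma ContinuousOn.quad_left {f : ℝ → ℝ → ℝ}
    (hf : ContinuousOn (fun x : ℝ × ℝ => f x.1 x.2) quad) {q : ℝ} (hq : 0 < q) :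
    ContinuousOn (fun p => f p q) (Ioi 0) :=
  hf.comp (f := fun p => (p, q)) (by fun_prop) fun _ hp => ⟨hp, hq⟩

lemma NullSol.wedge (h : NullSol y yp yq σ) {p₀ q₀ A D : ℝ} (hp₀ : 0 < p₀) (hA : 0 ≤ A) (hD : 0 ≤ D)
    (hF : ∀ p q, p₀ ≤ p → p ≤ q → q ≤ q₀ →
      |15 / 4 / (p + q) ^ 2 * y p q + σ p q| ≤ 16 / q ^ 2 * |y p q| + A / (q * √q))
    (hdiag : ∀ p q, p₀ ≤ p → p ≤ q → q ≤ q₀ → |y p p + ∫ r in p..q, yq r r| ≤ D * √q) :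
    ∀ p q, p₀ ≤ p → p ≤ q → q ≤ q₀ → |y p q| ≤ Cwedge * (D + 2 * A) * √q := by
  intro p q hp hpq hq
  have hp0 := hp₀.trans_le hp
  set tri : Set (ℝ × ℝ) := {x | p₀ ≤ x.1 ∧ x.1 ≤ x.2 ∧ x.2 ≤ q₀}
  have hcomp : IsCompact tri := by
    refine (isCompact_Icc.prod isCompact_Icc (s := Icc p₀ q₀) (t := Icc p₀ q₀)).of_isClosed_subset ?_ ?_
    · exact (isClosed_le continuous_const continuous_fst).inter
        ((isClosed_le continuous_fst continuous_snd).inter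
          (isClosed_le continuous_snd continuous_const))
    · rintro ⟨a, b⟩ ⟨h1, h2, h3⟩
      exact ⟨⟨h1, h2.trans h3⟩, ⟨h1.trans h2, h3⟩⟩
  have hsub : tri ⊆ quad := fun x hx =>
    ⟨hp₀.trans_le hx.1, (hp₀.trans_le hx.1).trans_le hx.2.1⟩
  have hcont : ContinuousOn (fun x : ℝ × ℝ => |y x.1 x.2| / wedgeΦ x.1 x.2) tri :=
    ContinuousOn.div (h.cy.abs.mono hsub) (wedgeΦ_continuousOn.mono hsub)
      fun x hx => (wedgeΦ_pos (hsub hx).2).ne'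
  obtain ⟨⟨a, b⟩, ⟨ha, hab, hb⟩, hmax⟩ := hcomp.exists_isMaxOn ⟨(p, q), hp, hpq, hq⟩ hcont
  have ha0 : 0 < a := hp₀.trans_le ha
  have hb0 : 0 < b := ha0.trans_le hab
  set N := |y a b| / wedgeΦ a b with hN
  have hN0 : 0 ≤ N := div_nonneg (abs_nonneg _) (wedgeΦ_pos hb0).le
  have hle : ∀ p q, p₀ ≤ p → p ≤ q → q ≤ q₀ → |y p q| ≤ N * wedgeΦ p q := fun p q h1 h2 h3 => by
    have := hmax (show (p, q) ∈ tri from ⟨h1, h2, h3⟩)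
    exact (div_le_iff₀ (wedgeΦ_pos (hp₀.trans_le (h1.trans h2)))).1 this
  have iq : ∀ x, 0 < x → IntervalIntegrable (yq a) volume a x := fun x hx =>
    (h.cyq.quad_right ha0).intervalIntegrable_Ioi ha0 hx
  have idg : IntervalIntegrable (fun r => yq r r) volume a b :=
    h.cdiag.intervalIntegrable_Ioi ha0 hb0
  have r1 := intervalIntegral.integral_eq_sub_of_hasDerivAt
    (fun x hx => h.hq a x ha0 (uIcc_subset_Ioi ha0 hb0 hx)) (iq b hb0)
  have r2 : y a b = y a a + (∫ r in a..b, yq r r) - ∫ r in a..b, (yq r r - yq a r) := by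
    rw [intervalIntegral.integral_sub idg (iq b hb0)]; linarith
  have cΦq : ContinuousOn (fun q => wedgeΦq a q) (Ioi 0) := by
    unfold wedgeΦq
    have c1 : ContinuousOn (fun q : ℝ => -12 * √a / √q) (Ioi 0) :=
      continuousOn_const.div continuous_sqrt.continuousOn fun x (hx : 0 < x) => by positivity
    have c2 : ContinuousOn (fun q : ℝ => 1 / (2 * √q)) (Ioi 0) :=
      continuousOn_const.div (continuous_sqrt.continuousOn.const_mul 2 |>.congr fun _ _ => rfl)
        fun x (hx : 0 < x) => by positivity
    have c3 : ContinuousOn (fun q : ℝ => 6 * √a / q) (Ioi 0) :=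
      continuousOn_const.div continuousOn_id fun x (hx : 0 < x) => ne_of_gt hx
    exact c1.rexp.mul (c2.add c3)
  have iΦq := cΦq.intervalIntegrable_Ioi ha0 hb0
  obtain ⟨is, es⟩ := integral_inv_sqrt ha0 hb0
  have key : |∫ r in a..b, (yq r r - yq a r)| ≤ ∫ r in a..b, (4 / 9 * N * wedgeΦq a r + A * (1 / √r)) := by
    refine intervalIntegral.norm_integral_le_of_norm_le (μ := volume) (f := fun r => yq r r - yq a r)
      (g := fun r => 4 / 9 * N * wedgeΦq a r + A * (1 / √r)) hab
      (Eventually.of_forall fun r hr => ?_) ((iΦq.const_mul _).add (is.const_mul _))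
    rw [norm_eq_abs]
    have hr0 : 0 < r := ha0.trans hr.1
    have hw : ContinuousOn (fun x : ℝ × ℝ => 15 / 4 / (x.1 + x.2) ^ 2) quad :=
      ContinuousOn.div (by fun_prop) (by fun_prop) fun x hx => pow_ne_zero 2 (quad_add_ne hx)
    have iF : IntervalIntegrable (fun p => 15 / 4 / (p + r) ^ 2 * y p r + σ p r) volume a r :=
      (ContinuousOn.quad_left (f := fun p q => 15 / 4 / (p + q) ^ 2 * y p q + σ p q)
        ((hw.mul h.cy).add h.cσ) hr0).intervalIntegrable_Ioi ha0 hr0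
    have e1 := intervalIntegral.integral_eq_sub_of_hasDerivAt
      (fun x hx => h.hqp x r (uIcc_subset_Ioi ha0 hr0 hx) hr0) iF
    rw [← e1]
    have iΦ : IntervalIntegrable (fun p => -(36 / r ^ 2 * wedgeΦ p r)) volume a r :=
      (continuousOn_const.mul (wedgeΦ_continuousOn.quad_left hr0)).neg.intervalIntegrable_Ioi ha0 hr0
    have e2 := intervalIntegral.integral_eq_sub_of_hasDerivAt
      (fun x hx => wedgeΦq_hasDerivAt (uIcc_subset_Ioi ha0 hr0 hx) hr0) iΦ
    refine (intervalIntegral.norm_integral_le_of_norm_le (μ := volume)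
      (f := fun p => 15 / 4 / (p + r) ^ 2 * y p r + σ p r) (g := fun p => -(4 / 9 * N) * (-(36 / r ^ 2 * wedgeΦ p r)) + A / (r * √r)) hr.1.le
      (Eventually.of_forall fun x hx => ?_) ((iΦ.const_mul _).add intervalIntegrable_const)).trans ?_
    · have hrq : r ≤ q₀ := hr.2.trans hb
      have := hF x r (ha.trans hx.1.le) hx.2 hrq
      refine this.trans (add_le_add ?_ le_rfl)
      have := mul_le_mul_of_nonneg_left (hle x r (ha.trans hx.1.le) hx.2 hrq)
        (show 0 ≤ 16 / r ^ 2 by positivity)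
      refine this.trans (le_of_eq (by ring))
    · rw [intervalIntegral.integral_add (iΦ.const_mul _) intervalIntegrable_const,
        intervalIntegral.integral_const_mul, e2, intervalIntegral.integral_const, smul_eq_mul]
      have t1 : 0 ≤ 4 / 9 * N * wedgeΦq r r := by have := wedgeΦq_nonneg (p := r) hr0; positivity
      have t2 : (r - a) * (A / (r * √r)) ≤ A * (1 / √r) := by
        calc _ ≤ r * (A / (r * √r)) := by gcongr; linarith
          _ = _ := by field_simp
      linarith
  rw [intervalIntegral.integral_add (iΦq.const_mul _) (is.const_mul _),
    intervalIntegral.integral_const_mul, intervalIntegral.integral_const_mul, es,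
    intervalIntegral.integral_eq_sub_of_hasDerivAt
      (fun x hx => wedgeΦ_hasDerivAt (uIcc_subset_Ioi ha0 hb0 hx)) iΦq] at key
  have hyab : |y a b| = N * wedgeΦ a b := by rw [hN, div_mul_cancel₀ _ (wedgeΦ_pos hb0).ne']
  have tot : |y a b| ≤ D * √b + (4 / 9 * N * (wedgeΦ a b - wedgeΦ a a) + A * (2 * √b - 2 * √a)) := by
    rw [r2]
    exact (abs_sub _ _).trans (add_le_add (hdiag a b ha hab hb) key)
  have hs := sqrt_le_wedgeΦ ha0 hab
  have f1 : 0 ≤ N * wedgeΦ a a := mul_nonneg hN0 (wedgeΦ_pos ha0).le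
  have f2 : 0 ≤ A * √a := by positivity
  have f3 : (D + 2 * A) * √b ≤ (D + 2 * A) * (rexp 12 * wedgeΦ a b) := by gcongr
  have f4 : 5 / 9 * N * wedgeΦ a b ≤ (D + 2 * A) * rexp 12 * wedgeΦ a b := by
    rw [hyab] at tot; linarith
  have f5 := le_of_mul_le_mul_right f4 (wedgeΦ_pos hb0)
  have f6 : N ≤ Cwedge * (D + 2 * A) := by
    have : 0 ≤ (D + 2 * A) * rexp 12 := by positivity
    unfold Cwedge; linarith
  exact (hle p q hp hpq hq).trans (mul_le_mul f6 (wedgeΦ_le (hp0.trans_le hpq))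
    (wedgeΦ_pos (hp0.trans_le hpq)).le (by have := Cwedge_pos; positivity))

end

lemma Vrad_abs (r : ℝ) : |Vrad r| = 1152 / (24 + r ^ 2) ^ 2 := by
  have : Vrad r = -(1152 / (24 + r ^ 2) ^ 2) := by unfold Vrad; field_simp; norm_num
  rw [this, abs_neg, abs_of_nonneg (by positivity)]

lemma Vrad_abs_le_inv_sq {r : ℝ} (hr : 0 < r) : |Vrad r| ≤ 12 / r ^ 2 := by
  rw [Vrad_abs, div_le_div_iff₀ (by positivity) (by positivity)]
  nlinarith [sq_nonneg (24 - r ^ 2)]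

lemma Vrad_abs_le_inv_quartic {r : ℝ} (hr : 0 < r) : |Vrad r| ≤ 1152 / r ^ 4 := by
  rw [Vrad_abs]
  gcongr
  nlinarith [sq_nonneg r]

lemma Vrad_abs_le_two (r : ℝ) : |Vrad r| ≤ 2 := by
  rw [Vrad_abs, div_le_iff₀ (by positivity)]
  nlinarith [sq_nonneg r]

section
variable {c : ℝ} {f ft fr ftt ftr frr : ℝ → ℝ → ℝ}

lemma coeff_abs_le {p q : ℝ} (hp : 0 < p) (hpq : p ≤ q) :
    |15 / 4 / (p + q) ^ 2 + Vrad ((p + q) / 2) / 4| ≤ 16 / q ^ 2 := by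
  have hq : 0 < q := hp.trans_le hpq
  have h1 : |Vrad ((p + q) / 2)| ≤ 48 / q ^ 2 :=
    (Vrad_abs_le_inv_sq (by positivity)).trans (by
      rw [div_le_div_iff₀ (by positivity) (by positivity)]; nlinarith)
  have h2 : 15 / 4 / (p + q) ^ 2 ≤ 15 / 4 / q ^ 2 := by gcongr; linarith
  have h3 : 15 / 4 / q ^ 2 + 48 / q ^ 2 / 4 ≤ 16 / q ^ 2 := by
    have : 15 / 4 / q ^ 2 + 48 / q ^ 2 / 4 = 63 / 4 / q ^ 2 := by ring
    rw [this]; gcongr; norm_num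
  refine (abs_add_le _ _).trans ?_
  rw [abs_of_pos (by positivity : 0 < 15 / 4 / (p + q) ^ 2), abs_div, abs_of_pos (by norm_num : (0:ℝ) < 4)]
  linarith

lemma Vrad_mul_le {R q : ℝ} (hq : 0 < q) (hR : q / 2 ≤ R) :
    |Vrad R| / 4 * (R ^ 2 * √R) ≤ 900 / (q * √q) := by
  have hR0 : 0 < R := by linarith
  have hr : √R * √R = R := mul_self_sqrt hR0.le
  have hr0 : 0 < √R := by positivity
  have hq0 : 0 < √q := by positivity
  have h1 := Vrad_abs_le_inv_quartic hR0
  calc |Vrad R| / 4 * (R ^ 2 * √R) ≤ 1152 / R ^ 4 / 4 * (R ^ 2 * √R) := by gcongr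
    _ = 288 / (R * √R) := by
      have : R ^ 2 = R * (√R * √R) := by rw [hr]; ring
      rw [div_div, div_mul_eq_mul_div, div_eq_div_iff (by positivity) (by positivity)]
      rw [show 1152 * (R ^ 2 * √R) * (R * √R) = 1152 * R ^ 3 * (√R * √R) by ring, hr]; ring
    _ ≤ _ := by
      rw [div_le_div_iff₀ (by positivity) (by positivity)]
      have h2 : √q ≤ 1.5 * √R := by
        rw [sqrt_le_left (by positivity), mul_pow, sq_sqrt hR0.le]; linarith
      have : q * √q ≤ (2 * R) * (1.5 * √R) := by gcongr; linarith
      nlinarith [mul_pos hR0 hr0]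

lemma RadWave.coeff_bound (c : ℝ) (f : ℝ → ℝ → ℝ) {p q : ℝ} (hp : 0 < p) (hpq : p ≤ q) :
    |15 / 4 / (p + q) ^ 2 * wY f p q + wσ c f p q| ≤
      16 / q ^ 2 * |wY f p q| + 900 * |c| / (q * √q) := by
  have hq : 0 < q := hp.trans_le hpq
  have e : 15 / 4 / (p + q) ^ 2 * wY f p q + wσ c f p q =
      (15 / 4 / (p + q) ^ 2 + Vrad ((p + q) / 2) / 4) * wY f p q +
      c * (Vrad ((p + q) / 2) / 4 * (((p + q) / 2) ^ 2 * √((p + q) / 2))) := by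
    unfold wσ; ring
  rw [e]
  refine (abs_add_le _ _).trans (add_le_add ?_ ?_)
  · rw [abs_mul]; gcongr; exact coeff_abs_le hp hpq
  · rw [abs_mul, abs_mul, abs_div, abs_of_pos (by norm_num : (0:ℝ) < 4),
      abs_of_nonneg (by positivity : 0 ≤ ((p + q) / 2) ^ 2 * √((p + q) / 2))]
    calc _ ≤ |c| * (900 / (q * √q)) := by
          gcongr; exact Vrad_mul_le hq (by linarith)
      _ = _ := by ring

lemma RadWave.diag_even (h : RadWave c f ft fr ftt ftr frr) (he : ∀ t r, f (-t) r = f t r)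
    {p q : ℝ} (hp : 0 < p) (hq : 0 < q) :
    wY f p p + ∫ r in p..q, wYq f ft fr r r = 1 / 2 * (wY f p p + wY f q q) := by
  have hn := h.nullSol
  have := intervalIntegral.integral_eq_sub_of_hasDerivAt (a := p) (b := q)
    (f' := fun r => 2 * wYq f ft fr r r)
    (fun x hx => (hn.diag x (uIcc_subset_Ioi hp hq hx)).congr_deriv
      (by rw [h.sym he (uIcc_subset_Ioi hp hq hx)]; ring))
    ((continuousOn_const.mul hn.cdiag).intervalIntegrable_Ioi hp hq)
  rw [intervalIntegral.integral_const_mul] at this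
  linarith

lemma wY_diag_le {r B : ℝ} (hr : 0 < r) (hB : r ^ 2 * |f 0 r| ≤ B) : |wY f r r| ≤ B * √r := by
  rw [wY_diag, abs_mul, abs_of_pos (by positivity)]
  calc _ = r ^ 2 * |f 0 r| * √r := by ring
    _ ≤ _ := by gcongr

lemma RadWave.wedge_even (h : RadWave c f ft fr ftt ftr frr) (he : ∀ t r, f (-t) r = f t r)
    {p q B : ℝ} (hp : 0 < p) (hpq : p ≤ q) (hB : ∀ r, p ≤ r → r ≤ q → r ^ 2 * |f 0 r| ≤ B) :
    |wY f p q| ≤ Cwedge * (B + 1800 * |c|) * √q := by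
  have hB0 : 0 ≤ B := (by positivity : (0:ℝ) ≤ p ^ 2 * |f 0 p|).trans (hB p le_rfl hpq)
  have := h.nullSol.wedge (p₀ := p) (q₀ := q) (A := 900 * |c|) (D := B) hp (by positivity) hB0
    (fun a b ha hab _ => RadWave.coeff_bound c f (hp.trans_le ha) hab)
    (fun a b ha hab hb => by
      have ha0 := hp.trans_le ha
      have hb0 := ha0.trans_le hab
      rw [h.diag_even he ha0 hb0]
      have h1 := wY_diag_le ha0 (hB a ha (hab.trans hb))
      have h2 := wY_diag_le hb0 (hB b (ha.trans hab) hb)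
      have h3 : B * √a ≤ B * √b := by gcongr
      rw [abs_mul, abs_of_pos (by norm_num : (0:ℝ) < 1 / 2)]
      have := abs_add_le (wY f a a) (wY f b b)
      linarith)
    p q le_rfl hpq le_rfl
  exact this.trans (le_of_eq (by ring))

end

def CJ : ℝ := 1000000 * (Cwedge + 1)

lemma CJ_pos : 0 < CJ := by have := Cwedge_pos; unfold CJ; positivity

section
variable {c : ℝ} {f ft fr ftt ftr frr : ℝ → ℝ → ℝ}

lemma integral_shift_inv_cube {p b : ℝ} (hp : 0 < p) (hb : 0 < b) :
    IntervalIntegrable (fun q : ℝ => 1 / (1 + q) ^ 3) volume p b ∧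
    ∫ q in p..b, 1 / (1 + q) ^ 3 = -(1 / 2) / (1 + b) ^ 2 - -(1 / 2) / (1 + p) ^ 2 :=
  integral_of_hasDerivAt_pos (F := fun x => -(1 / 2) / (1 + x) ^ 2) hp hb
    (fun x hx => by
      have hx1 : 0 < 1 + x := by linarith
      refine ((hasDerivAt_const x (-(1 / 2 : ℝ))).div (((hasDerivAt_id' x).const_add 1).fun_pow 2)
        (by positivity)).congr_deriv ?_
      field_simp
      ring)
    (ContinuousOn.div (by fun_prop) (by fun_prop) fun x (hx : 0 < x) => by positivity)

lemma integral_inv_p32 {p b : ℝ} (hp : 0 < p) (hb : 0 < b) :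
    IntervalIntegrable (fun q : ℝ => 1 / (q * √q)) volume p b ∧
    ∫ q in p..b, 1 / (q * √q) = -2 / √b - -2 / √p :=
  integral_of_hasDerivAt_pos (F := fun x => -2 / √x) hp hb
    (fun x hx => by
      have hx1 : √x * √x = x := mul_self_sqrt hx.le
      have hx0 : 0 < √x := by positivity
      refine ((hasDerivAt_const x (-2 : ℝ)).div (hasDerivAt_sqrt hx.ne') hx0.ne').congr_deriv ?_
      rw [pow_two, hx1]
      field_simp
      norm_num)
    (ContinuousOn.div (by fun_prop) (by fun_prop) fun x (hx : 0 < x) => by positivity)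

lemma RadWave.integral_source_le (h : RadWave c f ft fr ftt ftr frr)
    (he : ∀ t r, f (-t) r = f t r) {p L D₁ D₂ : ℝ} (hp : 0 < p) (hL : 0 ≤ L)
    (hD₁ : 0 ≤ D₁) (hD₂ : 0 ≤ D₂) (hB : ∀ r, p ≤ r → r ^ 2 * |f 0 r| ≤ D₁ + D₂ * √r) :
    ∫ q in p..(p + L), |wσ c f p q| ≤ CJ * ((D₁ + D₂) / (1 + p) ^ 2 + |c| / √p) := by
  have hpL : 0 < p + L := by linarith
  have hW := Cwedge_pos
  obtain ⟨i1, e1⟩ := integral_shift_inv_cube hp hpL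
  obtain ⟨i2, e2⟩ := integral_inv_p32 hp hpL
  have hn := h.nullSol
  have hle := intervalIntegral.integral_mono_on (μ := volume) (show p ≤ p + L by linarith)
    (f := fun q => |wσ c f p q|)
    (g := fun q => 20000 * Cwedge * (D₁ + D₂) * (1 / (1 + q) ^ 3) +
      (21600 * Cwedge + 900) * |c| * (1 / (q * √q)))
    ((hn.cσ.quad_right hp).intervalIntegrable_Ioi hp hpL).abs
    ((i1.const_mul _).add (i2.const_mul _)) (fun q hq => by
      have hq0 : 0 < q := hp.trans_le hq.1
      have hs0 : 0 < √q := by positivity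
      have hs1 : √q * √q = q := mul_self_sqrt hq0.le
      have hR : 0 < (p + q) / 2 := by positivity
      have hy := h.wedge_even he hp hq.1 (B := D₁ + D₂ * √q) fun r h1 h2 =>
        (hB r h1).trans (by gcongr)
      have hV1 : |Vrad ((p + q) / 2)| / 4 * √q ≤ 12 / (q * √q) := by
        calc _ ≤ 12 / ((p + q) / 2) ^ 2 / 4 * √q := by
              gcongr; exact Vrad_abs_le_inv_sq hR
          _ ≤ 12 / (q / 2) ^ 2 / 4 * √q := by gcongr; linarith
          _ = 12 / (q * (√q * √q)) * √q := by rw [hs1]; field_simp; norm_num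
          _ = 12 / (q * √q) := by field_simp
      have hV2 : |Vrad ((p + q) / 2)| / 4 * (√q * (1 + √q)) ≤ 20000 * (1 / (1 + q) ^ 3) := by
        rw [Vrad_abs]
        have h1 : (1 + q) ^ 2 / 5 ≤ 24 + ((p + q) / 2) ^ 2 := by
          nlinarith [sq_nonneg (q - 4), mul_pos hp hq0]
        have h2 : √q * (1 + √q) ≤ 2 * (1 + q) := by nlinarith [sq_nonneg (√q - 1)]
        calc _ ≤ 1152 / ((1 + q) ^ 2 / 5) ^ 2 / 4 * (2 * (1 + q)) := by gcongr
          _ = 14400 * (1 / (1 + q) ^ 3) := by field_simp; norm_num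
          _ ≤ _ := by gcongr; norm_num
      have hV3 := Vrad_mul_le hq0 (R := (p + q) / 2) (by linarith)
      set v := |Vrad ((p + q) / 2)| / 4 with hv
      have hv0 : 0 ≤ v := by positivity
      have e0 : |wσ c f p q| ≤ v * |wY f p q| + |c| * (v * (((p + q) / 2) ^ 2 * √((p + q) / 2))) := by
        unfold wσ
        rw [abs_mul, abs_div, abs_of_pos (by norm_num : (0:ℝ) < 4), ← hv]
        calc _ ≤ v * (|wY f p q| + |c * (((p + q) / 2) ^ 2 * √((p + q) / 2))|) := by
              gcongr; exact abs_add_le _ _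
          _ = _ := by
              rw [abs_mul, abs_of_nonneg (by positivity : 0 ≤ ((p + q) / 2) ^ 2 * √((p + q) / 2))]
              ring
      have e1 : v * |wY f p q| ≤ Cwedge * ((D₁ + D₂) * (v * (√q * (1 + √q))) + 1800 * |c| * (v * √q)) := by
        calc _ ≤ v * (Cwedge * (D₁ + D₂ * √q + 1800 * |c|) * √q) := by gcongr
          _ ≤ v * (Cwedge * ((D₁ + D₂) * (1 + √q) + 1800 * |c|) * √q) := by
              gcongr; nlinarith
          _ = _ := by ring
      have e2 : Cwedge * ((D₁ + D₂) * (v * (√q * (1 + √q))) + 1800 * |c| * (v * √q)) ≤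
          Cwedge * ((D₁ + D₂) * (20000 * (1 / (1 + q) ^ 3)) + 1800 * |c| * (12 / (q * √q))) := by
        gcongr
      have e3 : |c| * (v * (((p + q) / 2) ^ 2 * √((p + q) / 2))) ≤ |c| * (900 / (q * √q)) := by
        gcongr
      refine (e0.trans (add_le_add (e1.trans e2) e3)).trans (le_of_eq (by ring)))
  rw [intervalIntegral.integral_add (i1.const_mul _) (i2.const_mul _),
    intervalIntegral.integral_const_mul, intervalIntegral.integral_const_mul, e1, e2] at hle
  refine hle.trans ?_
  have a1 : 0 ≤ 1 / (1 + (p + L)) ^ 2 := by positivity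
  have a2 : 0 ≤ 1 / √(p + L) := by positivity
  have b1 : -(1 / 2) / (1 + (p + L)) ^ 2 - -(1 / 2) / (1 + p) ^ 2 ≤ 1 / (1 + p) ^ 2 := by
    have : 0 ≤ 1 / (1 + p) ^ 2 := by positivity
    ring_nf at *; linarith
  have b2 : -2 / √(p + L) - -2 / √p ≤ 2 * (1 / √p) := by
    ring_nf at *; linarith
  have : 0 ≤ 1 / (1 + p) ^ 2 := by positivity
  have : 0 ≤ 1 / √p := by positivity
  calc _ ≤ 20000 * Cwedge * (D₁ + D₂) * (1 / (1 + p) ^ 2) +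
        (21600 * Cwedge + 900) * |c| * (2 * (1 / √p)) := by gcongr
    _ ≤ CJ * (D₁ + D₂) * (1 / (1 + p) ^ 2) + CJ * |c| * (1 / √p) := by
      have c1 : 20000 * Cwedge ≤ CJ := by unfold CJ; linarith
      have c2 : (21600 * Cwedge + 900) * 2 ≤ CJ := by unfold CJ; linarith
      have c3 : (21600 * Cwedge + 900) * |c| * (2 * (1 / √p)) =
        (21600 * Cwedge + 900) * 2 * |c| * (1 / √p) := by ring
      rw [c3]
      gcongr
    _ = _ := by ring

end

/-- The scaling mode as a function of `Y = r²/24`. -/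
def φY (Y : ℝ) : ℝ := 2 * (1 - Y) / (1 + Y) ^ 3
def φY1 (Y : ℝ) : ℝ := 4 * (Y - 2) / (1 + Y) ^ 4
def φY2 (Y : ℝ) : ℝ := 12 * (3 - Y) / (1 + Y) ^ 5

def κY (Y : ℝ) : ℝ := -1 / (15 * Y ^ 2) - 16 / (15 * Y) + 4 * log Y + Y
def κY1 (Y : ℝ) : ℝ := 2 / (15 * Y ^ 3) + 16 / (15 * Y ^ 2) + 4 / Y + 1
def κY2 (Y : ℝ) : ℝ := -6 / (15 * Y ^ 4) - 32 / (15 * Y ^ 3) - 4 / Y ^ 2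

/-- Numerator of the generalized mode. -/
def νY (Y : ℝ) : ℝ := (1 - Y) * κY Y + 124 / 15
def νY1 (Y : ℝ) : ℝ := -κY Y + (1 - Y) * κY1 Y
def νY2 (Y : ℝ) : ℝ := -2 * κY1 Y + (1 - Y) * κY2 Y

/-- The generalized mode, as a function of `Y = r²/24`. -/
def μY (Y : ℝ) : ℝ := νY Y / (1 + Y) ^ 3
def μY1 (Y : ℝ) : ℝ := νY1 Y / (1 + Y) ^ 3 - 3 * νY Y / (1 + Y) ^ 4
def μY2 (Y : ℝ) : ℝ := νY2 Y / (1 + Y) ^ 3 - 6 * νY1 Y / (1 + Y) ^ 4 + 12 * νY Y / (1 + Y) ^ 5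

section
variable {Y : ℝ}

lemma hasDerivAt_add_one_pow (n : ℕ) (Y : ℝ) :
    HasDerivAt (fun Y : ℝ => (1 + Y) ^ n) (n * (1 + Y) ^ (n - 1)) Y := by
  simpa using ((hasDerivAt_id' Y).const_add 1).fun_pow n

lemma φY_hasDerivAt (hY : 0 ≤ Y) : HasDerivAt φY (φY1 Y) Y := by
  have h : HasDerivAt (fun Y : ℝ => 2 * (1 - Y)) (-2) Y :=
    (((hasDerivAt_id' Y).const_sub 1).const_mul 2).congr_deriv (by norm_num)
  refine (h.div (hasDerivAt_add_one_pow 3 Y) (by positivity)).congr_deriv ?_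
  unfold φY1; push_cast; field_simp; ring

lemma φY1_hasDerivAt (hY : 0 ≤ Y) : HasDerivAt φY1 (φY2 Y) Y := by
  have h : HasDerivAt (fun Y : ℝ => 4 * (Y - 2)) 4 Y :=
    (((hasDerivAt_id' Y).sub_const 2).const_mul 4).congr_deriv (by norm_num)
  refine (h.div (hasDerivAt_add_one_pow 4 Y) (by positivity)).congr_deriv ?_
  unfold φY2; push_cast; field_simp; ring

lemma κY_hasDerivAt (hY : 0 < Y) : HasDerivAt κY (κY1 Y) Y := by
  have h1 := (hasDerivAt_const Y (-1 : ℝ)).div ((hasDerivAt_pow 2 Y).const_mul 15) (by positivity)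
  have h2 := (hasDerivAt_const Y (16 : ℝ)).div ((hasDerivAt_id' Y).const_mul 15) (by positivity)
  have h3 := (hasDerivAt_log hY.ne').const_mul 4
  refine (((h1.sub h2).add h3).add (hasDerivAt_id' Y)).congr_deriv ?_
  unfold κY1; push_cast; field_simp; ring

lemma κY1_hasDerivAt (hY : 0 < Y) : HasDerivAt κY1 (κY2 Y) Y := by
  have h1 := (hasDerivAt_const Y (2 : ℝ)).div ((hasDerivAt_pow 3 Y).const_mul 15) (by positivity)
  have h2 := (hasDerivAt_const Y (16 : ℝ)).div ((hasDerivAt_pow 2 Y).const_mul 15) (by positivity)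
  have h3 := (hasDerivAt_const Y (4 : ℝ)).div (hasDerivAt_id' Y) hY.ne'
  refine (((h1.add h2).add h3).add_const 1).congr_deriv ?_
  unfold κY2; push_cast; field_simp; ring

lemma νY_hasDerivAt (hY : 0 < Y) : HasDerivAt νY (νY1 Y) Y := by
  refine ((((hasDerivAt_id' Y).const_sub 1).mul (κY_hasDerivAt hY)).add_const _).congr_deriv ?_
  unfold νY1; ring

lemma νY1_hasDerivAt (hY : 0 < Y) : HasDerivAt νY1 (νY2 Y) Y := by
  refine ((κY_hasDerivAt hY).neg.add (((hasDerivAt_id' Y).const_sub 1).mul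
    (κY1_hasDerivAt hY))).congr_deriv ?_
  unfold νY2; ring

lemma μY_hasDerivAt (hY : 0 < Y) : HasDerivAt μY (μY1 Y) Y := by
  refine ((νY_hasDerivAt hY).div (hasDerivAt_add_one_pow 3 Y) (by positivity)).congr_deriv ?_
  unfold μY1; push_cast; field_simp

lemma μY1_hasDerivAt (hY : 0 < Y) : HasDerivAt μY1 (μY2 Y) Y := by
  refine (((νY1_hasDerivAt hY).div (hasDerivAt_add_one_pow 3 Y) (by positivity)).sub
    (((νY_hasDerivAt hY).const_mul 3).div (hasDerivAt_add_one_pow 4 Y) (by positivity))).congr_deriv ?_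
  unfold μY2; push_cast; field_simp; ring

lemma φY_ode (hY : 0 ≤ Y) : Y * φY2 Y + 3 * φY1 Y + 12 * φY Y / (1 + Y) ^ 2 = 0 := by
  unfold φY φY1 φY2; field_simp; ring

lemma μY_ode (hY : 0 < Y) :
    Y * μY2 Y + 3 * μY1 Y + 12 * μY Y / (1 + Y) ^ 2 = -φY Y / 2 := by
  unfold μY μY1 μY2 νY νY1 νY2
  generalize κY Y = k
  unfold κY1 κY2 φY
  field_simp
  ring

lemma κY_strictMono {Y Z : ℝ} (hY : 0 < Y) (hZ : Y < Z) : κY Y < κY Z := by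
  have h1 := log_lt_log hY hZ
  have h2 : 1 / (15 * Z ^ 2) ≤ 1 / (15 * Y ^ 2) := by gcongr
  have h3 : 16 / (15 * Z) ≤ 16 / (15 * Y) := by gcongr
  have e1 : -1 / (15 * Z ^ 2) = -(1 / (15 * Z ^ 2)) := by ring
  have e2 : -1 / (15 * Y ^ 2) = -(1 / (15 * Y ^ 2)) := by ring
  unfold κY; rw [e1, e2]; linarith

lemma mode_det_pos {Y Z : ℝ} (hY : 1 < Y) (hZ : Y < Z) : 0 < φY Y * μY Z - φY Z * μY Y := by
  have h := κY_strictMono (by linarith) hZ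
  have e : φY Y * μY Z - φY Z * μY Y = 2 * ((Y - 1) * (Z - 1) * (κY Z - κY Y) + 124 / 15 * (Z - Y)) /
      ((1 + Y) ^ 3 * (1 + Z) ^ 3) := by
    have : 1 + Z ≠ 0 := by linarith
    have : 1 + Y ≠ 0 := by linarith
    unfold φY μY νY; field_simp; ring
  rw [e]
  have : 0 < Y - 1 := by linarith
  have : 0 < Z - 1 := by linarith
  have : 0 < Z - Y := by linarith
  have : 0 < κY Z - κY Y := by linarith
  have : 0 < 1 + Y := by linarith
  have : 0 < 1 + Z := by linarith
  positivity

lemma κY_abs_le (hY : 1 / 24 ≤ Y) : |κY Y| ≤ 165 * (1 + Y) := by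
  have h0 : 0 < Y := by linarith
  have h1 : 1 / Y ≤ 24 := by rw [div_le_iff₀ h0]; linarith
  have h1' : 0 < 1 / Y := by positivity
  have h2 := log_le_sub_one_of_pos h0
  have h3 := one_sub_inv_le_log_of_pos h0
  rw [← one_div] at h3
  have e : κY Y = -1 / 15 * (1 / Y) ^ 2 - 16 / 15 * (1 / Y) + 4 * log Y + Y := by
    unfold κY; field_simp
  rw [e, abs_le]
  constructor <;> nlinarith

lemma κY1_abs_le (hY : 1 / 24 ≤ Y) : |κY1 Y| ≤ 2555 := by
  have h0 : 0 < Y := by linarith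
  have h1 : 1 / Y ≤ 24 := by rw [div_le_iff₀ h0]; linarith
  have h1' : 0 < 1 / Y := by positivity
  have e : κY1 Y = 2 / 15 * (1 / Y) ^ 3 + 16 / 15 * (1 / Y) ^ 2 + 4 * (1 / Y) + 1 := by
    unfold κY1; field_simp
  have h2 : (1 / Y) ^ 2 ≤ 24 ^ 2 := by gcongr
  have h3 : (1 / Y) ^ 3 ≤ 24 ^ 3 := by gcongr
  rw [e, abs_of_pos (by positivity)]
  linarith

lemma νY_abs_le (hY : 1 / 24 ≤ Y) : |νY Y| ≤ 174 * (1 + Y) ^ 2 := by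
  have h := κY_abs_le hY
  have h1 : |1 - Y| ≤ 1 + Y := by rw [abs_le]; constructor <;> linarith
  unfold νY
  calc _ ≤ |1 - Y| * |κY Y| + |(124 / 15 : ℝ)| := by
        rw [← abs_mul]; exact abs_add_le _ _
    _ ≤ (1 + Y) * (165 * (1 + Y)) + 124 / 15 := by
        rw [abs_of_pos (by norm_num : (0:ℝ) < 124 / 15)]; gcongr
    _ ≤ _ := by nlinarith

lemma νY1_abs_le (hY : 1 / 24 ≤ Y) : |νY1 Y| ≤ 2720 * (1 + Y) := by
  have h := κY_abs_le hY
  have h' := κY1_abs_le hY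
  have h1 : |1 - Y| ≤ 1 + Y := by rw [abs_le]; constructor <;> linarith
  unfold νY1
  calc _ ≤ |κY Y| + |1 - Y| * |κY1 Y| := by
        rw [← abs_mul, ← abs_neg (κY Y)]; exact abs_add_le _ _
    _ ≤ 165 * (1 + Y) + (1 + Y) * 2555 := by gcongr
    _ = _ := by ring

lemma μY_abs_le (hY : 1 / 24 ≤ Y) : |μY Y| ≤ 174 / Y := by
  have h0 : 0 < Y := by linarith
  unfold μY
  rw [abs_div, abs_of_pos (by positivity : 0 < (1 + Y) ^ 3)]
  calc _ ≤ 174 * (1 + Y) ^ 2 / (1 + Y) ^ 3 := by gcongr; exact νY_abs_le hY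
    _ = 174 / (1 + Y) := by field_simp
    _ ≤ _ := by gcongr; linarith

lemma μY1_abs_le (hY : 1 / 24 ≤ Y) : |μY1 Y| ≤ 3300 / Y ^ 2 := by
  have h0 : 0 < Y := by linarith
  unfold μY1
  calc _ ≤ |νY1 Y| / (1 + Y) ^ 3 + 3 * |νY Y| / (1 + Y) ^ 4 := by
        refine (abs_sub _ _).trans (le_of_eq ?_)
        rw [abs_div, abs_div, abs_mul, abs_of_pos (by positivity : 0 < (1 + Y) ^ 3),
          abs_of_pos (by positivity : 0 < (1 + Y) ^ 4), abs_of_pos (by norm_num : (0:ℝ) < 3)]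
    _ ≤ 2720 * (1 + Y) / (1 + Y) ^ 3 + 3 * (174 * (1 + Y) ^ 2) / (1 + Y) ^ 4 := by
        gcongr
        exacts [νY1_abs_le hY, νY_abs_le hY]
    _ = 3242 / (1 + Y) ^ 2 := by field_simp; norm_num
    _ ≤ _ := by gcongr <;> linarith

lemma φY_abs_le (hY : 0 ≤ Y) : |φY Y| ≤ 2 / (1 + Y) ^ 2 := by
  have h1 : |1 - Y| ≤ 1 + Y := by rw [abs_le]; constructor <;> linarith
  unfold φY
  rw [abs_div, abs_mul, abs_of_pos (by positivity : 0 < (1 + Y) ^ 3), abs_of_pos (by norm_num : (0:ℝ) < 2)]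
  calc _ ≤ 2 * (1 + Y) / (1 + Y) ^ 3 := by gcongr
    _ = _ := by field_simp

lemma φY1_abs_le (hY : 0 ≤ Y) : |φY1 Y| ≤ 8 / (1 + Y) ^ 3 := by
  have h1 : |Y - 2| ≤ 2 * (1 + Y) := by rw [abs_le]; constructor <;> linarith
  unfold φY1
  rw [abs_div, abs_mul, abs_of_pos (by positivity : 0 < (1 + Y) ^ 4), abs_of_pos (by norm_num : (0:ℝ) < 4)]
  calc _ ≤ 4 * (2 * (1 + Y)) / (1 + Y) ^ 4 := by gcongr
    _ = _ := by field_simp; norm_num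

lemma μY_tendsto : Tendsto (fun Y => Y ^ 2 * μY Y) (𝓝[>] 0) (𝓝 (-1 / 15)) := by
  have hc : ContinuousAt (fun Y : ℝ => ((1 - Y) * (-1 / 15 - 16 / 15 * Y + 4 * (Y * (Y * log Y)) + Y ^ 3)
      + 124 / 15 * Y ^ 2) / (1 + Y) ^ 3) 0 := by
    have h1 : Continuous fun Y : ℝ => Y * log Y := Real.continuous_mul_log
    have h2 : Continuous fun Y : ℝ => ((1 - Y) * (-1 / 15 - 16 / 15 * Y + 4 * (Y * (Y * log Y)) + Y ^ 3)
      + 124 / 15 * Y ^ 2) := by fun_prop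
    exact h2.continuousAt.div (by fun_prop) (by norm_num)
  have ht := hc.tendsto.mono_left (nhdsWithin_le_nhds (s := Ioi 0))
  norm_num at ht
  refine Tendsto.congr' ?_ (ht.trans (le_of_eq (by norm_num)))
  filter_upwards [self_mem_nhdsWithin] with Y (hY : 0 < Y)
  unfold μY νY κY
  field_simp

end

/-- Composition of `g` with `Y = r²/24`. -/
lemma hasDerivAt_radial {g : ℝ → ℝ} {g' r : ℝ} (h : HasDerivAt g g' (r ^ 2 / 24)) :
    HasDerivAt (fun r => g (r ^ 2 / 24)) (g' * (r / 12)) r := by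
  have h1 : HasDerivAt (fun r : ℝ => r ^ 2 / 24) (r / 12) r :=
    ((hasDerivAt_pow 2 r).div_const 24).congr_deriv (by push_cast; ring)
  exact HasDerivAt.comp (h₂ := g) (h := fun r => r ^ 2 / 24) r h h1

lemma hasDerivAt_radial' {g : ℝ → ℝ} {g' r : ℝ} (h : HasDerivAt g g' (r ^ 2 / 24)) :
    HasDerivAt (fun r => g (r ^ 2 / 24) * (r / 12))
      (g' * (r ^ 2 / 24) / 6 + g (r ^ 2 / 24) / 12) r :=
  ((hasDerivAt_radial h).mul ((hasDerivAt_id' r).div_const 12)).congr_deriv (by ring)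

def φR (r : ℝ) : ℝ := φY (r ^ 2 / 24)
def φR1 (r : ℝ) : ℝ := φY1 (r ^ 2 / 24) * (r / 12)
def φR2 (r : ℝ) : ℝ := φY2 (r ^ 2 / 24) * (r ^ 2 / 24) / 6 + φY1 (r ^ 2 / 24) / 12
def μR (r : ℝ) : ℝ := μY (r ^ 2 / 24)
def μR1 (r : ℝ) : ℝ := μY1 (r ^ 2 / 24) * (r / 12)
def μR2 (r : ℝ) : ℝ := μY2 (r ^ 2 / 24) * (r ^ 2 / 24) / 6 + μY1 (r ^ 2 / 24) / 12

section
variable {r : ℝ}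

lemma φR_hasDerivAt (r : ℝ) : HasDerivAt φR (φR1 r) r :=
  hasDerivAt_radial (φY_hasDerivAt (by positivity))
lemma φR1_hasDerivAt (r : ℝ) : HasDerivAt φR1 (φR2 r) r :=
  hasDerivAt_radial' (φY1_hasDerivAt (by positivity))
lemma μR_hasDerivAt (hr : 0 < r) : HasDerivAt μR (μR1 r) r :=
  hasDerivAt_radial (μY_hasDerivAt (by positivity))
lemma μR1_hasDerivAt (hr : 0 < r) : HasDerivAt μR1 (μR2 r) r :=
  hasDerivAt_radial' (μY1_hasDerivAt (by positivity))

lemma φR_ode (hr : 0 < r) : φR2 r + 5 / r * φR1 r - Vrad r * φR r = 0 := by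
  have h := φY_ode (Y := r ^ 2 / 24) (by positivity)
  have e : φR2 r + 5 / r * φR1 r - Vrad r * φR r = 1 / 6 * (r ^ 2 / 24 * φY2 (r ^ 2 / 24) +
      3 * φY1 (r ^ 2 / 24) + 12 * φY (r ^ 2 / 24) / (1 + r ^ 2 / 24) ^ 2) := by
    unfold φR φR1 φR2 Vrad
    generalize φY (r ^ 2 / 24) = a
    generalize φY1 (r ^ 2 / 24) = b
    generalize φY2 (r ^ 2 / 24) = d
    field_simp
    ring
  rw [e, h, mul_zero]

lemma μR_ode (hr : 0 < r) : μR2 r + 5 / r * μR1 r - Vrad r * μR r = -φR r / 12 := by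
  have h := μY_ode (Y := r ^ 2 / 24) (by positivity)
  have e : μR2 r + 5 / r * μR1 r - Vrad r * μR r = 1 / 6 * (r ^ 2 / 24 * μY2 (r ^ 2 / 24) +
      3 * μY1 (r ^ 2 / 24) + 12 * μY (r ^ 2 / 24) / (1 + r ^ 2 / 24) ^ 2) := by
    unfold μR μR1 μR2 Vrad
    generalize μY (r ^ 2 / 24) = a
    generalize μY1 (r ^ 2 / 24) = b
    generalize μY2 (r ^ 2 / 24) = d
    field_simp
    ring
  rw [e, h]; unfold φR; ring

lemma radWave_φ : RadWave 0 (fun _ r => φR r) (fun _ _ => 0) (fun _ r => φR1 r) (fun _ _ => 0)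
    (fun _ _ => 0) (fun _ r => φR2 r) := by
  have a1 : ∀ t : ℝ, HasDerivAt (fun _ : ℝ => (1 : ℝ)) 0 t := fun t => hasDerivAt_const t 1
  have h1 := hasGrad_mul a1 (fun r _ => φR_hasDerivAt r)
  have h2 := hasGrad_mul a1 (fun r _ => φR1_hasDerivAt r)
  simp only [one_mul, zero_mul] at h1 h2
  refine ⟨h1, fun t r _ => ?_, h2, fun t r hr => ?_⟩
  · exact (hasFDerivAt_const (0:ℝ) (t, r)).congr_fderiv (by ext <;> simp)
  · have := φR_ode hr; rw [add_zero]; linarith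

def mW (t r : ℝ) : ℝ := μR r + -(t ^ 2 / 24) * φR r
def mWt (t r : ℝ) : ℝ := -(t / 12) * φR r
def mWr (t r : ℝ) : ℝ := μR1 r + -(t ^ 2 / 24) * φR1 r

lemma radWave_m : RadWave 0 mW mWt mWr (fun _ r => -(1 / 12) * φR r) (fun t r => -(t / 12) * φR1 r)
    (fun t r => μR2 r + -(t ^ 2 / 24) * φR2 r) := by
  have a1 : ∀ t : ℝ, HasDerivAt (fun _ : ℝ => (1 : ℝ)) 0 t := fun t => hasDerivAt_const t 1
  have a2 : ∀ t : ℝ, HasDerivAt (fun t : ℝ => -(t ^ 2 / 24)) (-(t / 12)) t := fun t =>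
    (((hasDerivAt_pow 2 t).div_const 24).neg).congr_deriv (by push_cast; ring)
  have a3 : ∀ t : ℝ, HasDerivAt (fun t : ℝ => -(t / 12)) (-(1 / 12)) t := fun t =>
    ((hasDerivAt_id' t).div_const 12).neg
  have h1 := hasGrad_mul a1 (fun r hr => μR_hasDerivAt hr)
  have h2 := hasGrad_mul a1 (fun r hr => μR1_hasDerivAt hr)
  have k1 := hasGrad_mul a2 (fun r _ => φR_hasDerivAt r)
  have k2 := hasGrad_mul a2 (fun r _ => φR1_hasDerivAt r)
  have k3 := hasGrad_mul a3 (fun r _ => φR_hasDerivAt r)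
  have e1 := h1.add k1
  have e2 := h2.add k2
  simp only [one_mul, zero_mul, zero_add] at e1 e2
  refine ⟨e1, k3, e2, fun t r hr => ?_⟩
  have i1 := φR_ode hr
  have i2 := μR_ode hr
  simp only [mW, mWr]
  linear_combination -i2 + t ^ 2 / 24 * i1

lemma φR_abs_le (hr : 0 < r) : |φR r| ≤ 1152 / r ^ 4 := by
  refine (φY_abs_le (by positivity)).trans ?_
  rw [div_le_div_iff₀ (by positivity) (by positivity)]
  nlinarith [sq_nonneg r, pow_pos hr 4]

lemma φR_abs_le_two (r : ℝ) : |φR r| ≤ 2 := by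
  refine (φY_abs_le (by positivity)).trans ?_
  rw [div_le_iff₀ (by positivity)]
  nlinarith [sq_nonneg r]

lemma φR1_abs_le_pos (hr : 0 < r) : |φR1 r| ≤ r := by
  unfold φR1
  rw [abs_mul, abs_of_pos (by positivity : 0 < r / 12)]
  have h : |φY1 (r ^ 2 / 24)| ≤ 8 := (φY1_abs_le (by positivity)).trans (by
    rw [div_le_iff₀ (by positivity)]
    have : 1 ≤ (1 + r ^ 2 / 24) ^ 3 := one_le_pow₀ (by nlinarith [sq_nonneg r])
    linarith)
  nlinarith

lemma φR1_abs_le (hr : 0 < r) : |φR1 r| ≤ 9216 / r ^ 5 := by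
  unfold φR1
  rw [abs_mul, abs_of_pos (by positivity : 0 < r / 12)]
  have h : |φY1 (r ^ 2 / 24)| ≤ 8 / (r ^ 2 / 24) ^ 3 := (φY1_abs_le (by positivity)).trans (by
    gcongr; linarith)
  calc _ ≤ 8 / (r ^ 2 / 24) ^ 3 * (r / 12) := by gcongr
    _ = _ := by field_simp; norm_num

lemma μR_abs_le (hr : 1 ≤ r) : |μR r| ≤ 4176 / r ^ 2 := by
  refine (μY_abs_le (by nlinarith)).trans (le_of_eq ?_)
  have : 0 < r := by linarith
  field_simp; norm_num

lemma μR1_abs_le (hr : 1 ≤ r) : |μR1 r| ≤ 158400 / r ^ 3 := by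
  have h0 : 0 < r := by linarith
  unfold μR1
  rw [abs_mul, abs_of_pos (by positivity : 0 < r / 12)]
  calc _ ≤ 3300 / (r ^ 2 / 24) ^ 2 * (r / 12) := by
        gcongr; exact μY1_abs_le (by nlinarith)
    _ = _ := by field_simp; norm_num

lemma mode_bounds {T : ℝ} (hT : 1 ≤ T) (hr : T ≤ r) :
    (|φR r| ≤ 160000 / r ^ 2 ∧ |φR1 r| ≤ 160000 / r ^ 3) ∧
    |mW T r| ≤ 160000 / r ^ 2 ∧ |mWt T r| ≤ 160000 / r ^ 3 ∧ |mWr T r| ≤ 160000 / r ^ 3 := by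
  have hr1 : 1 ≤ r := hT.trans hr
  have h0 : 0 < r := by linarith
  have f1 := φR_abs_le h0
  have f2 := φR1_abs_le h0
  have m1 := μR_abs_le hr1
  have m2 := μR1_abs_le hr1
  have hi : 1 / r ≤ 1 := by rw [div_le_one h0]; exact hr1
  have hi0 : 0 < 1 / r := by positivity
  have hTr : T * (1 / r) ≤ 1 := by rw [mul_one_div, div_le_one h0]; exact hr
  have hTr0 : 0 ≤ T * (1 / r) := by positivity
  set z := 1 / r with hz
  have e2 : ∀ C : ℝ, C / r ^ 2 = C * z ^ 2 := fun C => by rw [hz]; field_simp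
  have e3 : ∀ C : ℝ, C / r ^ 3 = C * z ^ 3 := fun C => by rw [hz]; field_simp
  have e4 : ∀ C : ℝ, C / r ^ 4 = C * z ^ 4 := fun C => by rw [hz]; field_simp
  have e5 : ∀ C : ℝ, C / r ^ 5 = C * z ^ 5 := fun C => by rw [hz]; field_simp
  simp only [e2, e3, e4, e5] at *
  have z2 : z ^ 2 ≤ 1 := by nlinarith
  have z4 : z ^ 4 ≤ z ^ 2 := by nlinarith [sq_nonneg z]
  have z5 : z ^ 5 ≤ z ^ 3 := by nlinarith [pow_pos hi0 3]
  have p2 : 0 < z ^ 2 := by positivity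
  have p3 : 0 < z ^ 3 := by positivity
  have tz : T ^ 2 * z ^ 4 ≤ z ^ 2 := by
    have : (T * z) ^ 2 ≤ 1 := by nlinarith
    nlinarith
  have tz5 : T ^ 2 * z ^ 5 ≤ z ^ 3 := by nlinarith
  have tz1 : T * z ^ 4 ≤ z ^ 3 := by nlinarith
  have hT2 : 0 ≤ T ^ 2 / 24 := by positivity
  refine ⟨⟨by linarith, by linarith⟩, ?_, ?_, ?_⟩
  · unfold mW
    refine (abs_add_le _ _).trans ?_
    rw [abs_mul, abs_neg, abs_of_nonneg hT2]
    have := mul_le_mul_of_nonneg_left f1 hT2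
    nlinarith
  · unfold mWt
    rw [abs_mul, abs_neg, abs_of_nonneg (by positivity : 0 ≤ T / 12)]
    have := mul_le_mul_of_nonneg_left f1 (by positivity : 0 ≤ T / 12)
    nlinarith
  · unfold mWr
    refine (abs_add_le _ _).trans ?_
    rw [abs_mul, abs_neg, abs_of_nonneg hT2]
    have := mul_le_mul_of_nonneg_left f2 hT2
    nlinarith

lemma μR_tendsto : Tendsto (fun r => r ^ 4 * μR r) (𝓝[>] 0) (𝓝 (-(192 / 5))) := by
  have h : Tendsto (fun r : ℝ => r ^ 2 / 24) (𝓝[>] 0) (𝓝[>] 0) := by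
    refine tendsto_nhdsWithin_iff.2 ⟨?_, ?_⟩
    · have : ContinuousAt (fun r : ℝ => r ^ 2 / 24) 0 := by fun_prop
      simpa using this.tendsto.mono_left (nhdsWithin_le_nhds (s := Ioi 0))
    · filter_upwards [self_mem_nhdsWithin] with r (hr : 0 < r)
      show 0 < r ^ 2 / 24
      positivity
  have := (μY_tendsto.comp h).const_mul 576
  norm_num at this
  refine (this.congr fun r => ?_).trans (le_of_eq (by norm_num))
  unfold μR; ring

end

lemma le_two_mul_of_contraction {S : Set ℝ} {g : ℝ → ℝ} {A K : ℝ} (hg : ∀ x ∈ S, 0 ≤ g x)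
    (hK : ∀ x ∈ S, g x ≤ K)
    (hc : ∀ N, 0 ≤ N → (∀ x ∈ S, g x ≤ N) → ∀ x ∈ S, g x ≤ A + N / 2) :
    ∀ x ∈ S, g x ≤ 2 * A := by
  intro x hx
  have hb : BddAbove (g '' S) := ⟨K, by rintro _ ⟨y, hy, rfl⟩; exact hK y hy⟩
  have hle : ∀ y ∈ S, g y ≤ sSup (g '' S) := fun y hy => le_csSup hb ⟨y, hy, rfl⟩
  have h1 : sSup (g '' S) ≤ A + sSup (g '' S) / 2 :=
    csSup_le ⟨_, x, hx, rfl⟩ (by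
      rintro _ ⟨y, hy, rfl⟩
      exact hc _ ((hg x hx).trans (hle x hx)) hle y hy)
  linarith [hle x hx]

lemma one_add_log_le_sqrt {x : ℝ} (hx : 0 < x) : 1 + log x ≤ 2 * √x := by
  have h : 0 < √x := by positivity
  have h1 := log_le_sub_one_of_pos h
  have : log x = 2 * log √x := by rw [log_sqrt hx.le]; ring
  linarith

lemma one_add_log_le_sqrt_sqrt {x : ℝ} (hx : 0 < x) : 1 + log x ≤ 4 * √√x := by
  have h : 0 < √x := by positivity
  have h2 : 0 < √√x := by positivity
  have h1 := log_le_sub_one_of_pos h2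
  have : log x = 4 * log √√x := by rw [log_sqrt h.le, log_sqrt hx.le]; ring
  linarith

lemma L2Bound.mono {j : ℝ → ℝ} {M M' : ℝ} (h : L2Bound j M) (hM : M ≤ M') : L2Bound j M' :=
  ⟨h.cont, h.nonneg, h.pos.trans_le hM, fun a b ha hab => (h.le a b ha hab).trans (by
    have := h.pos; gcongr)⟩

lemma L2Bound.integral_le {j : ℝ → ℝ} {M x y : ℝ} (h : L2Bound j M) (hx : 0 < x) (hxy : x ≤ y) :
    ∫ s in x..y, s * √s * j s ≤ M * y ^ 2 / 2 := by
  have hy : 0 < y := hx.trans_le hxy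
  have hM := h.pos
  have c1 : ContinuousOn (fun s : ℝ => s * √s * j s) (Ioi 0) :=
    ContinuousOn.mul (by fun_prop) h.cont
  have i2 : IntervalIntegrable (fun s : ℝ => j s ^ 2) volume x y :=
    (h.cont.pow 2).intervalIntegrable_Ioi hx hy
  have i3 : IntervalIntegrable (fun s : ℝ => s ^ 3) volume x y :=
    (continuous_pow 3).intervalIntegrable _ _
  have hle := intervalIntegral.integral_mono_on (μ := volume) hxy
    (f := fun s => s * √s * j s) (g := fun s => M / y ^ 2 * s ^ 3 + y ^ 2 / (4 * M) * j s ^ 2)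
    (c1.intervalIntegrable_Ioi hx hy) ((i3.const_mul _).add (i2.const_mul _)) fun s hs => by
      have hs0 : 0 < s := hx.trans_le hs.1
      have e : (s * √s) ^ 2 = s ^ 3 := by rw [mul_pow, sq_sqrt hs0.le]; ring
      have e2 : M / y ^ 2 * s ^ 3 + y ^ 2 / (4 * M) * j s ^ 2 - s * √s * j s =
          1 / (4 * M * y ^ 2) * (2 * M * (s * √s) - y ^ 2 * j s) ^ 2 := by
        rw [← e]; field_simp; ring
      have : 0 ≤ 1 / (4 * M * y ^ 2) * (2 * M * (s * √s) - y ^ 2 * j s) ^ 2 := by positivity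
      show s * √s * j s ≤ M / y ^ 2 * s ^ 3 + y ^ 2 / (4 * M) * j s ^ 2
      linarith
  rw [intervalIntegral.integral_add (i3.const_mul _) (i2.const_mul _),
    intervalIntegral.integral_const_mul, intervalIntegral.integral_const_mul, integral_pow] at hle
  have h1 := h.le x y hx hxy
  have h2 : M / y ^ 2 * ((y ^ (3 + 1) - x ^ (3 + 1)) / ((3 : ℕ) + 1)) ≤ M * y ^ 2 / 4 := by
    have : 0 ≤ x ^ 4 := by positivity
    calc _ ≤ M / y ^ 2 * (y ^ 4 / 4) := by
          gcongr
          · norm_num; linarith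
          · norm_num
      _ = _ := by field_simp
  have h3 : y ^ 2 / (4 * M) * ∫ s in x..y, j s ^ 2 ≤ M * y ^ 2 / 4 := by
    calc _ ≤ y ^ 2 / (4 * M) * M ^ 2 := by gcongr
      _ = _ := by field_simp
  linarith

/-- Size of the data of `f` at time `T` on the light cone parametrized by `p`. -/
def extSize (f ft fr : ℝ → ℝ → ℝ) (T p : ℝ) : ℝ :=
  |wYp f ft fr p (p + 2 * T)| + p / (p + 2 * T) ^ 2 * |wY f p (p + 2 * T)|

section
variable {c : ℝ} {f ft fr ftt ftr frr : ℝ → ℝ → ℝ}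

lemma RadWave.quartic_sub (h : RadWave c f ft fr ftt ftr frr) (he : ∀ t r, f (-t) r = f t r)
    {x y : ℝ} (hx : 0 < x) (hy : 0 < y) :
    ∫ s in x..y, s * bK (wY f) (wYp f ft fr) s = y ^ 4 * f 0 y - x ^ 4 * f 0 x :=
  intervalIntegral.integral_eq_sub_of_hasDerivAt
    (fun _ hs => h.hasDerivAt_quartic he (uIcc_subset_Ioi hx hy hs))
    ((continuousOn_id.mul (bK_continuousOn h.nullSol)).intervalIntegrable_Ioi hx hy)

lemma RadWave.quartic_le (h : RadWave c f ft fr ftt ftr frr) (he : ∀ t r, f (-t) r = f t r)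
    {j : ℝ → ℝ} {M x y : ℝ} (hj : L2Bound j M) (hx : 0 < x) (hxy : x ≤ y) {g G Γ : ℝ → ℝ}
    (hb : ∀ s, x ≤ s → s ≤ y → |bK (wY f) (wYp f ft fr) s| ≤ 5000 * (√s * j s) + g s)
    (hg : ∀ s, x ≤ s → s ≤ y → s * g s ≤ G s)
    (hΓ : ∀ s, 0 < s → HasDerivAt Γ (G s) s) (hG : ContinuousOn G (Ioi 0)) :
    |y ^ 4 * f 0 y - x ^ 4 * f 0 x| ≤ 2500 * M * y ^ 2 + (Γ y - Γ x) := by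
  have hy : 0 < y := hx.trans_le hxy
  rw [← h.quartic_sub he hx hy]
  have i1 : IntervalIntegrable (fun s : ℝ => s * √s * j s) volume x y :=
    ContinuousOn.intervalIntegrable_Ioi (ContinuousOn.mul (by fun_prop) hj.cont) hx hy
  have i2 := hG.intervalIntegrable_Ioi hx hy
  have h1 := intervalIntegral.norm_integral_le_of_norm_le (μ := volume) hxy
    (f := fun s => s * bK (wY f) (wYp f ft fr) s) (g := fun s => 5000 * (s * √s * j s) + G s)
    (Eventually.of_forall fun s hs => by
      have hs0 : 0 < s := hx.trans hs.1
      rw [norm_eq_abs, abs_mul, abs_of_pos hs0]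
      have a1 := mul_le_mul_of_nonneg_left (hb s hs.1.le hs.2) hs0.le
      have a2 := hg s hs.1.le hs.2
      calc _ ≤ _ := a1
        _ = 5000 * (s * √s * j s) + s * g s := by ring
        _ ≤ _ := by linarith)
    ((i1.const_mul _).add i2)
  rw [intervalIntegral.integral_add (i1.const_mul _) i2, intervalIntegral.integral_const_mul,
    intervalIntegral.integral_eq_sub_of_hasDerivAt
      (fun s hs => hΓ s (uIcc_subset_Ioi hx hy hs)) i2] at h1
  have h2 := hj.integral_le hx hxy
  rw [norm_eq_abs] at h1
  linarith

lemma RadWave.growth (h : RadWave c f ft fr ftt ftr frr) (he : ∀ t r, f (-t) r = f t r)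
    {K : ℝ} (hK : ∀ r, 1 ≤ r → r ^ 2 * |f 0 r| ≤ K) {p q : ℝ} (hp : 1 ≤ p) (hpq : p ≤ q) :
    |wY f p q| ≤ (Cwedge * (K + 1800 * |c|)) * q := by
  have hK0 : 0 ≤ K := (by positivity : (0:ℝ) ≤ 1 ^ 2 * |f 0 1|).trans (hK 1 le_rfl)
  have hC := Cwedge_pos
  have hq : 1 ≤ q := hp.trans hpq
  have hs : √q ≤ q := by rw [sqrt_le_left (by linarith)]; nlinarith
  refine (h.wedge_even he (by linarith) hpq (B := K) fun r h1 _ => hK r (hp.trans h1)).trans ?_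
  gcongr

/-- The kernel estimate for an even radial wave in terms of the size of its data at time `T`. -/
lemma RadWave.bK_le (h : RadWave c f ft fr ftt ftr frr) (he : ∀ t r, f (-t) r = f t r)
    {j : ℝ → ℝ} {T r₁ M M' η H K Q s : ℝ} (hT : 0 ≤ T) (hr₁ : 0 < r₁) (hs : 0 < s)
    (hj : L2Bound j M) (hMM : M ≤ M') (hη : 0 ≤ η) (hH : 0 ≤ H)
    (hK : ∀ r, 1 ≤ r → r ^ 2 * |f 0 r| ≤ K)
    (hext : ∀ p, 0 < p → extSize f ft fr T p ≤ j p + M / √p + η)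
    (hσ : ∀ p, s ≤ p ∨ r₁ ≤ p → ∫ q in p..(p + 2 * T), |wσ c f p q| ≤ (M' - M) / √p + H / p ^ 2)
    (hQ : |(2 * r₁) ^ 4 * f 0 (2 * r₁) - r₁ ^ 4 * f 0 r₁| ≤ Q * r₁ ^ 2) :
    |bK (wY f) (wYp f ft fr) s| ≤ Q + 5000 * (√s * j s + M' * (1 + |log (s / r₁)|)
      + η * (√s + √r₁) + H * (1 / (s * √s) + 1 / (r₁ * √r₁))) := by
  have hK0 : 0 ≤ K := (by positivity : (0:ℝ) ≤ 1 ^ 2 * |f 0 1|).trans (hK 1 le_rfl)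
  have hC := Cwedge_pos
  refine bK_anchored (L := 2 * T) (p₀ := min s r₁) (K := Cwedge * (K + 1800 * |c|)) h.nullSol
    (fun r hr => h.sym he hr)
    (by positivity) (lt_min hs hr₁) (min_le_left _ _) (min_le_right _ _) (by positivity)
    (fun p q hp hpq => h.growth he hK hp hpq) (hj.mono hMM) hη hH (fun p hp => ?_) ?_
  · have hp0 : 0 < p := hp.elim (fun h => hs.trans_le h) fun h => hr₁.trans_le h
    have h1 := hext p hp0
    have h2 := hσ p hp
    unfold sizeK majK
    unfold extSize at h1
    have : M' / √p = M / √p + (M' - M) / √p := by ring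
    linarith
  · rw [h.quartic_sub he hr₁ (by positivity)]; exact hQ

lemma inv_one_add_sq_le {p : ℝ} (hp : 0 < p) :
    1 / (1 + p) ^ 2 ≤ 1 / √p ∧ 1 / (1 + p) ^ 2 ≤ 1 := by
  have h : √p ≤ 1 + p := by rw [sqrt_le_left (by linarith)]; nlinarith
  have h0 : 0 < √p := by positivity
  constructor
  · gcongr; nlinarith
  · rw [div_le_one (by positivity)]; nlinarith

/-- Outer region. -/
lemma RadWave.stage_outer (h : RadWave c f ft fr ftt ftr frr) (he : ∀ t r, f (-t) r = f t r)
    {j : ℝ → ℝ} {T r₁ M η K : ℝ} (hT : 0 ≤ T) (hr₁ : 1 ≤ r₁) (hr₁' : 20000 * CJ ≤ r₁ ^ 2)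
    (hj : L2Bound j M) (hη : 0 ≤ η) (hK : ∀ r, 1 ≤ r → r ^ 2 * |f 0 r| ≤ K)
    (hext : ∀ p, 0 < p → extSize f ft fr T p ≤ j p + M / √p + η)
    (h1 : f 0 r₁ = 0) (h2 : f 0 (2 * r₁) = 0) :
    ∀ r, r₁ ≤ r → r ^ 2 * |f 0 r| ≤ 25000 * (M + CJ * |c| + η) * √r := by
  have hr0 : 0 < r₁ := by linarith
  have hM := hj.pos
  have hC := CJ_pos
  set M' := M + CJ * |c| with hM'
  have hMM : M ≤ M' := by rw [hM']; have : 0 ≤ CJ * |c| := by positivity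
                          linarith
  have key := le_two_mul_of_contraction (S := Ici r₁) (g := fun r => r ^ 2 * |f 0 r| / √r)
    (A := 12500 * M' + 10000 * η) (K := K) (fun x hx => by positivity)
    (fun x (hx : r₁ ≤ x) => by
      have hx1 : 1 ≤ x := hr₁.trans hx
      rw [div_le_iff₀ (by positivity)]
      have h3 := hK x hx1
      have h4 : 1 ≤ √x := one_le_sqrt.2 hx1
      have h5 : 0 ≤ x ^ 2 * |f 0 x| := by positivity
      nlinarith)
    (fun N hN0 hN s (hs : r₁ ≤ s) => by
      have hs0 : 0 < s := hr0.trans_le hs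
      have hN' : ∀ r, r₁ ≤ r → r ^ 2 * |f 0 r| ≤ N * √r := fun r hr => by
        have hr0 : 0 < r := hr0.trans_le hr
        exact (div_le_iff₀ (by positivity)).1 (hN r hr)
      have hb : ∀ x, r₁ ≤ x → x ≤ s → |bK (wY f) (wYp f ft fr) x| ≤ 5000 * (√x * j x) +
          5000 * (M' * (1 + log (x / r₁)) + η * (√x + √r₁) +
            CJ * N * (1 / (x * √x) + 1 / (r₁ * √r₁))) := fun x hx _ => by
        have hx0 : 0 < x := hr0.trans_le hx
        have := h.bK_le he (Q := 0) (H := CJ * N) hT hr0 hx0 hj hMM hη (by positivity) hK hext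
          (fun p hp => by
            have hp1 : r₁ ≤ p := hp.elim (fun h => hx.trans h) id
            have hp0 : 0 < p := hr0.trans_le hp1
            refine (h.integral_source_le he (L := 2 * T) (D₁ := 0) (D₂ := N) hp0 (by positivity)
              le_rfl hN0 fun r hr => by rw [zero_add]; exact hN' r (hp1.trans hr)).trans ?_
            have : N / (1 + p) ^ 2 ≤ N / p ^ 2 := by gcongr; linarith
            rw [zero_add, mul_add, hM', add_sub_cancel_left]
            calc _ ≤ CJ * (N / p ^ 2) + CJ * (|c| / √p) := by gcongr
              _ = _ := by ring) (by rw [h1, h2]; simp)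
        have hl : 0 ≤ log (x / r₁) := log_nonneg (by rw [le_div_iff₀ hr0]; linarith)
        rw [abs_of_nonneg hl] at this
        linarith
      set Kc := 5000 * (2 * M' + 2 * η + 2 * CJ * N / r₁ ^ 2) with hKc
      have hKc0 : 0 ≤ Kc := by positivity
      have := h.quartic_le he hj hr0 hs hb (G := fun _ => Kc * (s * √s))
        (Γ := fun x => Kc * (s * √s) * x) (fun x hx hxs => by
          have hx0 : 0 < x := hr0.trans_le hx
          have b1 : 1 + log (x / r₁) ≤ 2 * √x := by
            refine (one_add_log_le_sqrt (by positivity)).trans ?_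
            gcongr
            exact div_le_self hx0.le hr₁
          have b2 : √r₁ ≤ √x := by gcongr
          have b3 : 1 / (r₁ * √r₁) ≤ √x / r₁ ^ 2 := by
            have e : √r₁ * √r₁ = r₁ := mul_self_sqrt hr0.le
            calc 1 / (r₁ * √r₁) = √r₁ / (r₁ * (√r₁ * √r₁)) := by
                  have : 0 < √r₁ := by positivity
                  field_simp
              _ = √r₁ / r₁ ^ 2 := by rw [e]; ring
              _ ≤ _ := by gcongr
          have b4 : 1 / (x * √x) ≤ 1 / (r₁ * √r₁) := by gcongr
          have b5 : 5000 * (M' * (1 + log (x / r₁)) + η * (√x + √r₁) +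
            CJ * N * (1 / (x * √x) + 1 / (r₁ * √r₁))) ≤ Kc * √x := by
            have hM0 : 0 ≤ M' := hM.le.trans hMM
            have b6 : 1 / (x * √x) + 1 / (r₁ * √r₁) ≤ √x / r₁ ^ 2 + √x / r₁ ^ 2 :=
              add_le_add (b4.trans b3) b3
            have b7 : √x + √r₁ ≤ √x + √x := by linarith
            have b8 := mul_le_mul_of_nonneg_left b6 (by positivity : 0 ≤ CJ * N)
            have b9 := mul_le_mul_of_nonneg_left b7 hη
            have b10 := mul_le_mul_of_nonneg_left b1 hM0
            calc _ ≤ 5000 * (M' * (2 * √x) + η * (√x + √x) +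
                  CJ * N * (√x / r₁ ^ 2 + √x / r₁ ^ 2)) := by linarith
              _ = _ := by rw [hKc]; ring
          calc _ ≤ x * (Kc * √x) := by gcongr
            _ = Kc * (x * √x) := by ring
            _ ≤ _ := by gcongr)
        (fun x _ => by simpa using (hasDerivAt_id' x).const_mul (Kc * (s * √s))) continuousOn_const
      rw [h1, mul_zero, sub_zero, abs_mul, abs_of_pos (by positivity : 0 < s ^ 4)] at this
      have hsq : 0 < √s := by positivity
      have hs1 : 1 ≤ √s := one_le_sqrt.2 (hr₁.trans hs)
      have c1 : 2500 * M * s ^ 2 ≤ 2500 * M' * (s ^ 2 * √s) := by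
        calc _ ≤ 2500 * M' * s ^ 2 := by gcongr
          _ ≤ _ := by
            have hM0 : 0 ≤ M' := hM.le.trans hMM
            gcongr; nlinarith [sq_nonneg s]
      have c2 : Kc * (s * √s) * s - Kc * (s * √s) * r₁ ≤ Kc * (s ^ 2 * √s) := by
        have : 0 ≤ Kc * (s * √s) * r₁ := by positivity
        nlinarith
      have c3 : Kc ≤ 10000 * M' + 10000 * η + N / 2 := by
        have : 2 * CJ * N / r₁ ^ 2 ≤ N / 10000 := by
          rw [div_le_div_iff₀ (by positivity) (by positivity)]; nlinarith
        rw [hKc]; linarith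
      show s ^ 2 * |f 0 s| / √s ≤ _
      rw [div_le_iff₀ hsq]
      have c4 : s ^ 2 * (s ^ 2 * |f 0 s|) ≤ s ^ 2 * ((12500 * M' + 10000 * η + N / 2) * √s) := by
        calc _ = s ^ 4 * |f 0 s| := by ring
          _ ≤ 2500 * M' * (s ^ 2 * √s) + (10000 * M' + 10000 * η + N / 2) * (s ^ 2 * √s) := by
            have : Kc * (s ^ 2 * √s) ≤ (10000 * M' + 10000 * η + N / 2) * (s ^ 2 * √s) := by gcongr
            linarith
          _ = _ := by ring
      exact le_of_mul_le_mul_left c4 (by positivity))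
  intro r hr
  have hr' : 0 < r := hr0.trans_le hr
  have := (div_le_iff₀ (by positivity)).1 (key r hr)
  refine this.trans (mul_le_mul_of_nonneg_right ?_ (sqrt_nonneg _))
  linarith

end

section
variable {c : ℝ} {f ft fr ftt ftr frr : ℝ → ℝ → ℝ}

/-- Inner region. -/
lemma RadWave.stage_inner (h : RadWave c f ft fr ftt ftr frr) (he : ∀ t r, f (-t) r = f t r)
    {j : ℝ → ℝ} {T r₁ M η K N₁ : ℝ} (hT : 0 ≤ T) (hr₁ : 1 ≤ r₁)
    (hj : L2Bound j M) (hη : 0 ≤ η) (hK : ∀ r, 1 ≤ r → r ^ 2 * |f 0 r| ≤ K)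
    (hext : ∀ p, 0 < p → extSize f ft fr T p ≤ j p + M / √p + η)
    (h1 : f 0 r₁ = 0) (h2 : f 0 (2 * r₁) = 0) (hN₁ : 0 ≤ N₁)
    (hout : ∀ r, r₁ ≤ r → r ^ 2 * |f 0 r| ≤ N₁ * √r) {s : ℝ} (hs : 0 < s) (hsr : s ≤ r₁) :
    s ^ 4 * |f 0 s| ≤ 20000 * (M + CJ * (N₁ + |c|) + η) * r₁ ^ 3 * exp (40000 * CJ * √r₁) := by
  have hr0 : 0 < r₁ := by linarith
  have hM := hj.pos
  have hC := CJ_pos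
  set M' := M + CJ * (N₁ + |c|) with hM'
  have hMM : M ≤ M' := by
    have : 0 ≤ CJ * (N₁ + |c|) := by positivity
    linarith
  have hM0 : 0 ≤ M' := hM.le.trans hMM
  set E : ℝ → ℝ := fun x => exp (40000 * CJ * (√r₁ - √x)) with hE
  have hE0 : ∀ x, 0 < E x := fun x => exp_pos _
  have hE1 : ∀ x, x ≤ r₁ → 1 ≤ E x := fun x hx => by
    have : √x ≤ √r₁ := by gcongr
    exact one_le_exp (mul_nonneg (by positivity) (by linarith))
  have hEa : ∀ x y, x ≤ y → E y ≤ E x := fun x y hxy => by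
    have : √x ≤ √y := by gcongr
    simp only [hE]
    gcongr
  have cf : ContinuousOn (fun x => x ^ 4 * |f 0 x| / E x) (Icc s r₁) := by
    have hc : ContinuousOn (fun x => f 0 x) (Icc s r₁) :=
      (h.d0.continuousOn_r 0).mono fun x hx => hs.trans_le hx.1
    refine ContinuousOn.div ((continuous_pow 4).continuousOn.mul hc.abs) ?_
      fun x _ => (hE0 x).ne'
    have : Continuous E := by simp only [hE]; fun_prop
    exact this.continuousOn
  obtain ⟨K', hK'⟩ := isCompact_Icc.exists_bound_of_continuousOn cf
  have key := le_two_mul_of_contraction (S := Icc s r₁) (g := fun x => x ^ 4 * |f 0 x| / E x)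
    (A := 10000 * (M' + η) * r₁ ^ 3) (K := K') (fun x hx => by have := hE0 x; positivity)
    (fun x hx => (le_abs_self _).trans (hK' x hx))
    (fun N hN0 hN x hx => by
      have hx0 : 0 < x := hs.trans_le hx.1
      have hN' : ∀ r, s ≤ r → r ≤ r₁ → r ^ 4 * |f 0 r| ≤ N * E r := fun r h1 h2 =>
        (div_le_iff₀ (hE0 r)).1 (hN r ⟨h1, h2⟩)
      have hb : ∀ y, x ≤ y → y ≤ r₁ → |bK (wY f) (wYp f ft fr) y| ≤ 5000 * (√y * j y) +
          5000 * (M' * (1 + log (r₁ / y)) + η * (√y + √r₁) +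
            CJ * N * E y * (1 / (y * √y) + 1 / (r₁ * √r₁))) := fun y hxy hyr => by
        have hy0 : 0 < y := hx0.trans_le hxy
        have hEy := hE0 y
        have := h.bK_le he (Q := 0) (H := CJ * N * E y) hT hr0 hy0 hj hMM hη (by positivity) hK hext
          (fun p hp => by
            have hyp : y ≤ p := hp.elim id fun h => hyr.trans h
            have hp0 : 0 < p := hy0.trans_le hyp
            refine (h.integral_source_le he (L := 2 * T) (D₁ := N * E y / p ^ 2) (D₂ := N₁) hp0
              (by positivity) (by positivity) hN₁ fun r hr => ?_).trans ?_
            · have hr0 : 0 < r := hp0.trans_le hr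
              rcases le_total r r₁ with hrr | hrr
              · have a1 := hN' r (hx.1.trans (hxy.trans (hyp.trans hr))) hrr
                have a2 := hEa y r (hyp.trans hr)
                have : r ^ 2 * |f 0 r| ≤ N * E y / p ^ 2 := by
                  rw [le_div_iff₀ (by positivity)]
                  calc _ ≤ r ^ 2 * |f 0 r| * r ^ 2 := by gcongr
                    _ = r ^ 4 * |f 0 r| := by ring
                    _ ≤ N * E r := a1
                    _ ≤ _ := by gcongr
                have : 0 ≤ N₁ * √r := by positivity
                linarith
              · have : 0 ≤ N * E y / p ^ 2 := by positivity
                linarith [hout r hrr]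
            · obtain ⟨q1, q2⟩ := inv_one_add_sq_le hp0
              have a1 : N * E y / p ^ 2 * (1 / (1 + p) ^ 2) ≤ N * E y / p ^ 2 :=
                mul_le_of_le_one_right (by positivity) q2
              have a2 : N₁ * (1 / (1 + p) ^ 2) ≤ N₁ * (1 / √p) := by gcongr
              rw [hM', add_sub_cancel_left]
              calc _ = CJ * (N * E y / p ^ 2 * (1 / (1 + p) ^ 2) + N₁ * (1 / (1 + p) ^ 2)
                      + |c| / √p) := by ring
                _ ≤ CJ * (N * E y / p ^ 2 + N₁ * (1 / √p) + |c| / √p) := by gcongr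
                _ = _ := by ring) (by rw [h1, h2]; simp)
        have hl : log (y / r₁) = - log (r₁ / y) := by rw [← Real.log_inv, inv_div]
        have hl0 : 0 ≤ log (r₁ / y) := log_nonneg (by rw [le_div_iff₀ hy0]; linarith)
        rw [hl, abs_neg, abs_of_nonneg hl0] at this
        linarith
      set Kc := 5000 * M' * r₁ + 10000 * η * (r₁ * √r₁) with hKc
      have hKc0 : 0 ≤ Kc := by positivity
      have := h.quartic_le he hj hx0 hx.2 hb (G := fun y => Kc + 10000 * CJ * N * E y / √y)
        (Γ := fun y => Kc * y - N / 2 * E y) (fun y hxy hyr => by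
          have hy0 : 0 < y := hx0.trans_le hxy
          have hEy := hE0 y
          have b1 : y * (1 + log (r₁ / y)) ≤ r₁ := by
            have := log_le_sub_one_of_pos (by positivity : 0 < r₁ / y)
            calc _ ≤ y * (r₁ / y) := by gcongr; linarith
              _ = _ := by field_simp
          have b2 : y * (√y + √r₁) ≤ 2 * (r₁ * √r₁) := by
            have : √y ≤ √r₁ := by gcongr
            calc _ ≤ r₁ * (√r₁ + √r₁) := by gcongr
              _ = _ := by ring
          have b3 : y * (1 / (y * √y) + 1 / (r₁ * √r₁)) ≤ 2 / √y := by
            have : 1 / (r₁ * √r₁) ≤ 1 / (y * √y) := by gcongr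
            calc _ ≤ y * (1 / (y * √y) + 1 / (y * √y)) := by gcongr
              _ = _ := by field_simp; ring
          have d1 := mul_le_mul_of_nonneg_left b1 hM0
          have d2 := mul_le_mul_of_nonneg_left b2 hη
          have d3 := mul_le_mul_of_nonneg_left b3 (by positivity : 0 ≤ CJ * N * E y)
          calc _ = 5000 * (M' * (y * (1 + log (r₁ / y))) + η * (y * (√y + √r₁)) +
                CJ * N * E y * (y * (1 / (y * √y) + 1 / (r₁ * √r₁)))) := by ring
            _ ≤ 5000 * (M' * r₁ + η * (2 * (r₁ * √r₁)) + CJ * N * E y * (2 / √y)) := by linarith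
            _ = _ := by rw [hKc]; ring)
        (fun y hy => by
          have e1 : HasDerivAt E (E y * (40000 * CJ * (0 - 1 / (2 * √y)))) y :=
            (((hasDerivAt_const y √r₁).sub (hasDerivAt_sqrt hy.ne')).const_mul _).exp
          refine (((hasDerivAt_id' y).const_mul Kc).sub (e1.const_mul (N / 2))).congr_deriv ?_
          have : 0 < √y := by positivity
          field_simp
          ring)
        (by
          have : Continuous E := by simp only [hE]; fun_prop
          exact continuousOn_const.add ((continuousOn_const.mul this.continuousOn).div
            continuous_sqrt.continuousOn fun y (hy : 0 < y) => (sqrt_pos.2 hy).ne'))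
      rw [h1, mul_zero, zero_sub, abs_neg, abs_mul, abs_of_pos (by positivity : 0 < x ^ 4)] at this
      have hEx := hE0 x
      have hEr := hE0 r₁
      have hEx1 := hE1 x hx.2
      have hsr : √r₁ ≤ r₁ := by rw [sqrt_le_left (by linarith)]; nlinarith
      have c1 : 2500 * M * r₁ ^ 2 ≤ 2500 * M' * r₁ ^ 3 := by
        calc _ ≤ 2500 * M' * r₁ ^ 2 := by gcongr
          _ ≤ _ := by gcongr; norm_num
      have c2 : Kc * r₁ ≤ 5000 * M' * r₁ ^ 3 + 10000 * η * r₁ ^ 3 := by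
        have e1 : M' * r₁ ^ 2 ≤ M' * r₁ ^ 3 := by gcongr; norm_num
        have e2 : η * (r₁ ^ 2 * √r₁) ≤ η * (r₁ ^ 2 * r₁) := by gcongr
        calc _ = 5000 * (M' * r₁ ^ 2) + 10000 * (η * (r₁ ^ 2 * √r₁)) := by rw [hKc]; ring
          _ ≤ _ := by linarith
      have c3 : 0 ≤ Kc * x := by positivity
      have c4 : 0 ≤ N / 2 * E r₁ := by positivity
      have c5 : 0 ≤ M' * r₁ ^ 3 := by positivity
      have c6 : 10000 * (M' + η) * r₁ ^ 3 ≤ 10000 * (M' + η) * r₁ ^ 3 * E x :=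
        le_mul_of_one_le_right (by positivity) hEx1
      show x ^ 4 * |f 0 x| / E x ≤ _
      rw [div_le_iff₀ hEx]
      linarith)
  have h3 := (div_le_iff₀ (hE0 s)).1 (key s ⟨le_rfl, hsr⟩)
  have h4 : E s ≤ exp (40000 * CJ * √r₁) := by
    simp only [hE]
    gcongr
    linarith [sqrt_nonneg s]
  calc _ ≤ _ := h3
    _ ≤ 2 * (10000 * (M' + η) * r₁ ^ 3) * exp (40000 * CJ * √r₁) := by gcongr
    _ = _ := by ring

lemma HasGrad.even_t_zero (h : HasGrad f ft fr) (he : ∀ t r, f (-t) r = f t r) {r : ℝ}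
    (hr : 0 < r) : ft 0 r = 0 := by
  have h1 : HasDerivAt (fun t => f t r) (ft 0 r) 0 := h.deriv_t hr
  have h2 : HasDerivAt (fun t => f (-t) r) (ft (-0) r * -1) 0 :=
    HasDerivAt.comp (h₂ := fun t => f t r) (h := fun t : ℝ => -t) 0 (h.deriv_t hr)
      (hasDerivAt_neg' 0)
  simp only [he, neg_zero] at h2
  linarith [h1.unique h2]

lemma mul_abs_log_le {σ s : ℝ} (hσ : 0 < σ) (hs : σ ≤ s) : σ * |log σ| ≤ s * (1 + |log s|) := by
  have hs0 : 0 < s := hσ.trans_le hs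
  have h1 : log (s / σ) ≤ s / σ := (log_le_sub_one_of_pos (by positivity)).trans (by linarith)
  have h2 : log (s / σ) = log s - log σ := log_div hs0.ne' hσ.ne'
  have h3 : log σ ≤ log s := log_le_log hσ hs
  have h4 : |log σ| ≤ |log s| + s / σ := by
    have := le_abs_self (log s)
    have := neg_abs_le (log s)
    have : 0 ≤ s / σ := by positivity
    rw [abs_le]; constructor <;> linarith
  calc _ ≤ σ * (|log s| + s / σ) := by gcongr
    _ = σ * |log s| + s := by field_simp
    _ ≤ s * |log s| + s := by gcongr
    _ = _ := by ring

lemma RadWave.quartic_le_zero (h : RadWave c f ft fr ftt ftr frr)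
    (he : ∀ t r, f (-t) r = f t r) {j : ℝ → ℝ} {M K' G s : ℝ} (hj : L2Bound j M) (hs : 0 < s)
    (hK' : ∀ r, 0 < r → r ≤ 1 → |f 0 r| ≤ K') {g : ℝ → ℝ}
    (hb : ∀ x, 0 < x → x ≤ s → |bK (wY f) (wYp f ft fr) x| ≤ 5000 * (√x * j x) + g x)
    (hg : ∀ x, 0 < x → x ≤ s → x * g x ≤ G) (hG : 0 ≤ G) :
    s ^ 4 * |f 0 s| ≤ 2500 * M * s ^ 2 + G * s := by
  have hle : ∀ᶠ x in 𝓝[>] (0:ℝ), s ^ 4 * |f 0 s| ≤ 2500 * M * s ^ 2 + G * s + x ^ 4 * K' := by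
    filter_upwards [Ioc_mem_nhdsGT (lt_min hs one_pos)] with x hx
    have hx0 : 0 < x := hx.1
    have hxs : x ≤ s := hx.2.trans (min_le_left _ _)
    have := h.quartic_le he hj hx0 hxs (fun y h1 h2 => hb y (hx0.trans_le h1) h2)
      (fun y h1 h2 => hg y (hx0.trans_le h1) h2) (Γ := fun y => G * y)
      (fun y _ => by simpa using (hasDerivAt_id' y).const_mul G) continuousOn_const
    have h2 := hK' x hx0 (hx.2.trans (min_le_right _ _))
    have h3 : x ^ 4 * |f 0 x| ≤ x ^ 4 * K' := by gcongr
    have h4 := abs_sub_abs_le_abs_sub (s ^ 4 * f 0 s) (x ^ 4 * f 0 x)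
    rw [abs_mul, abs_mul, abs_of_pos (by positivity : 0 < s ^ 4),
      abs_of_pos (by positivity : 0 < x ^ 4)] at h4
    have : 0 ≤ G * x := by positivity
    linarith
  have hlim : Tendsto (fun x : ℝ => 2500 * M * s ^ 2 + G * s + x ^ 4 * K') (𝓝[>] 0)
      (𝓝 (2500 * M * s ^ 2 + G * s)) := by
    have : Tendsto (fun x : ℝ => 2500 * M * s ^ 2 + G * s + x ^ 4 * K') (𝓝 0)
      (𝓝 (2500 * M * s ^ 2 + G * s + 0 ^ 4 * K')) := Continuous.tendsto (by fun_prop) 0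
    simpa using this.mono_left nhdsWithin_le_nhds
  exact ge_of_tendsto hlim hle

/-- The region near the origin, and the resulting global bound. -/
lemma RadWave.stage_core (h : RadWave c f ft fr ftt ftr frr) (he : ∀ t r, f (-t) r = f t r)
    {j : ℝ → ℝ} {T r₁ ρ M η K K' Q D : ℝ} (hT : 0 ≤ T) (hr₁ : 1 ≤ r₁) (hρ1 : ρ ≤ 1)
    (hρr : 40000 * CJ * √√(r₁ * ρ) ≤ 1)
    (hj : L2Bound j M) (hη : 0 ≤ η) (hK : ∀ r, 1 ≤ r → r ^ 2 * |f 0 r| ≤ K)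
    (hK' : ∀ r, 0 < r → r ≤ 1 → |f 0 r| ≤ K')
    (hext : ∀ p, 0 < p → extSize f ft fr T p ≤ j p + M / √p + η) (hQ0 : 0 ≤ Q)
    (hQ : |(2 * r₁) ^ 4 * f 0 (2 * r₁) - r₁ ^ 4 * f 0 r₁| ≤ Q * r₁ ^ 2) (hD0 : 0 ≤ D)
    (hD : ∀ r, ρ ≤ r → r ^ 2 * |f 0 r| ≤ D + D * √r) {A M₅ : ℝ}
    (hA : A = 3500 * M + Q + CJ * (2 * D + |c|) + 10000 * η * √r₁)
    (hM₅ : M₅ = M + CJ * (2 * A + 2 * D + |c|)) {s : ℝ} (hs : 0 < s) :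
    s ^ 3 * |fr 0 s| ≤ 5000 * (√s * j s) + 5 * Q + 10000 * M
      + 25000 * M₅ * (2 + log r₁ + |log s|) + 25000 * η * (√s + √r₁) := by
  have hr0 : 0 < r₁ := by linarith
  have hM := hj.pos
  have hC := CJ_pos
  have hlr : 0 ≤ log r₁ := log_nonneg hr₁
  have hb : ∀ N, 0 ≤ N → (∀ r, 0 < r → r ≤ ρ → r ^ 2 * |f 0 r| * √r ≤ N) → ∀ x, 0 < x →
      |bK (wY f) (wYp f ft fr) x| ≤ 5000 * (√x * j x) +
        (Q + 5000 * ((M + CJ * (N + 2 * D + |c|)) * (1 + |log (x / r₁)|) + η * (√x + √r₁))) := by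
    intro N hN0 hN x hx0
    have := h.bK_le he (Q := Q) (M' := M + CJ * (N + 2 * D + |c|)) (H := 0) hT hr0 hx0 hj
      (by have : 0 ≤ CJ * (N + 2 * D + |c|) := by positivity
          linarith) hη le_rfl hK hext
      (fun p hp => by
        have hp0 : 0 < p := hp.elim (fun h => hx0.trans_le h) fun h => hr0.trans_le h
        refine (h.integral_source_le he (L := 2 * T) (D₁ := N / √p + D) (D₂ := D) hp0
          (by positivity) (by positivity) hD0 fun r hr => ?_).trans ?_
        · have hr0 : 0 < r := hp0.trans_le hr
          have hp' : 0 ≤ N / √p := by positivity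
          rcases le_total r ρ with hrr | hrr
          · have h1 := hN r hr0 hrr
            have : r ^ 2 * |f 0 r| ≤ N / √p := by
              rw [le_div_iff₀ (by positivity)]
              refine le_trans ?_ h1
              gcongr
            have : 0 ≤ D * √r := by positivity
            linarith
          · linarith [hD r hrr]
        · obtain ⟨q1, q2⟩ := inv_one_add_sq_le hp0
          have a1 : N / √p * (1 / (1 + p) ^ 2) ≤ N / √p :=
            mul_le_of_le_one_right (by positivity) q2
          have a2 : 2 * D * (1 / (1 + p) ^ 2) ≤ 2 * D * (1 / √p) := by gcongr
          rw [add_sub_cancel_left, zero_div, add_zero]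
          calc _ = CJ * (N / √p * (1 / (1 + p) ^ 2) + 2 * D * (1 / (1 + p) ^ 2)
                  + |c| / √p) := by ring
            _ ≤ CJ * (N / √p + 2 * D * (1 / √p) + |c| / √p) := by gcongr
            _ = _ := by ring) hQ
    linarith
  have key := le_two_mul_of_contraction (S := Ioc 0 ρ) (g := fun r => r ^ 2 * |f 0 r| * √r)
    (A := A) (K := K') (fun x hx => by positivity)
    (fun x hx => by
      have h1 := hK' x hx.1 (hx.2.trans hρ1)
      have hx1 : x ≤ 1 := hx.2.trans hρ1
      have h2 : √x ≤ 1 := sqrt_le_one.2 hx1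
      have h3 : x ^ 2 ≤ 1 := pow_le_one₀ hx.1.le hx1
      calc _ ≤ 1 * |f 0 x| * 1 := by gcongr
        _ ≤ K' := by linarith)
    (fun N hN0 hN x hx => by
      have hx0 : 0 < x := hx.1
      have hx1 : x ≤ 1 := hx.2.trans hρ1
      have hxr : x ≤ r₁ := hx1.trans hr₁
      set M' := M + CJ * (N + 2 * D + |c|) with hM'
      have hM0 : 0 ≤ M' := by positivity
      have := h.quartic_le_zero he hj hx0 hK' (fun y h1 _ => hb N hN0 (fun r h1 h2 => hN r ⟨h1, h2⟩)
        y h1) (G := Q * x + 20000 * M' * (√x * √√(r₁ * x)) + 10000 * η * (x * √r₁))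
        (fun y hy hyx => by
          have b1 : y * (1 + |log (y / r₁)|) ≤ 4 * (√x * √√(r₁ * x)) := by
            have hl : log (y / r₁) = - log (r₁ / y) := by rw [← Real.log_inv, inv_div]
            have hl0 : 0 ≤ log (r₁ / y) :=
              log_nonneg (by rw [le_div_iff₀ hy]; linarith)
            rw [hl, abs_neg, abs_of_nonneg hl0]
            have e1 : y * √√(r₁ / y) = √y * √√(r₁ * y) := by
              rw [← sq_eq_sq₀ (by positivity) (by positivity), mul_pow, mul_pow,
                sq_sqrt (by positivity), sq_sqrt hy.le, sq_sqrt (by positivity),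
                ← sq_eq_sq₀ (by positivity) (by positivity), mul_pow, mul_pow,
                sq_sqrt (by positivity), sq_sqrt (by positivity)]
              field_simp
            calc _ ≤ y * (4 * √√(r₁ / y)) := by gcongr; exact one_add_log_le_sqrt_sqrt (by positivity)
              _ = 4 * (√y * √√(r₁ * y)) := by rw [← e1]; ring
              _ ≤ _ := by gcongr
          have b2 : y * (√y + √r₁) ≤ 2 * (x * √r₁) := by
            have : √y ≤ √r₁ := by gcongr; linarith
            calc _ ≤ x * (√r₁ + √r₁) := by gcongr
              _ = _ := by ring
          have b3 : Q * y ≤ Q * x := by gcongr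
          have d1 := mul_le_mul_of_nonneg_left b1 hM0
          have d2 := mul_le_mul_of_nonneg_left b2 hη
          calc _ = Q * y + 5000 * (M' * (y * (1 + |log (y / r₁)|)) + η * (y * (√y + √r₁))) := by
                ring
            _ ≤ _ := by linarith) (by positivity)
      set z := √√(r₁ * ρ) with hz
      have hz0 : 0 ≤ z := sqrt_nonneg _
      have hzx : √√(r₁ * x) ≤ z := by rw [hz]; gcongr; exact hx.2
      have hsx : √x ≤ 1 := sqrt_le_one.2 hx1
      have e : √x * √x = x := mul_self_sqrt hx0.le
      have hCJ1 : 1 ≤ CJ := by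
        unfold CJ; have := Cwedge_pos; linarith
      have hz1 : 40000 * z ≤ 1 := by
        refine le_trans ?_ hρr
        have : z ≤ CJ * z := le_mul_of_one_le_left hz0 hCJ1
        linarith
      have c1 : 2500 * M * x ^ 2 * √x ≤ 2500 * M * x ^ 2 :=
        mul_le_of_le_one_right (by positivity) hsx
      have c2 : Q * x ^ 2 * √x ≤ Q * x ^ 2 := mul_le_of_le_one_right (by positivity) hsx
      have c3 : η * √r₁ * x ^ 2 * √x ≤ η * √r₁ * x ^ 2 :=
        mul_le_of_le_one_right (by positivity) hsx
      have c4 : 20000 * M' * (√x * √√(r₁ * x)) * x * √x ≤ 20000 * M' * z * x ^ 2 := by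
        calc _ = 20000 * M' * √√(r₁ * x) * (x * (√x * √x)) := by ring
          _ ≤ 20000 * M' * z * (x * (√x * √x)) := by gcongr
          _ = _ := by rw [e]; ring
      have c5 : 20000 * M' * z ≤ M + CJ * (2 * D + |c|) + N / 2 := by
        have e1 : 40000 * z * (M + CJ * (2 * D + |c|)) ≤ 1 * (M + CJ * (2 * D + |c|)) := by gcongr
        have e2 : 40000 * CJ * z * N ≤ 1 * N := by gcongr
        have e3 : 0 ≤ M + CJ * (2 * D + |c|) := by positivity
        calc _ = (40000 * z * (M + CJ * (2 * D + |c|)) + 40000 * CJ * z * N) / 2 := by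
              rw [hM']; ring
          _ ≤ _ := by linarith
      have c6 : x ^ 2 * (x ^ 2 * |f 0 x| * √x) ≤ x ^ 2 * (A + N / 2) := by
        calc _ = x ^ 4 * |f 0 x| * √x := by ring
          _ ≤ (2500 * M * x ^ 2 + (Q * x + 20000 * M' * (√x * √√(r₁ * x))
              + 10000 * η * (x * √r₁)) * x) * √x := by gcongr
          _ = 2500 * M * x ^ 2 * √x + Q * x ^ 2 * √x + 20000 * M' * (√x * √√(r₁ * x)) * x * √x
              + 10000 * (η * √r₁ * x ^ 2 * √x) := by ring
          _ ≤ 2500 * M * x ^ 2 + Q * x ^ 2 + (M + CJ * (2 * D + |c|) + N / 2) * x ^ 2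
              + 10000 * (η * √r₁ * x ^ 2) := by
            have : 20000 * M' * z * x ^ 2 ≤ (M + CJ * (2 * D + |c|) + N / 2) * x ^ 2 := by gcongr
            linarith
          _ ≤ _ := by
            have : 0 ≤ M * x ^ 2 := by positivity
            rw [hA]
            linarith
      exact le_of_mul_le_mul_left c6 (by positivity))
  have hA0 : 0 ≤ A := by rw [hA]; positivity
  have hb5 := hb (2 * A) (by positivity) fun r h1 h2 => key r ⟨h1, h2⟩
  rw [← hM₅] at hb5
  have hM50 : 0 ≤ M₅ := by rw [hM₅]; positivity
  have hlog : ∀ y, 0 < y → |log (y / r₁)| ≤ |log y| + log r₁ := fun y hy => by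
    rw [log_div hy.ne' hr0.ne']
    refine (abs_sub _ _).trans ?_
    rw [abs_of_nonneg hlr]
  have hf := h.quartic_le_zero he hj hs hK' (fun y h1 _ => hb5 y h1)
    (G := (Q + 5000 * (M₅ * (2 + log r₁ + |log s|) + η * (√s + √r₁))) * s)
    (fun y hy hys => by
      have b1 := mul_abs_log_le hy hys
      have b2 : y * (1 + |log (y / r₁)|) ≤ s * (2 + log r₁ + |log s|) := by
        have := hlog y hy
        have e2 : y * (1 + log r₁) ≤ s * (1 + log r₁) := by gcongr
        calc _ ≤ y * (1 + (|log y| + log r₁)) := by gcongr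
          _ = y * (1 + log r₁) + y * |log y| := by ring
          _ ≤ s * (1 + log r₁) + s * (1 + |log s|) := by linarith
          _ = _ := by ring
      have b3 : y * (√y + √r₁) ≤ s * (√s + √r₁) := by gcongr
      have b4 : Q * y ≤ Q * s := by gcongr
      have d1 := mul_le_mul_of_nonneg_left b2 hM50
      have d2 := mul_le_mul_of_nonneg_left b3 hη
      calc _ = Q * y + 5000 * (M₅ * (y * (1 + |log (y / r₁)|)) + η * (y * (√y + √r₁))) := by ring
        _ ≤ _ := by linarith) (by positivity)
  have hf2 : s ^ 2 * |f 0 s| ≤ 2500 * M + (Q + 5000 * (M₅ * (2 + log r₁ + |log s|)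
      + η * (√s + √r₁))) := by
    refine le_of_mul_le_mul_left ?_ (by positivity : 0 < s ^ 2)
    calc _ = s ^ 4 * |f 0 s| := by ring
      _ ≤ _ := hf
      _ = _ := by ring
  have hbs := hb5 s hs
  rw [bK_wave hs, h.d0.even_t_zero he hs, sub_zero] at hbs
  have hl : M₅ * (1 + |log (s / r₁)|) ≤ M₅ * (2 + log r₁ + |log s|) := by
    refine mul_le_mul_of_nonneg_left ?_ hM50
    linarith [hlog s hs]
  have e : s ^ 3 * |fr 0 s| ≤ |s ^ 3 * fr 0 s + 4 * s ^ 2 * f 0 s| + 4 * (s ^ 2 * |f 0 s|) := by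
    have e1 : s ^ 3 * |fr 0 s| = |s ^ 3 * fr 0 s| := by rw [abs_mul, abs_of_pos (by positivity : 0 < s ^ 3)]
    have e2 : 4 * (s ^ 2 * |f 0 s|) = |4 * s ^ 2 * f 0 s| := by
      rw [abs_mul, abs_of_pos (by positivity : 0 < 4 * s ^ 2)]; ring
    rw [e1, e2]
    have := abs_sub (s ^ 3 * fr 0 s + 4 * s ^ 2 * f 0 s) (4 * s ^ 2 * f 0 s)
    rwa [add_sub_cancel_right] at this
  linarith

end

section
variable {c : ℝ} {f ft fr ftt ftr frr g gt gr gtt gtr grr : ℝ → ℝ → ℝ}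

lemma RadWave.sub_const_mul (h : RadWave c f ft fr ftt ftr frr)
    (h' : RadWave 0 g gt gr gtt gtr grr) (a : ℝ) :
    RadWave c (fun t r => f t r - a * g t r) (fun t r => ft t r - a * gt t r)
      (fun t r => fr t r - a * gr t r) (fun t r => ftt t r - a * gtt t r)
      (fun t r => ftr t r - a * gtr t r) (fun t r => frr t r - a * grr t r) :=
  ⟨h.d0.sub (h'.d0.const_mul a), h.d1.sub (h'.d1.const_mul a), h.d2.sub (h'.d2.const_mul a),
    fun t r hr => by rw [h.pde t r hr, h'.pde t r hr]; ring⟩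

lemma extSize_sub_const_mul (a T : ℝ) {p : ℝ} (hp : 0 < p) :
    extSize (fun t r => f t r - a * g t r) (fun t r => ft t r - a * gt t r)
      (fun t r => fr t r - a * gr t r) T p ≤ extSize f ft fr T p + |a| * extSize g gt gr T p := by
  have e1 : wYp (fun t r => f t r - a * g t r) (fun t r => ft t r - a * gt t r)
      (fun t r => fr t r - a * gr t r) p (p + 2 * T) =
      wYp f ft fr p (p + 2 * T) - a * wYp g gt gr p (p + 2 * T) := by
    unfold wYp; ring
  have e2 : wY (fun t r => f t r - a * g t r) p (p + 2 * T) =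
      wY f p (p + 2 * T) - a * wY g p (p + 2 * T) := by
    unfold wY; ring
  unfold extSize
  rw [e1, e2]
  have h1 := abs_sub (wYp f ft fr p (p + 2 * T)) (a * wYp g gt gr p (p + 2 * T))
  have h2 := abs_sub (wY f p (p + 2 * T)) (a * wY g p (p + 2 * T))
  rw [abs_mul] at h1 h2
  have h3 := mul_le_mul_of_nonneg_left h2 (by positivity : 0 ≤ p / (p + 2 * T) ^ 2)
  linarith

lemma extSize_le_of_decay {K T : ℝ} (hT : 1 ≤ T) (hK : 0 ≤ K)
    (h0 : ∀ r, T ≤ r → |g T r| ≤ K / r ^ 2) (h1 : ∀ r, T ≤ r → |gt T r| ≤ K / r ^ 3)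
    (h2 : ∀ r, T ≤ r → |gr T r| ≤ K / r ^ 3) {p : ℝ} (hp : 0 < p) :
    extSize g gt gr T p ≤ 4 * K / √T := by
  have hR : T ≤ p + T := by linarith
  have hR0 : 0 < p + T := by linarith
  have e1 : (p + (p + 2 * T)) / 2 = p + T := by ring
  have e2 : (p + 2 * T - p) / 2 = T := by ring
  unfold extSize wYp wY
  rw [e1, e2]
  have b0 := h0 _ hR
  have b1 := h1 _ hR
  have b2 := h2 _ hR
  have hTR : √T ≤ √(p + T) := by gcongr
  set R := p + T with hRd
  have hs : 0 < √R := by positivity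
  have hss : √R * √R = R := mul_self_sqrt hR0.le
  have hR2 : R = √R ^ 2 := by rw [sq, hss]
  have c0 : R ^ 2 * √R * (K / R ^ 2) = K * √R := by field_simp
  have c1 : R ^ 2 * √R * (K / R ^ 3) = K / √R := by
    generalize √R = x at *
    rw [hR2]; field_simp
  have c2 : R * √R * (K / R ^ 2) = K / √R := by
    generalize √R = x at *
    rw [hR2]; field_simp
  have d1 : |1 / 2 * (R ^ 2 * √R * (gr T R - gt T R) + 5 / 2 * (R * √R * g T R))| ≤
      9 / 4 * (K / √R) := by
    have a1 : |R ^ 2 * √R * (gr T R - gt T R)| ≤ 2 * (K / √R) := by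
      rw [abs_mul, abs_of_pos (by positivity : 0 < R ^ 2 * √R)]
      calc _ ≤ R ^ 2 * √R * (K / R ^ 3 + K / R ^ 3) := by
            gcongr; exact (abs_sub _ _).trans (add_le_add b2 b1)
        _ = _ := by rw [mul_add, c1]; ring
    have a2 : |R * √R * g T R| ≤ K / √R := by
      rw [abs_mul, abs_of_pos (by positivity : 0 < R * √R), ← c2]
      gcongr
    rw [abs_mul, abs_of_pos (by norm_num : (0:ℝ) < 1 / 2)]
    have := abs_add_le (R ^ 2 * √R * (gr T R - gt T R)) (5 / 2 * (R * √R * g T R))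
    rw [abs_mul (5 / 2), abs_of_pos (by norm_num : (0:ℝ) < 5 / 2)] at this
    linarith
  have d2 : p / (p + 2 * T) ^ 2 * |R ^ 2 * √R * g T R| ≤ K / √R := by
    rw [abs_mul, abs_of_pos (by positivity : 0 < R ^ 2 * √R)]
    have hpR : p / (p + 2 * T) ^ 2 ≤ R / R ^ 2 := by gcongr <;> linarith
    calc _ ≤ R / R ^ 2 * (R ^ 2 * √R * (K / R ^ 2)) := by gcongr
      _ = K * √R / R := by rw [c0]; field_simp
      _ = _ := by
        generalize √R = x at *
        rw [hR2]; field_simp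
  have d3 : K / √R ≤ K / √T := by gcongr
  calc _ ≤ 9 / 4 * (K / √R) + K / √R := add_le_add d1 d2
    _ ≤ 4 * (K / √T) := by
      have : 0 ≤ K / √R := by positivity
      linarith
    _ = _ := by ring

lemma mode_extSize_le {T p : ℝ} (hT : 1 ≤ T) (hp : 0 < p) :
    extSize (fun _ r => φR r) (fun _ _ => 0) (fun _ r => φR1 r) T p ≤ 640000 / √T ∧
      extSize mW mWt mWr T p ≤ 640000 / √T := by
  constructor
  · refine (extSize_le_of_decay hT (K := 160000) (by norm_num)
      (fun r hr => (mode_bounds hT hr).1.1) (fun r hr => ?_)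
      (fun r hr => (mode_bounds hT hr).1.2) hp).trans (le_of_eq (by norm_num))
    have : 0 < r := by linarith
    rw [abs_zero]; positivity
  · exact (extSize_le_of_decay hT (K := 160000) (by norm_num)
      (fun r hr => (mode_bounds hT hr).2.1) (fun r hr => (mode_bounds hT hr).2.2.1)
      (fun r hr => (mode_bounds hT hr).2.2.2) hp).trans (le_of_eq (by norm_num))

lemma mW_zero (r : ℝ) : mW 0 r = μR r := by simp [mW]

lemma mW_even (t r : ℝ) : mW (-t) r = mW t r := by simp [mW]

lemma φR_sq_le {r : ℝ} (hr : 1 ≤ r) : r ^ 2 * |φR r| ≤ 1152 := by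
  have h0 : 0 < r := by linarith
  calc _ ≤ r ^ 2 * (1152 / r ^ 4) := by gcongr; exact φR_abs_le h0
    _ = 1152 / r ^ 2 := by field_simp
    _ ≤ _ := div_le_self (by norm_num) (one_le_pow₀ hr)

lemma μR_sq_le {r : ℝ} (hr : 1 ≤ r) : r ^ 2 * |μR r| ≤ 4176 := by
  have h0 : 0 < r := by linarith
  calc _ ≤ r ^ 2 * (4176 / r ^ 2) := by gcongr; exact μR_abs_le hr
    _ = _ := by field_simp

/-- The quantitative estimate on a time-even wave in terms of its size at time `T`. -/
theorem RadWave.exists_mode_estimate : ∃ C, 0 < C ∧ ∀ (c : ℝ) (f ft fr ftt ftr frr : ℝ → ℝ → ℝ)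
    (K K' : ℝ), RadWave c f ft fr ftt ftr frr → (∀ t r, f (-t) r = f t r) →
    (∀ r, 1 ≤ r → r ^ 2 * |f 0 r| ≤ K) → (∀ r, 0 < r → r ≤ 1 → |f 0 r| ≤ K') →
    ∃ a G : ℝ, 0 ≤ G ∧ ∀ (T : ℝ) (j : ℝ → ℝ) (M : ℝ), 1 ≤ T → L2Bound j M →
      (∀ p, 0 < p → extSize f ft fr T p ≤ j p + M / √p) → ∀ s, 0 < s →
      s ^ 3 * |fr 0 s - a * φR1 s| ≤
        C * (√s * j s + (M + |c| + G / √T) * (1 + |log s|) + G / √T * √s) := by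
  have hCJ := CJ_pos
  obtain ⟨r₁, hr₁⟩ : ∃ r₁, r₁ = 20000 * CJ + 5 := ⟨_, rfl⟩
  have hr5 : 5 ≤ r₁ := by linarith
  have hr1 : 1 ≤ r₁ := by linarith
  have hr0 : 0 < r₁ := by linarith
  have hrCJ : 20000 * CJ ≤ r₁ ^ 2 := by nlinarith
  have hdet := mode_det_pos (Y := r₁ ^ 2 / 24) (Z := (2 * r₁) ^ 2 / 24) (by nlinarith)
    (by nlinarith)
  change 0 < φR r₁ * μR (2 * r₁) - φR (2 * r₁) * μR r₁ at hdet
  have hlr : 0 ≤ log r₁ := log_nonneg hr1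
  have hCJ1 : 1 ≤ CJ := by
    unfold CJ; have := Cwedge_pos; linarith
  obtain ⟨ρ, hρ⟩ : ∃ ρ, ρ = 1 / (r₁ * (40000 * CJ) ^ 4) := ⟨_, rfl⟩
  have hρ0 : 0 < ρ := by rw [hρ]; positivity
  have hρ1 : ρ ≤ 1 := by
    rw [hρ, div_le_one (by positivity)]
    exact one_le_mul_of_one_le_of_one_le hr1 (one_le_pow₀ (by linarith))
  have hρr : 40000 * CJ * √√(r₁ * ρ) ≤ 1 := by
    have e : r₁ * ρ = ((1 / (40000 * CJ)) ^ 2) ^ 2 := by rw [hρ]; field_simp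
    rw [e, sqrt_sq (by positivity), sqrt_sq (by positivity)]
    exact le_of_eq (by field_simp)
  obtain ⟨Kμ, hKμ⟩ : ∃ Kμ, ∀ r ∈ Icc ρ 1, ‖μR r‖ ≤ Kμ :=
    isCompact_Icc.exists_bound_of_continuousOn fun x hx =>
      (μR_hasDerivAt (hρ0.trans_le hx.1)).continuousAt.continuousWithinAt
  have hKμ0 : 0 ≤ Kμ := (norm_nonneg _).trans (hKμ 1 ⟨hρ1, le_rfl⟩)
  obtain ⟨n₁, hn₁⟩ : ∃ n₁, n₁ = 25000 * (2 + CJ) := ⟨_, rfl⟩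
  obtain ⟨b₀, hb₀⟩ : ∃ b₀, b₀ = 20000 * (2 + CJ * (n₁ + 1)) * r₁ ^ 3 *
    exp (40000 * CJ * √r₁) := ⟨_, rfl⟩
  obtain ⟨d₀, hd₀⟩ : ∃ d₀, d₀ = n₁ + b₀ / ρ ^ 2 + (4176 + Kμ) * b₀ := ⟨_, rfl⟩
  obtain ⟨a₀, ha₀⟩ : ∃ a₀, a₀ = 3500 + 20880 * b₀ + CJ * (2 * d₀ + 1) + 10000 * √r₁ := ⟨_, rfl⟩
  obtain ⟨m₀, hm₀⟩ : ∃ m₀, m₀ = 1 + CJ * (2 * a₀ + 2 * d₀ + 1) := ⟨_, rfl⟩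
  have hn₁0 : 0 ≤ n₁ := by rw [hn₁]; positivity
  have hb₀0 : 0 ≤ b₀ := by rw [hb₀]; positivity
  have hd₀0 : 0 ≤ d₀ := by rw [hd₀]; positivity
  have ha₀0 : 0 ≤ a₀ := by rw [ha₀]; positivity
  have hm₀0 : 0 ≤ m₀ := by rw [hm₀]; positivity
  refine ⟨5000 + 5 * 20880 * b₀ + 10000 + 25000 * m₀ * (2 + log r₁) + 25000 + 25000 * √r₁,
    by positivity, ?_⟩
  intro c f ft fr ftt ftr frr K K' h he hK hK'
  obtain ⟨Δ, hΔ⟩ : ∃ Δ, Δ = φR r₁ * μR (2 * r₁) - φR (2 * r₁) * μR r₁ := ⟨_, rfl⟩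
  rw [← hΔ] at hdet
  obtain ⟨a, ha⟩ : ∃ a, a = (f 0 r₁ * μR (2 * r₁) - f 0 (2 * r₁) * μR r₁) / Δ := ⟨_, rfl⟩
  obtain ⟨b, hb⟩ : ∃ b, b = (φR r₁ * f 0 (2 * r₁) - φR (2 * r₁) * f 0 r₁) / Δ := ⟨_, rfl⟩
  have hw := h.sub_const_mul radWave_φ a
  have hg := hw.sub_const_mul radWave_m b
  have hewv : ∀ t r, f (-t) r - a * φR r = f t r - a * φR r := fun t r => by rw [he]
  have hegv : ∀ t r, f (-t) r - a * φR r - b * mW (-t) r = f t r - a * φR r - b * mW t r :=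
    fun t r => by rw [he, mW_even]
  have hg1 : f 0 r₁ - a * φR r₁ - b * mW 0 r₁ = 0 := by
    rw [mW_zero, ha, hb]; field_simp; rw [hΔ]; ring
  have hg2 : f 0 (2 * r₁) - a * φR (2 * r₁) - b * mW 0 (2 * r₁) = 0 := by
    rw [mW_zero, ha, hb]; field_simp; rw [hΔ]; ring
  refine ⟨a, 640000 * (|a| + |b|), by positivity, ?_⟩
  intro T j M hT hj hext s hs
  obtain ⟨η, hη⟩ : ∃ η, η = 640000 * (|a| + |b|) / √T := ⟨_, rfl⟩
  rw [← hη]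
  have hη0 : 0 ≤ η := by rw [hη]; positivity
  have hM := hj.pos
  have hKw : ∀ r, 1 ≤ r → r ^ 2 * |f 0 r - a * φR r| ≤ K + 1152 * |a| := fun r hr => by
    have h1 := hK r hr
    have h2 := φR_sq_le hr
    calc _ ≤ r ^ 2 * (|f 0 r| + |a| * |φR r|) := by
          gcongr; exact (abs_sub _ _).trans (by rw [abs_mul])
      _ = r ^ 2 * |f 0 r| + |a| * (r ^ 2 * |φR r|) := by ring
      _ ≤ K + |a| * 1152 := by gcongr
      _ = _ := by ring
  have hKg : ∀ r, 1 ≤ r → r ^ 2 * |f 0 r - a * φR r - b * mW 0 r| ≤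
      K + 1152 * |a| + 4176 * |b| := fun r hr => by
    have h1 := hKw r hr
    have h2 := μR_sq_le hr
    rw [mW_zero]
    calc _ ≤ r ^ 2 * (|f 0 r - a * φR r| + |b| * |μR r|) := by
          gcongr; exact (abs_sub _ _).trans (by rw [abs_mul])
      _ = r ^ 2 * |f 0 r - a * φR r| + |b| * (r ^ 2 * |μR r|) := by ring
      _ ≤ K + 1152 * |a| + |b| * 4176 := by gcongr
      _ = _ := by ring
  have hextw : ∀ p, 0 < p → extSize (fun t r => f t r - a * φR r) (fun t r => ft t r - a * 0)
      (fun t r => fr t r - a * φR1 r) T p ≤ j p + M / √p + 640000 * |a| / √T := fun p hp => by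
    refine (extSize_sub_const_mul (g := fun _ r => φR r) (gt := fun _ _ => 0)
      (gr := fun _ r => φR1 r) a T hp).trans ?_
    have h1 := hext p hp
    have h2 := mul_le_mul_of_nonneg_left (mode_extSize_le hT hp).1 (abs_nonneg a)
    have : 640000 * |a| / √T = |a| * (640000 / √T) := by ring
    linarith
  have hextg : ∀ p, 0 < p → extSize (fun t r => f t r - a * φR r - b * mW t r)
      (fun t r => ft t r - a * 0 - b * mWt t r)
      (fun t r => fr t r - a * φR1 r - b * mWr t r) T p ≤ j p + M / √p + η := fun p hp => by
    refine (extSize_sub_const_mul (f := fun t r => f t r - a * φR r)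
      (ft := fun t r => ft t r - a * 0) (fr := fun t r => fr t r - a * φR1 r) (g := mW) (gt := mWt)
      (gr := mWr) b T hp).trans ?_
    have h1 := hextw p hp
    have h2 := mul_le_mul_of_nonneg_left (mode_extSize_le hT hp).2 (abs_nonneg b)
    have : η = 640000 * |a| / √T + |b| * (640000 / √T) := by rw [hη]; ring
    linarith
  have hextw' : ∀ p, 0 < p → extSize (fun t r => f t r - a * φR r) (fun t r => ft t r - a * 0)
      (fun t r => fr t r - a * φR1 r) T p ≤ j p + M / √p + η := fun p hp => by
    have h1 := hextw p hp
    have h2 : η = 640000 * |a| / √T + |b| * (640000 / √T) := by rw [hη]; ring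
    have h3 : 0 ≤ |b| * (640000 / √T) := by positivity
    linarith
  obtain ⟨X, hX⟩ : ∃ X, X = M + |c| + η := ⟨_, rfl⟩
  have hc0 := abs_nonneg c
  have hX0 : 0 ≤ X := by rw [hX]; positivity
  have hMX : M ≤ X := by linarith
  have hcX : |c| ≤ X := by linarith
  have hηX : η ≤ X := by linarith
  have hout : ∀ r, r₁ ≤ r → r ^ 2 * |f 0 r - a * φR r - b * mW 0 r| ≤ n₁ * X * √r := fun r hr => by
    refine (hg.stage_outer hegv (by linarith) hr1 hrCJ hj hη0 hKg hextg hg1 hg2 r hr).trans ?_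
    have : CJ * |c| ≤ CJ * X := by gcongr
    refine mul_le_mul_of_nonneg_right ?_ (sqrt_nonneg _)
    rw [hn₁]; linarith
  have hin : ∀ r, 0 < r → r ≤ r₁ → r ^ 4 * |f 0 r - a * φR r - b * mW 0 r| ≤ b₀ * X :=
      fun r hr0 hr => by
    refine (hg.stage_inner hegv (by linarith) hr1 hj hη0 hKg hextg hg1 hg2
      (mul_nonneg hn₁0 hX0) hout hr0 hr).trans ?_
    have e : M + CJ * (n₁ * X + |c|) + η ≤ (2 + CJ * (n₁ + 1)) * X := by
      have : CJ * |c| ≤ CJ * X := by gcongr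
      linarith
    calc _ ≤ 20000 * ((2 + CJ * (n₁ + 1)) * X) * r₁ ^ 3 * exp (40000 * CJ * √r₁) := by gcongr
      _ = _ := by rw [hb₀]; ring
  have hbX : |b| ≤ b₀ * X := by
    have l1 : Tendsto (fun r : ℝ => r ^ 4 * K') (𝓝[>] 0) (𝓝 0) := by
      have : Tendsto (fun r : ℝ => r ^ 4 * K') (𝓝 0) (𝓝 (0 ^ 4 * K')) :=
        Continuous.tendsto (by fun_prop) 0
      simpa using this.mono_left nhdsWithin_le_nhds
    have l2 : Tendsto (fun r : ℝ => r ^ 4 * 2) (𝓝[>] 0) (𝓝 0) := by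
      have : Tendsto (fun r : ℝ => r ^ 4 * 2) (𝓝 0) (𝓝 (0 ^ 4 * 2)) :=
        Continuous.tendsto (by fun_prop) 0
      simpa using this.mono_left nhdsWithin_le_nhds
    have l3 := (μR_tendsto.abs.const_mul |b|)
    have hle : ∀ᶠ r in 𝓝[>] (0:ℝ), |b| * |r ^ 4 * μR r| ≤
        b₀ * X + r ^ 4 * K' + |a| * (r ^ 4 * 2) := by
      filter_upwards [Ioc_mem_nhdsGT one_pos] with r hr
      have h1 := hin r hr.1 (hr.2.trans hr1)
      have h2 := hK' r hr.1 hr.2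
      have h3 := φR_abs_le_two r
      have hr0 : 0 < r := hr.1
      have e1 : b * (r ^ 4 * μR r) = r ^ 4 * f 0 r - a * (r ^ 4 * φR r)
          - r ^ 4 * (f 0 r - a * φR r - b * mW 0 r) := by rw [mW_zero]; ring
      have t1 : |r ^ 4 * f 0 r| ≤ r ^ 4 * K' := by
        rw [abs_mul, abs_of_pos (by positivity : 0 < r ^ 4)]; gcongr
      have t2 : |a * (r ^ 4 * φR r)| ≤ |a| * (r ^ 4 * 2) := by
        rw [abs_mul, abs_mul, abs_of_pos (by positivity : 0 < r ^ 4)]; gcongr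
      have t3 : |r ^ 4 * (f 0 r - a * φR r - b * mW 0 r)| ≤ b₀ * X := by
        rwa [abs_mul, abs_of_pos (by positivity : 0 < r ^ 4)]
      rw [← abs_mul, e1]
      refine (abs_sub _ _).trans ?_
      have := abs_sub (r ^ 4 * f 0 r) (a * (r ^ 4 * φR r))
      linarith
    have hlim := le_of_tendsto_of_tendsto l3 ((tendsto_const_nhds.add l1).add (l2.const_mul |a|)) hle
    rw [abs_neg, abs_of_pos (by norm_num : (0:ℝ) < 192 / 5)] at hlim
    have := abs_nonneg b
    linarith
  have hbX0 : 0 ≤ b₀ * X := by positivity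
  have hQ : |(2 * r₁) ^ 4 * (f 0 (2 * r₁) - a * φR (2 * r₁)) - r₁ ^ 4 * (f 0 r₁ - a * φR r₁)| ≤
      20880 * (b₀ * X) * r₁ ^ 2 := by
    have e1 : f 0 (2 * r₁) - a * φR (2 * r₁) = b * μR (2 * r₁) := by
      rw [mW_zero] at hg2; linarith
    have e2 : f 0 r₁ - a * φR r₁ = b * μR r₁ := by
      rw [mW_zero] at hg1; linarith
    have m1 := μR_sq_le hr1
    have m2 := μR_sq_le (by linarith : 1 ≤ 2 * r₁)
    rw [e1, e2]
    have t1 : |(2 * r₁) ^ 4 * (b * μR (2 * r₁))| ≤ (2 * r₁) ^ 2 * ((b₀ * X) * 4176) := by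
      rw [abs_mul, abs_mul, abs_of_pos (by positivity : 0 < (2 * r₁) ^ 4)]
      calc _ = (2 * r₁) ^ 2 * (|b| * ((2 * r₁) ^ 2 * |μR (2 * r₁)|)) := by ring
        _ ≤ _ := by gcongr
    have t2 : |r₁ ^ 4 * (b * μR r₁)| ≤ r₁ ^ 2 * ((b₀ * X) * 4176) := by
      rw [abs_mul, abs_mul, abs_of_pos (by positivity : 0 < r₁ ^ 4)]
      calc _ = r₁ ^ 2 * (|b| * (r₁ ^ 2 * |μR r₁|)) := by ring
        _ ≤ _ := by gcongr
    refine (abs_sub _ _).trans ?_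
    linarith
  have hD : ∀ r, ρ ≤ r → r ^ 2 * |f 0 r - a * φR r| ≤ d₀ * X + d₀ * X * √r := fun r hr => by
    have hr0 : 0 < r := hρ0.trans_le hr
    have t1 : r ^ 2 * |μR r| ≤ 4176 + Kμ := by
      rcases le_total 1 r with h1 | h1
      · linarith [μR_sq_le h1]
      · have := hKμ r ⟨hr, h1⟩
        rw [norm_eq_abs] at this
        have h2 : r ^ 2 ≤ 1 := pow_le_one₀ hr0.le h1
        calc _ ≤ 1 * Kμ := by gcongr
          _ ≤ _ := by linarith
    have t2 : r ^ 2 * |f 0 r - a * φR r - b * mW 0 r| ≤ b₀ * X / ρ ^ 2 + n₁ * X * √r := by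
      rcases le_total r r₁ with h1 | h1
      · have h2 := hin r hr0 h1
        have h3 : r ^ 2 * |f 0 r - a * φR r - b * mW 0 r| ≤ b₀ * X / ρ ^ 2 := by
          rw [le_div_iff₀ (by positivity)]
          refine le_trans ?_ h2
          calc _ ≤ r ^ 2 * |f 0 r - a * φR r - b * mW 0 r| * r ^ 2 := by gcongr
            _ = _ := by ring
        have : 0 ≤ n₁ * X * √r := by positivity
        linarith
      · have : 0 ≤ b₀ * X / ρ ^ 2 := by positivity
        linarith [hout r h1]
    have t3 : r ^ 2 * |f 0 r - a * φR r| ≤ r ^ 2 * |f 0 r - a * φR r - b * mW 0 r|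
        + b₀ * X * (4176 + Kμ) := by
      calc _ = r ^ 2 * |f 0 r - a * φR r - b * mW 0 r + b * μR r| := by rw [mW_zero]; ring_nf
        _ ≤ r ^ 2 * (|f 0 r - a * φR r - b * mW 0 r| + |b| * |μR r|) := by
          gcongr; exact (abs_add_le _ _).trans (by rw [abs_mul])
        _ = r ^ 2 * |f 0 r - a * φR r - b * mW 0 r| + |b| * (r ^ 2 * |μR r|) := by ring
        _ ≤ _ := by gcongr
    have hd : d₀ * X = n₁ * X + b₀ * X / ρ ^ 2 + b₀ * X * (4176 + Kμ) := by rw [hd₀]; ring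
    have s1 : n₁ * X * √r ≤ d₀ * X * √r := by
      gcongr; rw [hd₀]
      have : 0 ≤ b₀ / ρ ^ 2 + (4176 + Kμ) * b₀ := by positivity
      linarith
    have : 0 ≤ n₁ * X := by positivity
    linarith
  have hcore := hw.stage_core hewv (by linarith) hr1 hρ1 hρr hj hη0 hKw
    (K' := K' + |a| * 2) (fun r h1 h2 => by
      refine (abs_sub _ _).trans ?_
      rw [abs_mul]
      have := hK' r h1 h2
      have := φR_abs_le_two r
      gcongr) hextw' (by positivity) hQ (by positivity) hD rfl rfl hs
  set A := 3500 * M + 20880 * (b₀ * X) + CJ * (2 * (d₀ * X) + |c|) + 10000 * η * √r₁ with hA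
  set M₅ := M + CJ * (2 * A + 2 * (d₀ * X) + |c|) with hM₅
  have hcc : CJ * |c| ≤ CJ * X := by gcongr
  have hAX : A ≤ a₀ * X := by
    have : η * √r₁ ≤ X * √r₁ := by gcongr
    rw [hA, ha₀]; linarith
  have hMX5 : M₅ ≤ m₀ * X := by
    have : CJ * A ≤ CJ * (a₀ * X) := by gcongr
    rw [hM₅, hm₀]; linarith
  refine hcore.trans ?_
  obtain ⟨l, hl⟩ : ∃ l, l = |log s| := ⟨_, rfl⟩
  have hl0 : 0 ≤ l := by rw [hl]; positivity
  rw [← hl, ← hX]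
  have hj0 := hj.nonneg s hs
  have hsj : 0 ≤ √s * j s := by positivity
  have hsη : 0 ≤ η * √s := by positivity
  have u1 : 25000 * M₅ * (2 + log r₁ + l) ≤ 25000 * m₀ * (2 + log r₁) * (X * (1 + l)) := by
    calc _ ≤ 25000 * (m₀ * X) * (2 + log r₁ + l) := by gcongr
      _ ≤ 25000 * (m₀ * X) * ((2 + log r₁) * (1 + l)) := by
        gcongr
        have : 0 ≤ log r₁ * l := by positivity
        linarith
      _ = _ := by ring
  have u2 : η * √r₁ ≤ √r₁ * (X * (1 + l)) := by
    have : 0 ≤ √r₁ * (X * l) := by positivity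
    calc _ ≤ X * √r₁ := by gcongr
      _ ≤ _ := by linarith
  have u3 : 5 * (20880 * (b₀ * X)) ≤ 5 * 20880 * b₀ * (X * (1 + l)) := by
    have : 0 ≤ b₀ * (X * l) := by positivity
    linarith
  have u4 : 10000 * M ≤ 10000 * (X * (1 + l)) := by
    have : 0 ≤ X * l := by positivity
    linarith
  set Y := X * (1 + l) with hY
  have hY0 : 0 ≤ Y := by positivity
  have p1 : 0 ≤ 5 * 20880 * b₀ * (√s * j s + η * √s) := by positivity
  have p2 : 0 ≤ 25000 * m₀ * (2 + log r₁) * (√s * j s + η * √s) := by positivity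
  have p3 : 0 ≤ √r₁ * (√s * j s + η * √s) := by positivity
  linarith

end

lemma abs_integral_le_of_weighted {g : ℝ → ℝ} {x y E : ℝ} (hg : ContinuousOn g (Ioi 0))
    (hx : 0 < x) (hxy : x ≤ y) (hE : 0 < E) (h : ∫ r in x..y, g r ^ 2 * r ^ 5 ≤ E) :
    |∫ r in x..y, g r| ≤ 1 / 2 * √E / x ^ 2 := by
  have hy : 0 < y := hx.trans_le hxy
  have hsE : 0 < √E := sqrt_pos.2 hE
  have hEE : √E * √E = E := mul_self_sqrt hE.le
  obtain ⟨l, hl⟩ : ∃ l, l = 2 * x ^ 2 * √E := ⟨_, rfl⟩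
  have hl0 : 0 < l := by rw [hl]; positivity
  have i1 : IntervalIntegrable (fun r => g r ^ 2 * r ^ 5) volume x y :=
    ((hg.pow 2).mul (by fun_prop)).intervalIntegrable_Ioi hx hy
  have hd : ∀ r : ℝ, 0 < r → HasDerivAt (fun r : ℝ => -(1 / 4) * (r ^ 4)⁻¹) ((r ^ 5)⁻¹) r :=
    fun r hr => by
    refine (((hasDerivAt_pow 4 r).fun_inv (by positivity)).const_mul _).congr_deriv ?_
    push_cast
    field_simp
  have c2 : ContinuousOn (fun r : ℝ => (r ^ 5)⁻¹) (Ioi 0) :=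
    ContinuousOn.inv₀ (by fun_prop) fun r hr => (pow_pos (mem_Ioi.1 hr) 5).ne'
  have i2 : IntervalIntegrable (fun r : ℝ => (r ^ 5)⁻¹) volume x y :=
    c2.intervalIntegrable_Ioi hx hy
  have e2 : ∫ r in x..y, (r ^ 5)⁻¹ ≤ 1 / 4 * (x ^ 4)⁻¹ := by
    rw [(integral_of_hasDerivAt_pos hx hy hd c2).2]
    have : 0 < (y ^ 4)⁻¹ := by positivity
    linarith
  have b : ∀ r ∈ Ioc x y, ‖g r‖ ≤ 1 / 2 * (l * (r ^ 5)⁻¹ + 1 / l * (g r ^ 2 * r ^ 5)) :=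
    fun r hr => by
    have hr0 : 0 < r := hx.trans hr.1
    rw [norm_eq_abs]
    have e : 1 / 2 * (l * (r ^ 5)⁻¹ + 1 / l * (g r ^ 2 * r ^ 5)) - |g r|
        = 1 / (2 * l * r ^ 5) * (l - |g r| * r ^ 5) ^ 2 := by
      rw [← sq_abs (g r)]; field_simp; ring
    have : 0 ≤ 1 / (2 * l * r ^ 5) * (l - |g r| * r ^ 5) ^ 2 := by positivity
    linarith
  have := intervalIntegral.norm_integral_le_of_norm_le (μ := volume) hxy
    (Eventually.of_forall b) (((i2.const_mul l).add (i1.const_mul (1 / l))).const_mul (1 / 2))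
  rw [norm_eq_abs, intervalIntegral.integral_const_mul, intervalIntegral.integral_add
    (i2.const_mul l) (i1.const_mul (1 / l)), intervalIntegral.integral_const_mul,
    intervalIntegral.integral_const_mul] at this
  refine this.trans ?_
  calc _ ≤ 1 / 2 * (l * (1 / 4 * (x ^ 4)⁻¹) + 1 / l * E) := by gcongr
    _ = 1 / 2 * √E / x ^ 2 := by
      rw [hl]; field_simp; nlinarith

section
variable {c : ℝ} {f ft fr ftt ftr frr : ℝ → ℝ → ℝ} {y yp yq σ : ℝ → ℝ → ℝ}

lemma HasGrad.abs_sub_le (h : HasGrad f ft fr) (h2 : HasGrad fr ftr frr) {t x y E : ℝ}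
    (hx : 0 < x) (hxy : x ≤ y)
    (hE : 0 < E) (hi : ∫ r in x..y, fr t r ^ 2 * r ^ 5 ≤ E) :
    |f t y - f t x| ≤ 1 / 2 * √E / x ^ 2 := by
  have hc := h2.continuousOn_r t
  rw [← (integral_of_hasDerivAt_pos hx (hx.trans_le hxy) (fun r hr => h.deriv_r (t := t) hr) hc).2]
  exact abs_integral_le_of_weighted hc hx hxy hE hi

lemma NullSol.diag_even (hn : NullSol y yp yq σ) (hsym : ∀ r, 0 < r → yp r r = yq r r)
    {p q : ℝ} (hp : 0 < p) (hq : 0 < q) :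
    y p p + ∫ r in p..q, yq r r = 1 / 2 * (y p p + y q q) := by
  have := intervalIntegral.integral_eq_sub_of_hasDerivAt (a := p) (b := q)
    (f' := fun r => 2 * yq r r)
    (fun x hx => (hn.diag x (uIcc_subset_Ioi hp hq hx)).congr_deriv
      (by rw [hsym x (uIcc_subset_Ioi hp hq hx)]; ring))
    ((continuousOn_const.mul hn.cdiag).intervalIntegrable_Ioi hp hq)
  rw [intervalIntegral.integral_const_mul] at this
  linarith

/-- `t² r⁻⁴` solves the free inhomogeneous equation with source `2 r⁻⁴`. -/
lemma hasGrad_sq_mul_inv_quartic :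
    HasGrad (fun t r => t ^ 2 * (r ^ 4)⁻¹) (fun t r => 2 * t * (r ^ 4)⁻¹)
      (fun t r => t ^ 2 * (-4 * (r ^ 5)⁻¹)) ∧
    HasGrad (fun t r => 2 * t * (r ^ 4)⁻¹) (fun _ r => 2 * (r ^ 4)⁻¹)
      (fun t r => 2 * t * (-4 * (r ^ 5)⁻¹)) ∧
    HasGrad (fun t r => t ^ 2 * (-4 * (r ^ 5)⁻¹)) (fun t r => 2 * t * (-4 * (r ^ 5)⁻¹))
      (fun t r => t ^ 2 * (20 * (r ^ 6)⁻¹)) := by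
  have a2 : ∀ t : ℝ, HasDerivAt (fun t : ℝ => t ^ 2) (2 * t) t := fun t => by
    simpa using hasDerivAt_pow 2 t
  have a1 : ∀ t : ℝ, HasDerivAt (fun t : ℝ => 2 * t) 2 t := fun t => by
    simpa using (hasDerivAt_id' t).const_mul 2
  have b4 : ∀ r : ℝ, 0 < r → HasDerivAt (fun r : ℝ => (r ^ 4)⁻¹) (-4 * (r ^ 5)⁻¹) r :=
    fun r hr => by
    refine ((hasDerivAt_pow 4 r).fun_inv (by positivity)).congr_deriv ?_
    push_cast; field_simp
  have b5 : ∀ r : ℝ, 0 < r → HasDerivAt (fun r : ℝ => -4 * (r ^ 5)⁻¹) (20 * (r ^ 6)⁻¹) r :=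
    fun r hr => by
    refine (((hasDerivAt_pow 5 r).fun_inv (by positivity)).const_mul _).congr_deriv ?_
    push_cast; field_simp; norm_num
  exact ⟨hasGrad_mul a2 b4, hasGrad_mul a1 b4, hasGrad_mul a2 b5⟩

lemma Vrad_add_abs_le {r : ℝ} (hr : 0 < r) : |Vrad r + 1152 * (r ^ 4)⁻¹| ≤ 55296 / r ^ 6 := by
  have e : Vrad r + 1152 * (r ^ 4)⁻¹ = 1152 * (48 * r ^ 2 + 576) / (r ^ 4 * (24 + r ^ 2) ^ 2) := by
    unfold Vrad; field_simp; ring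
  rw [e, abs_of_nonneg (by positivity), div_le_div_iff₀ (by positivity) (by positivity)]
  have : 0 < r ^ 4 := by positivity
  nlinarith [mul_pos this (sq_pos_of_pos hr), mul_pos this this]

lemma RadWave.sub_quartic_bound (h : RadWave c f ft fr ftt ftr frr)
    (he : ∀ t r, f (-t) r = f t r) {K D p₀ : ℝ} (hp₀ : 1 ≤ p₀) (hD : 0 ≤ D)
    (hK : ∀ r, 1 ≤ r → r ^ 2 * |f 0 r| ≤ K) (hDf : ∀ r, p₀ ≤ r → r ^ 2 * |f 0 r| ≤ D) {p q : ℝ}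
    (hp : p₀ ≤ p) (hpq : p ≤ q) :
    |wY (fun t r => f t r - 576 * c * (t ^ 2 * (r ^ 4)⁻¹)) p q| ≤
      Cwedge * (D + 2 * ((1152 * (Cwedge * (K + 1800 * |c|)) + 41472 * |c|) / p₀ ^ 2)) * √q := by
  have hCw := Cwedge_pos
  have hp0 : 0 < p₀ := by linarith
  obtain ⟨g0, g1, g2⟩ := hasGrad_sq_mul_inv_quartic
  have cV := Vrad_continuous
  have hK0 : 0 ≤ K := (by positivity : (0:ℝ) ≤ 1 ^ 2 * |f 0 1|).trans (hK 1 le_rfl)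
  have hn := (h.d0.sub (g0.const_mul (576 * c))).nullSol
    (S := fun t r => -(Vrad r * f t r) - c * (Vrad r + 1152 * (r ^ 4)⁻¹))
    (h.d1.sub (g1.const_mul (576 * c))) (h.d2.sub (g2.const_mul (576 * c)))
    (by
      refine ContinuousOn.sub (ContinuousOn.neg (ContinuousOn.mul (by fun_prop)
        h.d0.continuousOn_null)) (continuousOn_const.mul (ContinuousOn.add (by fun_prop)
        (continuousOn_const.mul (ContinuousOn.inv₀ (by fun_prop) fun x hx => ?_))))
      have : 0 < (x.1 + x.2) / 2 := half_pos (add_pos (show 0 < x.1 from hx.1) hx.2)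
      positivity)
    (fun t r hr => by rw [h.pde t r hr]; field_simp; ring)
  have hB : ∀ p q, 1 ≤ p → p ≤ q → |wY f p q| ≤ Cwedge * (K + 1800 * |c|) * √q :=
    fun p q hp hpq => h.wedge_even he (by linarith) hpq fun r hr _ => hK r (hp.trans hr)
  refine hn.wedge (q₀ := q) hp0 (by positivity) hD (fun p q hp hpq _ => ?_)
    (fun p q hp hpq _ => ?_) p q hp hpq le_rfl
  · have hp1 : 0 < p := by linarith
    have hq1 : 0 < q := by linarith
    obtain ⟨R, hR⟩ : ∃ R, R = (p + q) / 2 := ⟨_, rfl⟩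
    have hR0 : 0 < R := by rw [hR]; positivity
    have hRq : q / 2 ≤ R := by rw [hR]; linarith
    have hRp : p₀ ≤ R := by rw [hR]; linarith
    have hsR : √q ≤ 3 / 2 * √R := by
      rw [show (3:ℝ) / 2 = √((3 / 2) ^ 2) by rw [sqrt_sq]; norm_num, ← sqrt_mul (by positivity)]
      exact sqrt_le_sqrt (by linarith)
    have hsq : 0 < √q := by positivity
    have hsR0 : 0 < √R := by positivity
    have hqq : √q * √q = q := mul_self_sqrt hq1.le
    refine (abs_add_le _ _).trans (add_le_add ?_ ?_)
    · rw [abs_mul, abs_of_pos (by positivity)]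
      refine mul_le_mul_of_nonneg_right ?_ (abs_nonneg _)
      rw [div_div, div_le_div_iff₀ (by positivity) (by positivity)]
      nlinarith
    · rw [← hR]
      have e : -(1 / 4) * (R ^ 2 * √R * (-(Vrad R * f ((q - p) / 2) R) -
          c * (Vrad R + 1152 * (R ^ 4)⁻¹))) =
          1 / 4 * (Vrad R * wY f p q) + 1 / 4 * (c * (R ^ 2 * √R * (Vrad R + 1152 * (R ^ 4)⁻¹))) := by
        simp only [wY, ← hR]; ring
      rw [e]
      refine (abs_add_le _ _).trans ?_
      have t1 : |1 / 4 * (Vrad R * wY f p q)| ≤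
          1152 * (Cwedge * (K + 1800 * |c|)) / p₀ ^ 2 / (q * √q) := by
        rw [abs_mul, abs_mul, abs_of_pos (by norm_num : (0:ℝ) < 1 / 4)]
        have b1 : |Vrad R| ≤ 1152 / ((q / 2) ^ 2 * p₀ ^ 2) := by
          refine (Vrad_abs_le_inv_quartic hR0).trans ?_
          refine div_le_div_of_nonneg_left (by norm_num) (by positivity) ?_
          calc _ ≤ R ^ 2 * R ^ 2 := by gcongr
            _ = _ := by ring
        calc _ ≤ 1 / 4 * (1152 / ((q / 2) ^ 2 * p₀ ^ 2) * (Cwedge * (K + 1800 * |c|) * √q)) := by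
              have := hB p q (by linarith) hpq
              gcongr
          _ = _ := by field_simp; rw [sq, sq, hqq]; ring
      have t2 : |1 / 4 * (c * (R ^ 2 * √R * (Vrad R + 1152 * (R ^ 4)⁻¹)))| ≤
          41472 * |c| / p₀ ^ 2 / (q * √q) := by
        rw [abs_mul, abs_mul, abs_mul, abs_of_pos (by norm_num : (0:ℝ) < 1 / 4),
          abs_of_pos (by positivity : 0 < R ^ 2 * √R)]
        have b2 : R ^ 2 * √R * |Vrad R + 1152 * (R ^ 4)⁻¹| ≤ 165888 / p₀ ^ 2 / (q * √q) := by
          calc _ ≤ R ^ 2 * √R * (55296 / R ^ 6) := by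
                gcongr; exact Vrad_add_abs_le hR0
            _ = 55296 * √R / (R ^ 2 * R ^ 2) := by field_simp
            _ ≤ 165888 / p₀ ^ 2 / (q * √q) := by
              rw [div_div, div_le_div_iff₀ (by positivity) (by positivity)]
              have a1 : √R * (q * √q) ≤ 3 * (R * R) := by
                have : √R * √R = R := mul_self_sqrt hR0.le
                calc √R * (q * √q) ≤ √R * ((2 * R) * (3 / 2 * √R)) := by
                      gcongr; linarith
                  _ = 3 * (R * (√R * √R)) := by ring
                  _ = _ := by rw [this]
              have a2 : p₀ ^ 2 ≤ R ^ 2 := by gcongr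
              calc 55296 * √R * (p₀ ^ 2 * (q * √q)) = 55296 * (p₀ ^ 2 * (√R * (q * √q))) := by ring
                _ ≤ 55296 * (R ^ 2 * (3 * (R * R))) := by gcongr
                _ = _ := by ring
        calc _ ≤ 1 / 4 * (|c| * (165888 / p₀ ^ 2 / (q * √q))) := by gcongr
          _ = _ := by ring
      calc _ ≤ _ := add_le_add t1 t2
        _ = _ := by ring
  · have hp1 : 0 < p := by linarith
    have hq1 : 0 < q := by linarith
    have h0 := fun r (hr : 0 < r) => h.d0.even_t_zero he hr
    rw [hn.diag_even (fun r hr => by simp [wYp, wYq, h0 r hr]) hp1 hq1]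
    have ey : ∀ r, wY (fun t r => f t r - 576 * c * (t ^ 2 * (r ^ 4)⁻¹)) r r = wY f r r :=
      fun r => by simp [wY]
    rw [ey, ey]
    have h1 := wY_diag_le hp1 (hDf p hp)
    have h2 := wY_diag_le hq1 (hDf q (hp.trans hpq))
    have h3 : D * √p ≤ D * √q := by gcongr
    rw [abs_mul, abs_of_pos (by norm_num : (0:ℝ) < 1 / 2)]
    have := abs_add_le (wY f p p) (wY f q q)
    linarith

theorem RadWave.abs_const_le (h : RadWave c f ft fr ftt ftr frr) (he : ∀ t r, f (-t) r = f t r)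
    {K E : ℝ} (hK : ∀ r, 1 ≤ r → r ^ 2 * |f 0 r| ≤ K)
    (hlim : Tendsto (fun r => r ^ 2 * |f 0 r|) atTop (𝓝 0)) (hE : 0 < E)
    (hext : ∀ᶠ T in atTop, ∀ x y, T ≤ x → x ≤ y →
      ∫ r in x..y, fr T r ^ 2 * r ^ 5 ≤ E) : |c| ≤ √E := by
  have hCw := Cwedge_pos
  obtain ⟨A, hA⟩ : ∃ A, A = 1152 * (Cwedge * (K + 1800 * |c|)) + 41472 * |c| := ⟨_, rfl⟩
  refine le_of_forall_pos_le_add fun ε hε => ?_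
  have l1 : Tendsto (fun T : ℝ => Cwedge * (2 * (A / T ^ 2))) atTop (𝓝 0) := by
    have : Tendsto (fun T : ℝ => A / T ^ 2) atTop (𝓝 0) :=
      tendsto_const_nhds.div_atTop (tendsto_pow_atTop two_ne_zero)
    simpa using (this.const_mul 2).const_mul Cwedge
  obtain ⟨r₀, hr₀⟩ := eventually_atTop.1 (hlim.eventually_le_const
    (show 0 < ε / (2 * Cwedge) by positivity))
  obtain ⟨T, ⟨hT1, hTr⟩, hTl, hTe⟩ := (((eventually_ge_atTop 1).and (eventually_ge_atTop r₀)).and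
    ((l1.eventually_le_const (half_pos hε)).and hext)).exists
  have hT0 : 0 < T := by linarith
  have hb := fun {p q : ℝ} => h.sub_quartic_bound he (K := K) (D := ε / (2 * Cwedge)) (p₀ := T)
    (p := p) (q := q) hT1 (by positivity) hK (fun r hr => hr₀ r (hTr.trans hr))
  rw [← hA] at hb
  have hδ : Cwedge * (ε / (2 * Cwedge) + 2 * (A / T ^ 2)) ≤ ε := by
    rw [mul_add]
    have : Cwedge * (ε / (2 * Cwedge)) = ε / 2 := by field_simp
    linarith
  have b1 : T ^ 2 * |f T (2 * T) - 36 * c / T ^ 2| ≤ ε := by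
    have := (hb (p := T) (q := 3 * T) le_rfl (by linarith)).trans
      (mul_le_mul_of_nonneg_right hδ (sqrt_nonneg _))
    simp only [wY, show (T + 3 * T) / 2 = 2 * T by ring, show (3 * T - T) / 2 = T by ring] at this
    rw [show f T (2 * T) - 576 * c * (T ^ 2 * ((2 * T) ^ 4)⁻¹) = f T (2 * T) - 36 * c / T ^ 2 by
      field_simp; ring, abs_mul, abs_of_pos (by positivity)] at this
    have s : √(3 * T) ≤ 2 * √(2 * T) := by
      refine (sqrt_le_sqrt (by linarith : _ ≤ 2 ^ 2 * (2 * T))).trans_eq ?_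
      rw [sqrt_mul (by positivity), sqrt_sq (by norm_num)]
    have s0 : 0 < √(2 * T) := by positivity
    have t : (2 * T) ^ 2 * √(2 * T) * |f T (2 * T) - 36 * c / T ^ 2| ≤ ε * (2 * √(2 * T)) :=
      this.trans (by gcongr)
    have t' : √(2 * T) * (4 * (T ^ 2 * |f T (2 * T) - 36 * c / T ^ 2|)) ≤ √(2 * T) * (2 * ε) := by
      linarith
    have := le_of_mul_le_mul_left t' s0
    linarith
  have b2 : T ^ 2 * |f T (3 * T) - 64 / 9 * c / T ^ 2| ≤ ε := by
    have := (hb (p := 2 * T) (q := 4 * T) (by linarith) (by linarith)).trans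
      (mul_le_mul_of_nonneg_right hδ (sqrt_nonneg _))
    simp only [wY, show (2 * T + 4 * T) / 2 = 3 * T by ring,
      show (4 * T - 2 * T) / 2 = T by ring] at this
    rw [show f T (3 * T) - 576 * c * (T ^ 2 * ((3 * T) ^ 4)⁻¹) = f T (3 * T) - 64 / 9 * c / T ^ 2 by
      field_simp; norm_num; ring, abs_mul, abs_of_pos (by positivity)] at this
    have s : √(4 * T) ≤ 2 * √(3 * T) := by
      refine (sqrt_le_sqrt (by linarith : _ ≤ 2 ^ 2 * (3 * T))).trans_eq ?_
      rw [sqrt_mul (by positivity), sqrt_sq (by norm_num)]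
    have s0 : 0 < √(3 * T) := by positivity
    have t : (3 * T) ^ 2 * √(3 * T) * |f T (3 * T) - 64 / 9 * c / T ^ 2| ≤ ε * (2 * √(3 * T)) :=
      this.trans (by gcongr)
    have t' : √(3 * T) * (9 * (T ^ 2 * |f T (3 * T) - 64 / 9 * c / T ^ 2|)) ≤
        √(3 * T) * (2 * ε) := by linarith
    have := le_of_mul_le_mul_left t' s0
    linarith
  have b3 : T ^ 2 * |f T (3 * T) - f T (2 * T)| ≤ 1 / 8 * √E := by
    have := h.d0.abs_sub_le h.d2 (t := T) (x := 2 * T) (y := 3 * T) (by positivity) (by linarith) hE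
      (hTe _ _ (by linarith) (by linarith))
    calc _ ≤ T ^ 2 * (1 / 2 * √E / (2 * T) ^ 2) := by gcongr
      _ = _ := by field_simp; norm_num
  have e : 260 / 9 * |c| = T ^ 2 * |36 * c / T ^ 2 - 64 / 9 * c / T ^ 2| := by
    rw [show 36 * c / T ^ 2 - 64 / 9 * c / T ^ 2 = 260 / 9 * c / T ^ 2 by ring, abs_div, abs_mul,
      abs_of_pos (by positivity : 0 < T ^ 2), abs_of_pos (by norm_num : (0:ℝ) < 260 / 9)]
    field_simp
  have tri : |36 * c / T ^ 2 - 64 / 9 * c / T ^ 2| ≤ |f T (2 * T) - 36 * c / T ^ 2| +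
      |f T (3 * T) - 64 / 9 * c / T ^ 2| + |f T (3 * T) - f T (2 * T)| := by
    rw [show 36 * c / T ^ 2 - 64 / 9 * c / T ^ 2 = -(f T (2 * T) - 36 * c / T ^ 2) +
      (f T (3 * T) - 64 / 9 * c / T ^ 2) + -(f T (3 * T) - f T (2 * T)) by ring]
    refine (abs_add_three _ _ _).trans ?_
    rw [abs_neg, abs_neg]
  have := mul_le_mul_of_nonneg_left tri (by positivity : 0 ≤ T ^ 2)
  have := sqrt_nonneg E
  have := abs_nonneg c
  linarith

end

section
variable {c : ℝ} {f ft fr ftt ftr frr : ℝ → ℝ → ℝ}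

lemma RadWave.tendsto_zero (h : RadWave c f ft fr ftt ftr frr) (he : ∀ t r, f (-t) r = f t r)
    {K T : ℝ} (hT : 0 ≤ T) (hK : ∀ r, 1 ≤ r → r ^ 2 * |f 0 r| ≤ K) :
    Tendsto (fun r => f T r) atTop (𝓝 0) := by
  obtain ⟨B, hB⟩ : ∃ B, B = Cwedge * (K + 1800 * |c|) := ⟨_, rfl⟩
  have hl : Tendsto (fun r : ℝ => 2 * B / r ^ 2) atTop (𝓝 0) :=
    tendsto_const_nhds.div_atTop (tendsto_pow_atTop two_ne_zero)
  refine squeeze_zero_norm' ?_ hl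
  filter_upwards [eventually_ge_atTop (T + 1)] with r hr
  have hr0 : 0 < r := by linarith
  have := h.wedge_even he (p := r - T) (q := r + T) (B := K) (by linarith) (by linarith)
    (fun s hs _ => hK s (by linarith))
  rw [← hB] at this
  simp only [wY, show (r - T + (r + T)) / 2 = r by ring,
    show (r + T - (r - T)) / 2 = T by ring] at this
  rw [abs_mul, abs_of_pos (by positivity)] at this
  have hs : √(r + T) ≤ 2 * √r := by
    refine (sqrt_le_sqrt (by linarith : _ ≤ 2 ^ 2 * r)).trans_eq ?_
    rw [sqrt_mul (by positivity), sqrt_sq (by norm_num)]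
  have hB0 : 0 ≤ B := by
    have := Cwedge_pos
    have : 0 ≤ K := (by positivity : (0:ℝ) ≤ 1 ^ 2 * |f 0 1|).trans (hK 1 le_rfl)
    rw [hB]; positivity
  have s0 : 0 < √r := by positivity
  have h1 : √r * (r ^ 2 * |f T r|) ≤ √r * (2 * B) := by
    calc _ = r ^ 2 * √r * |f T r| := by ring
      _ ≤ B * (2 * √r) := this.trans (by gcongr)
      _ = _ := by ring
  have := le_of_mul_le_mul_left h1 s0
  rw [norm_eq_abs, le_div_iff₀ (by positivity)]
  linarith

lemma RadWave.abs_le_of_ext (h : RadWave c f ft fr ftt ftr frr) {T E : ℝ} (hT : 0 ≤ T)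
    (hl : Tendsto (fun r => f T r) atTop (𝓝 0)) (hE : 0 < E)
    (hext : ∀ x y, T ≤ x → x ≤ y → ∫ r in x..y, fr T r ^ 2 * r ^ 5 ≤ E) {r : ℝ}
    (hr : T < r) : |f T r| ≤ 1 / 2 * √E / r ^ 2 := by
  have h1 : Tendsto (fun y => |f T y - f T r|) atTop (𝓝 |0 - f T r|) := (hl.sub_const _).abs
  rw [zero_sub, abs_neg] at h1
  refine le_of_tendsto h1 ?_
  filter_upwards [eventually_ge_atTop r] with y hy
  exact h.d0.abs_sub_le h.d2 (by linarith) hy hE (hext r y hr.le hy)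

/-- The exterior energy density at time `T`, as a function of the incoming coordinate. -/
def extJ (ft fr : ℝ → ℝ → ℝ) (T p : ℝ) : ℝ :=
  1 / 2 * ((p + T) ^ 2 * √(p + T) * (|ft T (p + T)| + |fr T (p + T)|))

lemma RadWave.extJ_bound (h : RadWave c f ft fr ftt ftr frr) {T E : ℝ} (hT : 0 ≤ T) (hE : 0 < E)
    (hext : ∀ x y, T ≤ x → x ≤ y → ∫ r in x..y, (ft T r ^ 2 + fr T r ^ 2) * r ^ 5 ≤ E) :
    L2Bound (extJ ft fr T) (2 * √E) := by
  have hm : MapsTo (fun p : ℝ => p + T) (Ioi 0) (Ioi 0) := fun p (hp : 0 < p) =>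
    show 0 < p + T by linarith
  have c1 : ContinuousOn (fun p => ft T (p + T)) (Ioi 0) :=
    (h.d1.continuousOn_r T).comp (f := fun p : ℝ => p + T) (by fun_prop) hm
  have c2 : ContinuousOn (fun p => fr T (p + T)) (Ioi 0) :=
    (h.d2.continuousOn_r T).comp (f := fun p : ℝ => p + T) (by fun_prop) hm
  have cj : ContinuousOn (extJ ft fr T) (Ioi 0) := by
    unfold extJ
    exact continuousOn_const.mul (ContinuousOn.mul (by fun_prop) (c1.abs.add c2.abs))
  refine ⟨cj, fun p hp => by unfold extJ; positivity, by positivity, fun a b ha hab => ?_⟩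
  have hb := ha.trans_le hab
  have ci : IntervalIntegrable (fun p => (ft T (p + T) ^ 2 + fr T (p + T) ^ 2) * (p + T) ^ 5)
      volume a b :=
    (ContinuousOn.mul ((c1.pow 2).add (c2.pow 2)) (by fun_prop)).intervalIntegrable_Ioi ha hb
  have e := intervalIntegral.integral_comp_add_right (a := a) (b := b)
    (fun r => (ft T r ^ 2 + fr T r ^ 2) * r ^ 5) T
  calc ∫ p in a..b, extJ ft fr T p ^ 2
      ≤ ∫ p in a..b, (ft T (p + T) ^ 2 + fr T (p + T) ^ 2) * (p + T) ^ 5 := by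
        refine intervalIntegral.integral_mono_on hab ((cj.pow 2).intervalIntegrable_Ioi ha hb) ci
          fun p hp => ?_
        have hp0 : 0 < p + T := by linarith [hp.1]
        have hs : √(p + T) ^ 2 = p + T := sq_sqrt hp0.le
        have e : extJ ft fr T p ^ 2 = 1 / 4 * ((p + T) ^ 5 *
            (|ft T (p + T)| + |fr T (p + T)|) ^ 2) := by
          unfold extJ
          rw [mul_pow, mul_pow, mul_pow, hs]; ring
        rw [e, ← sq_abs (ft T (p + T)), ← sq_abs (fr T (p + T)), mul_comm _ ((p + T) ^ 5)]
        have h5 : 0 < (p + T) ^ 5 := by positivity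
        have : 1 / 4 * (|ft T (p + T)| + |fr T (p + T)|) ^ 2 ≤
            |ft T (p + T)| ^ 2 + |fr T (p + T)| ^ 2 := by
          nlinarith [sq_nonneg (|ft T (p + T)| - |fr T (p + T)|), sq_nonneg |ft T (p + T)|,
            sq_nonneg |fr T (p + T)|]
        have := mul_le_mul_of_nonneg_left this h5.le
        linarith
    _ ≤ E := by rw [e]; exact hext _ _ (by linarith) (by linarith)
    _ ≤ (2 * √E) ^ 2 := by rw [mul_pow, sq_sqrt hE.le]; linarith

lemma extSize_le_extJ {T p E : ℝ} (hT : 0 ≤ T) (hp : 0 < p)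
    (hf : |f T (p + T)| ≤ 1 / 2 * √E / (p + T) ^ 2) :
    extSize f ft fr T p ≤ extJ ft fr T p + 2 * √E / √p := by
  obtain ⟨R, hR⟩ : ∃ R, R = p + T := ⟨_, rfl⟩
  have hR0 : 0 < R := by rw [hR]; positivity
  have hpR : p ≤ R := by rw [hR]; linarith
  have hsE := sqrt_nonneg E
  have hsR : 0 < √R := by positivity
  have hsp : 0 < √p := by positivity
  have hss : √p ≤ √R := sqrt_le_sqrt hpR
  have hRR : √R * √R = R := mul_self_sqrt hR0.le
  have hRR' : √R ^ 2 = R := sq_sqrt hR0.le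
  simp only [extSize, extJ, wYp, wY, show (p + (p + 2 * T)) / 2 = p + T by ring,
    show (p + 2 * T - p) / 2 = T by ring]
  rw [← hR] at hf ⊢
  have a1 : |1 / 2 * (R ^ 2 * √R * (fr T R - ft T R) + 5 / 2 * (R * √R * f T R))| ≤
      1 / 2 * (R ^ 2 * √R * (|ft T R| + |fr T R|)) + 5 / 8 * √E / √p := by
    rw [abs_mul, abs_of_pos (by norm_num : (0:ℝ) < 1 / 2)]
    have b1 := abs_add_le (R ^ 2 * √R * (fr T R - ft T R)) (5 / 2 * (R * √R * f T R))
    have b2 : |R ^ 2 * √R * (fr T R - ft T R)| ≤ R ^ 2 * √R * (|ft T R| + |fr T R|) := by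
      rw [abs_mul, abs_of_pos (by positivity)]
      refine mul_le_mul_of_nonneg_left ?_ (by positivity)
      rw [add_comm]; exact abs_sub _ _
    have b3 : |5 / 2 * (R * √R * f T R)| ≤ 5 / 4 * √E / √p := by
      rw [abs_mul, abs_mul, abs_of_pos (by norm_num : (0:ℝ) < 5 / 2),
        abs_of_pos (by positivity : 0 < R * √R)]
      calc _ ≤ 5 / 2 * (R * √R * (1 / 2 * √E / R ^ 2)) := by gcongr
        _ = 5 / 4 * √E / √R := by
          field_simp; rw [hRR']; ring
        _ ≤ _ := by gcongr
    calc _ ≤ 1 / 2 * (R ^ 2 * √R * (|ft T R| + |fr T R|) + 5 / 4 * √E / √p) := by linarith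
      _ = _ := by ring
  have a2 : p / (p + 2 * T) ^ 2 * |R ^ 2 * √R * f T R| ≤ 1 / 2 * √E / √p := by
    rw [abs_mul, abs_of_pos (by positivity : 0 < R ^ 2 * √R)]
    have hRT : R ≤ p + 2 * T := by rw [hR]; linarith
    calc _ ≤ R / R ^ 2 * (R ^ 2 * √R * (1 / 2 * √E / R ^ 2)) := by gcongr
      _ = 1 / 2 * √E / √R := by field_simp; rw [hRR']
      _ ≤ _ := by gcongr
  have : 2 * √E / √p = 5 / 8 * √E / √p + 1 / 2 * √E / √p + 7 / 8 * (√E / √p) := by ring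
  have : 0 ≤ 7 / 8 * (√E / √p) := by positivity
  linarith

lemma inv_one_add_sq_ge {s x : ℝ} (h1 : s ≤ 1 → x ≤ 1) (h2 : 1 ≤ s → x * s ^ 2 ≤ 1)
    (hs : 0 < s) : x ≤ 2 * (1 + s ^ 2)⁻¹ := by
  rw [← div_eq_mul_inv, le_div_iff₀ (by positivity)]
  rcases le_total s 1 with h | h
  · have := h1 h
    have h3 : s ^ 2 ≤ 1 := pow_le_one₀ hs.le h
    by_cases hx : 0 ≤ x
    · nlinarith
    · nlinarith [sq_nonneg s]
  · have h3 := h2 h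
    have : 1 ≤ s ^ 2 := one_le_pow₀ h
    nlinarith

lemma φR1_weight_sq {s : ℝ} (hs : 0 < s) :
    φR1 s ^ 2 * s ^ 5 ≤ 9216 ^ 2 * (2 * (1 + s ^ 2)⁻¹) := by
  rw [← sq_abs]
  suffices |φR1 s| ^ 2 * s ^ 5 / 9216 ^ 2 ≤ 2 * (1 + s ^ 2)⁻¹ by
    rw [div_le_iff₀ (by norm_num)] at this; linarith
  refine inv_one_add_sq_ge (fun h => ?_) (fun h => ?_) hs
  · rw [div_le_one (by norm_num)]
    calc _ ≤ s ^ 2 * s ^ 5 := by gcongr; exact φR1_abs_le_pos hs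
      _ ≤ 1 ^ 2 * 1 ^ 5 := by gcongr
      _ ≤ _ := by norm_num
  · calc _ ≤ (9216 / s ^ 5) ^ 2 * s ^ 5 / 9216 ^ 2 * s ^ 2 := by
          gcongr; exact φR1_abs_le hs
      _ = 1 / s ^ 3 := by field_simp
      _ ≤ 1 := by rw [div_le_one (by positivity)]; exact one_le_pow₀ h

lemma φR1_weight_log {s : ℝ} (hs : 0 < s) :
    s ^ 2 * |φR1 s| * (1 + |log s|) ≤ 18432 * (2 * (1 + s ^ 2)⁻¹) := by
  suffices s ^ 2 * |φR1 s| * (1 + |log s|) / 18432 ≤ 2 * (1 + s ^ 2)⁻¹ by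
    rw [div_le_iff₀ (by norm_num)] at this; linarith
  refine inv_one_add_sq_ge (fun h => ?_) (fun h => ?_) hs
  · rw [div_le_one (by norm_num)]
    have h1 : s * (1 + |log s|) ≤ 2 := by
      rw [abs_of_nonpos (log_nonpos hs.le h)]
      have := one_sub_inv_le_log_of_pos hs
      have h2 : s * (1 - s⁻¹) ≤ s * log s := mul_le_mul_of_nonneg_left this hs.le
      rw [mul_sub, mul_inv_cancel₀ hs.ne'] at h2
      linarith
    calc _ ≤ s ^ 2 * s * (1 + |log s|) := by gcongr; exact φR1_abs_le_pos hs
      _ = s ^ 2 * (s * (1 + |log s|)) := by ring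
      _ ≤ 1 ^ 2 * 2 := by gcongr
      _ ≤ _ := by norm_num
  · rw [abs_of_nonneg (log_nonneg h)]
    have hl := log_nonneg h
    have h0 : √s ≤ s := by
      rw [sqrt_le_left hs.le]; nlinarith
    calc _ ≤ s ^ 2 * (9216 / s ^ 5) * (2 * √s) / 18432 * s ^ 2 := by
          gcongr
          · exact φR1_abs_le hs
          · exact one_add_log_le_sqrt hs
      _ = √s / s := by field_simp; norm_num
      _ ≤ 1 := by rwa [div_le_one hs]

lemma φR1_weight_sqrt {s : ℝ} (hs : 0 < s) :
    s ^ 2 * |φR1 s| * √s ≤ 9216 * (2 * (1 + s ^ 2)⁻¹) := by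
  suffices s ^ 2 * |φR1 s| * √s / 9216 ≤ 2 * (1 + s ^ 2)⁻¹ by
    rw [div_le_iff₀ (by norm_num)] at this; linarith
  refine inv_one_add_sq_ge (fun h => ?_) (fun h => ?_) hs
  · rw [div_le_one (by norm_num)]
    have h1 : √s ≤ 1 := sqrt_le_one.2 h
    calc _ ≤ s ^ 2 * s * √s := by gcongr; exact φR1_abs_le_pos hs
      _ ≤ 1 ^ 2 * 1 * 1 := by gcongr
      _ ≤ _ := by norm_num
  · have h0 : √s ≤ s := by
      rw [sqrt_le_left hs.le]; nlinarith
    calc _ ≤ s ^ 2 * (9216 / s ^ 5) * √s / 9216 * s ^ 2 := by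
          gcongr
          exact φR1_abs_le hs
      _ = √s / s := by field_simp
      _ ≤ 1 := by rwa [div_le_one hs]

lemma φR1_continuous : Continuous φR1 :=
  continuous_iff_continuousAt.2 fun r => (φR1_hasDerivAt r).continuousAt

lemma integral_inv_one_add_sq_le {x y : ℝ} : ∫ s in x..y, (1 + s ^ 2)⁻¹ ≤ π := by
  rw [integral_inv_one_add_sq]
  have := arctan_lt_pi_div_two y
  have := neg_pi_div_two_lt_arctan x
  linarith

end

section
variable {c : ℝ} {f ft fr ftt ftr frr : ℝ → ℝ → ℝ}

/-- Pointwise majorant of a remainder, at all sufficiently late times. -/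
structure ModeRem (C E : ℝ) (e : ℝ → ℝ) : Prop where
  cont : ContinuousOn e (Ioi 0)
  bound : ∀ ε, 0 < ε → ∃ (j : ℝ → ℝ) (η : ℝ), 0 ≤ η ∧ η ≤ ε ∧ L2Bound j (2 * √E) ∧ ∀ s, 0 < s →
    s ^ 3 * |e s| ≤ C * (√s * j s + (3 * √E + η) * (1 + |log s|) + η * √s)

lemma ModeRem.annulus {C E : ℝ} {e : ℝ → ℝ} (h : ModeRem C E e) (hC : 0 < C) (hE : 0 < E)
    {R : ℝ} (hR : 0 < R) :
    ∫ s in R..2 * R, e s ^ 2 * s ^ 5 ≤ 420 * C ^ 2 * E * (1 + log R ^ 2) := by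
  have hsE : 0 < √E := sqrt_pos.2 hE
  have hEE : √E ^ 2 = E := sq_sqrt hE.le
  obtain ⟨j, η, hη, hηε, hj, hb⟩ := h.bound (min √E (√E / √R)) (by positivity)
  have hη1 : η ≤ √E := hηε.trans (min_le_left _ _)
  have hη2 : η ^ 2 * R ≤ E := by
    have : η * √R ≤ √E := by
      rw [← le_div_iff₀ (by positivity)]; exact hηε.trans (min_le_right _ _)
    calc _ = (η * √R) ^ 2 := by rw [mul_pow, sq_sqrt hR.le]
      _ ≤ √E ^ 2 := by gcongr
      _ = E := hEE
  obtain ⟨L, hL⟩ : ∃ L, L = 2 + |log R| := ⟨_, rfl⟩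
  have h2R : R ≤ 2 * R := by linarith
  have h2R0 : 0 < 2 * R := by linarith
  have i1 : IntervalIntegrable (fun s => e s ^ 2 * s ^ 5) volume R (2 * R) :=
    ((h.cont.pow 2).mul (by fun_prop)).intervalIntegrable_Ioi hR h2R0
  have i2 : IntervalIntegrable (fun s => j s ^ 2) volume R (2 * R) :=
    (hj.cont.pow 2).intervalIntegrable_Ioi hR h2R0
  obtain ⟨A, hA⟩ : ∃ A, A = (16 * E * L ^ 2 + E * 2) / R := ⟨_, rfl⟩
  calc ∫ s in R..2 * R, e s ^ 2 * s ^ 5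
      ≤ ∫ s in R..2 * R, 3 * C ^ 2 * (j s ^ 2 + A) := by
        refine intervalIntegral.integral_mono_on h2R i1 ((i2.add (by simp)).const_mul _)
          fun s hs => ?_
        have hs0 : 0 < s := hR.trans_le hs.1
        have hss : √s ^ 2 = s := sq_sqrt hs0.le
        have hlog : 1 + |log s| ≤ L := by
          have h1 : log R ≤ log s := log_le_log hR hs.1
          have h2 : log s ≤ Real.log (2 * R) := log_le_log hs0 hs.2
          rw [Real.log_mul (by norm_num) hR.ne'] at h2
          have := log_two_lt_d9
          have h3 : |log s| ≤ |log R| + 1 := by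
            rw [abs_le]
            constructor
            · have := neg_abs_le (log R); linarith
            · have := le_abs_self (log R); linarith
          rw [hL]; linarith
        have hX : (3 * √E + η) * (1 + |log s|) ≤ 4 * √E * L := by
          gcongr; linarith
        have h1 : s ^ 3 * |e s| ≤ C * (√s * j s + 4 * √E * L + η * √s) :=
          (hb s hs0).trans (by gcongr)
        have h2 : (s ^ 3 * |e s|) ^ 2 ≤ (C * (√s * j s + 4 * √E * L + η * √s)) ^ 2 := by
          gcongr
        have h3 : (C * (√s * j s + 4 * √E * L + η * √s)) ^ 2 ≤
            C ^ 2 * (3 * (s * j s ^ 2 + 16 * E * L ^ 2 + η ^ 2 * s)) := by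
          rw [mul_pow]
          refine mul_le_mul_of_nonneg_left ?_ (by positivity)
          have : 3 * (s * j s ^ 2 + 16 * E * L ^ 2 + η ^ 2 * s) =
            3 * ((√s * j s) ^ 2 + (4 * √E * L) ^ 2 + (η * √s) ^ 2) := by
            simp only [mul_pow, hss, hEE]; ring
          rw [this]
          nlinarith [sq_nonneg (√s * j s - 4 * √E * L), sq_nonneg (√s * j s - η * √s),
            sq_nonneg (4 * √E * L - η * √s)]
        have h4 : η ^ 2 * s ≤ E * 2 := by
          calc _ ≤ η ^ 2 * (2 * R) := by gcongr; exact hs.2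
            _ = η ^ 2 * R * 2 := by ring
            _ ≤ _ := by gcongr
        have h5 : (16 * E * L ^ 2 + E * 2) ≤ s * A := by
          have : 0 ≤ A := by rw [hA]; positivity
          calc _ = R * A := by rw [hA]; field_simp
            _ ≤ _ := by gcongr; exact hs.1
        have h6 : s * (e s ^ 2 * s ^ 5) ≤ s * (3 * C ^ 2 * (j s ^ 2 + A)) := by
          calc _ = (s ^ 3 * |e s|) ^ 2 := by rw [mul_pow, sq_abs]; ring
            _ ≤ C ^ 2 * (3 * (s * j s ^ 2 + 16 * E * L ^ 2 + η ^ 2 * s)) := h2.trans h3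
            _ ≤ C ^ 2 * (3 * (s * j s ^ 2 + s * A)) :=
              mul_le_mul_of_nonneg_left (by linarith) (by positivity)
            _ = _ := by ring
        exact le_of_mul_le_mul_left h6 hs0
    _ = 3 * C ^ 2 * ((∫ s in R..2 * R, j s ^ 2) + R * A) := by
        rw [intervalIntegral.integral_const_mul, intervalIntegral.integral_add i2 (by simp),
          intervalIntegral.integral_const, smul_eq_mul]
        ring
    _ ≤ 3 * C ^ 2 * (4 * E + (16 * E * L ^ 2 + E * 2)) := by
        have h1 := hj.le R (2 * R) hR h2R
        rw [mul_pow, hEE] at h1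
        have h2 : R * A = 16 * E * L ^ 2 + E * 2 := by rw [hA]; field_simp
        rw [h2]
        gcongr
        linarith
    _ ≤ _ := by
        have : L ^ 2 ≤ 8 + 2 * log R ^ 2 := by
          rw [hL, ← sq_abs (log R)]; nlinarith [sq_nonneg (|log R| - 2)]
        have h1 : 4 * E + (16 * E * L ^ 2 + E * 2) ≤ E * (140 * (1 + log R ^ 2)) := by
          have : 16 * L ^ 2 + 6 ≤ 140 * (1 + log R ^ 2) := by nlinarith [sq_nonneg (log R)]
          nlinarith
        calc _ ≤ 3 * C ^ 2 * (E * (140 * (1 + log R ^ 2))) := by gcongr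
          _ = _ := by ring

lemma ModeRem.pairing {C E : ℝ} {e : ℝ → ℝ} (h : ModeRem C E e) (hC : 0 < C) (hE : 0 < E)
    {x y : ℝ} (hx : 0 < x) (hxy : x ≤ y) :
    |∫ s in x..y, e s * φR1 s * s ^ 5| ≤ C * 4 * 10 ^ 8 * √E := by
  have hsE : 0 < √E := sqrt_pos.2 hE
  have hEE : √E ^ 2 = E := sq_sqrt hE.le
  have hy := hx.trans_le hxy
  obtain ⟨j, η, hη, hη1, hj, hb⟩ := h.bound √E hsE
  have i2 : IntervalIntegrable (fun s => j s ^ 2) volume x y :=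
    (hj.cont.pow 2).intervalIntegrable_Ioi hx hy
  have ck : Continuous fun s : ℝ => (1 + s ^ 2)⁻¹ :=
    Continuous.inv₀ (by fun_prop) fun s => by positivity
  have i3 : IntervalIntegrable (fun s : ℝ => (1 + s ^ 2)⁻¹) volume x y := ck.intervalIntegrable _ _
  have b : ∀ s ∈ Ioc x y, ‖e s * φR1 s * s ^ 5‖ ≤
      C * (1 / (2 * √E) * j s ^ 2 + √E * (86000000 * (1 + s ^ 2)⁻¹)) := fun s hs => by
    have hs0 : 0 < s := hx.trans hs.1
    have hss : √s ^ 2 = s := sq_sqrt hs0.le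
    have w1 := φR1_weight_sq hs0
    have w2 := φR1_weight_log hs0
    have w3 := φR1_weight_sqrt hs0
    rw [norm_eq_abs, abs_mul, abs_mul, abs_of_pos (by positivity : 0 < s ^ 5)]
    have h1 : √s * j s * (s ^ 2 * |φR1 s|) ≤
        1 / (2 * √E) * j s ^ 2 + √E / 2 * (φR1 s ^ 2 * s ^ 5) := by
      have : 1 / (2 * √E) * j s ^ 2 + √E / 2 * (φR1 s ^ 2 * s ^ 5) -
          √s * j s * (s ^ 2 * |φR1 s|) =
          1 / (2 * √E) * (j s - √E * (√s * (s ^ 2 * |φR1 s|))) ^ 2 := by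
        have e : (√s * (s ^ 2 * |φR1 s|)) ^ 2 = φR1 s ^ 2 * s ^ 5 := by
          rw [mul_pow, hss, mul_pow, sq_abs]; ring
        rw [← e]
        field_simp; ring
      have : 0 ≤ 1 / (2 * √E) * (j s - √E * (√s * (s ^ 2 * |φR1 s|))) ^ 2 := by positivity
      linarith
    have hX : (3 * √E + η) * (s ^ 2 * |φR1 s| * (1 + |log s|)) ≤
        4 * √E * (18432 * (2 * (1 + s ^ 2)⁻¹)) := by
      gcongr; linarith
    have hY : η * (s ^ 2 * |φR1 s| * √s) ≤ √E * (9216 * (2 * (1 + s ^ 2)⁻¹)) := by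
      gcongr
    have hZ : √E / 2 * (φR1 s ^ 2 * s ^ 5) ≤ √E / 2 * (9216 ^ 2 * (2 * (1 + s ^ 2)⁻¹)) := by
      gcongr
    have hk : 0 ≤ √E * (1 + s ^ 2)⁻¹ := by positivity
    calc |e s| * |φR1 s| * s ^ 5 = s ^ 3 * |e s| * (s ^ 2 * |φR1 s|) := by ring
      _ ≤ C * (√s * j s + (3 * √E + η) * (1 + |log s|) + η * √s) * (s ^ 2 * |φR1 s|) :=
        mul_le_mul_of_nonneg_right (hb s hs0) (by positivity)
      _ = C * (√s * j s * (s ^ 2 * |φR1 s|) + (3 * √E + η) * (s ^ 2 * |φR1 s| * (1 + |log s|)) +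
          η * (s ^ 2 * |φR1 s| * √s)) := by ring
      _ ≤ _ := mul_le_mul_of_nonneg_left (by linarith) hC.le
  have := intervalIntegral.norm_integral_le_of_norm_le (μ := volume) hxy
    (Eventually.of_forall b) (((i2.const_mul (1 / (2 * √E))).add
      ((i3.const_mul 86000000).const_mul √E)).const_mul C)
  rw [norm_eq_abs, intervalIntegral.integral_const_mul, intervalIntegral.integral_add
    (i2.const_mul _) ((i3.const_mul _).const_mul _), intervalIntegral.integral_const_mul,
    intervalIntegral.integral_const_mul, intervalIntegral.integral_const_mul] at this
  refine this.trans ?_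
  have h1 := hj.le x y hx hxy
  have h2 := integral_inv_one_add_sq_le (x := x) (y := y)
  have h3 := pi_lt_d2
  calc _ ≤ C * (1 / (2 * √E) * (2 * √E) ^ 2 + √E * (86000000 * 3.15)) := by
        refine mul_le_mul_of_nonneg_left (add_le_add ?_ ?_) hC.le
        · gcongr
        · gcongr; linarith
    _ = C * √E * (2 + 86000000 * 3.15) := by field_simp
    _ ≤ C * √E * (4 * 10 ^ 8) := by gcongr; norm_num
    _ = _ := by ring

theorem RadWave.exists_modeRem : ∃ C, 0 < C ∧ ∀ (c : ℝ) (f ft fr ftt ftr frr : ℝ → ℝ → ℝ)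
    (E K' : ℝ), RadWave c f ft fr ftt ftr frr → (∀ t r, f (-t) r = f t r) →
    Tendsto (fun r => r ^ 2 * |f 0 r|) atTop (𝓝 0) → (∀ r, 0 < r → r ≤ 1 → |f 0 r| ≤ K') →
    0 < E → (∀ᶠ T in atTop, ∀ x y, T ≤ x → x ≤ y →
      ∫ r in x..y, (ft T r ^ 2 + fr T r ^ 2) * r ^ 5 ≤ E) →
    ∃ a, ModeRem C E (fun s => fr 0 s - a * φR1 s) := by
  obtain ⟨C, hC, H⟩ := RadWave.exists_mode_estimate
  refine ⟨C, hC, fun c f ft fr ftt ftr frr E K' h he hlim hK' hE hext => ?_⟩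
  have hsE : 0 < √E := sqrt_pos.2 hE
  obtain ⟨K, hK⟩ : ∃ K, ∀ r, 1 ≤ r → r ^ 2 * |f 0 r| ≤ K := by
    obtain ⟨r₀, hr₀⟩ := eventually_atTop.1 (hlim.eventually_le_const one_pos)
    have hc : ContinuousOn (fun r => r ^ 2 * |f 0 r|) (Icc 1 (max 1 r₀)) :=
      (ContinuousOn.mul (by fun_prop) (h.d0.continuousOn_r 0).abs).mono fun r hr =>
        lt_of_lt_of_le one_pos hr.1
    obtain ⟨K, hK⟩ := (isCompact_Icc.image_of_continuousOn hc).bddAbove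
    refine ⟨max K 1, fun r hr => ?_⟩
    rcases le_total r (max 1 r₀) with h' | h'
    · exact (hK ⟨r, ⟨hr, h'⟩, rfl⟩).trans (le_max_left _ _)
    · exact (hr₀ r ((le_max_right _ _).trans h')).trans (le_max_right _ _)
  have hext' : ∀ᶠ T in atTop, ∀ x y, T ≤ x → x ≤ y → ∫ r in x..y, fr T r ^ 2 * r ^ 5 ≤ E := by
    filter_upwards [hext, eventually_gt_atTop 0] with T hT hT0 x y hx hxy
    have hx0 := hT0.trans_le hx
    refine le_trans ?_ (hT x y hx hxy)
    have c1 := h.d1.continuousOn_r T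
    have c2 := h.d2.continuousOn_r T
    refine intervalIntegral.integral_mono_on hxy
      (((c2.pow 2).mul (by fun_prop)).intervalIntegrable_Ioi hx0 (hx0.trans_le hxy))
      ((((c1.pow 2).add (c2.pow 2)).mul (by fun_prop)).intervalIntegrable_Ioi hx0
        (hx0.trans_le hxy)) fun r hr => ?_
    have : 0 < r := hx0.trans_le hr.1
    gcongr
    nlinarith [sq_nonneg (ft T r)]
  have hcE : |c| ≤ √E := h.abs_const_le he hK hlim hE hext'
  obtain ⟨a, G, hG, Ha⟩ := H c f ft fr ftt ftr frr K K' h he hK hK'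
  refine ⟨a, (h.d2.continuousOn_r 0).sub
    (continuousOn_const.mul φR1_continuous.continuousOn), fun ε hε => ?_⟩
  have hlG : Tendsto (fun T : ℝ => G / √T) atTop (𝓝 0) :=
    tendsto_const_nhds.div_atTop tendsto_sqrt_atTop
  obtain ⟨T, ⟨hT, hT'⟩, hT1, hTG⟩ := ((hext.and hext').and ((eventually_ge_atTop 1).and
    (hlG.eventually_le_const hε))).exists
  have hT0 : 0 ≤ T := by linarith
  have hjb := h.extJ_bound hT0 hE hT
  have hη : 0 ≤ G / √T := by positivity
  refine ⟨extJ ft fr T, G / √T, hη, hTG, hjb, fun s hs => ?_⟩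
  refine (Ha T _ _ hT1 hjb (fun p hp => extSize_le_extJ hT0 hp
    (h.abs_le_of_ext hT0 (h.tendsto_zero he hT0 hK) hE hT' (by linarith))) s hs).trans ?_
  gcongr
  linarith

end

lemma tendsto_integral_Ioi_zero {g : ℝ → ℝ} (hg : IntegrableOn g (Ioi 0)) :
    Tendsto (fun n : ℕ => ∫ s in (1 / ((n : ℝ) + 1))..((n : ℝ) + 1), g s) atTop
      (𝓝 (∫ s in Ioi 0, g s)) := by
  have hc : AECover (volume.restrict (Ioi (0:ℝ))) (atTop : Filter ℕ)
      fun n => Ioi (1 / ((n : ℝ) + 1)) ∩ Iic ((n : ℝ) + 1) :=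
    (aecover_Ioi_of_Ioi tendsto_one_div_add_atTop_nhds_zero_nat).inter
      ((aecover_Iic (tendsto_natCast_atTop_atTop.atTop_add tendsto_const_nhds)).mono
        Measure.restrict_le_self)
  refine (hc.integral_tendsto_of_countably_generated hg).congr fun n => ?_
  have h1 : 1 / ((n : ℝ) + 1) ≤ (n : ℝ) + 1 := by
    rw [div_le_iff₀ (by positivity)]; nlinarith [(Nat.cast_nonneg n : (0:ℝ) ≤ n)]
  have h0 : 0 < 1 / ((n : ℝ) + 1) := by positivity
  have hsub : Ioc (1 / ((n : ℝ) + 1)) ((n : ℝ) + 1) ⊆ Ioi (0 : ℝ) := fun x hx => h0.trans hx.1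
  rw [intervalIntegral.integral_of_le h1, Ioi_inter_Iic,
    Measure.restrict_restrict measurableSet_Ioc, inter_eq_left.2 hsub]

lemma abs_integral_Ioi_le {g : ℝ → ℝ} {B : ℝ} (hg : IntegrableOn g (Ioi 0))
    (hB : ∀ x y, 0 < x → x ≤ y → |∫ s in x..y, g s| ≤ B) : |∫ s in Ioi 0, g s| ≤ B := by
  refine le_of_tendsto (tendsto_integral_Ioi_zero hg).abs (Eventually.of_forall fun n => ?_)
  refine hB _ _ (by positivity) ?_
  rw [div_le_iff₀ (by positivity)]; nlinarith [(Nat.cast_nonneg n : (0:ℝ) ≤ n)]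

lemma integrableOn_φR1_weight : IntegrableOn (fun s => φR1 s ^ 2 * s ^ 5) (Ioi 0) := by
  have := φR1_continuous
  refine ((integrable_inv_one_add_sq.integrableOn (s := Ioi 0)).const_mul (9216 ^ 2 * 2)).mono'
    (by fun_prop : Continuous fun s => φR1 s ^ 2 * s ^ 5).aestronglyMeasurable ?_
  refine (ae_restrict_iff' measurableSet_Ioi).2 (Eventually.of_forall fun s hs => ?_)
  have hs0 : 0 < s := hs
  rw [norm_eq_abs, abs_of_nonneg (by positivity)]
  exact (φR1_weight_sq hs0).trans_eq (by ring)

/-- Squared `Ḣ¹` norm of the radial profile of `ΛW`, without the area of the sphere. -/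
def normφ : ℝ := ∫ s in Ioi 0, φR1 s ^ 2 * s ^ 5

lemma normφ_pos : 0 < normφ := by
  have := φR1_continuous
  refine (setIntegral_pos_iff_support_of_nonneg_ae ?_ integrableOn_φR1_weight).2 ?_
  · exact (ae_restrict_iff' measurableSet_Ioi).2 (Eventually.of_forall fun s hs => by
      have : 0 < s := hs
      simp only [Pi.zero_apply]; positivity)
  · refine lt_of_lt_of_le (b := volume (Ioo (0:ℝ) 1)) (by simp) (measure_mono fun s hs => ⟨?_, hs.1⟩)
    have hs0 : 0 < s := hs.1
    have hs1 : s < 1 := hs.2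
    have h1 : s ^ 2 < 1 := by nlinarith
    have : φR1 s < 0 := by
      unfold φR1 φY1
      refine mul_neg_of_neg_of_pos (div_neg_of_neg_of_pos (by nlinarith) (by positivity))
        (by positivity)
    rw [Function.mem_support]
    have := this.ne
    positivity

lemma integrableOn_mul_weight {g h : ℝ → ℝ} (hg : ContinuousOn g (Ioi 0))
    (hh : ContinuousOn h (Ioi 0)) (h1 : IntegrableOn (fun s => g s ^ 2 * s ^ 5) (Ioi 0))
    (h2 : IntegrableOn (fun s => h s ^ 2 * s ^ 5) (Ioi 0)) :
    IntegrableOn (fun s => g s * h s * s ^ 5) (Ioi 0) := by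
  refine (h1.add h2).mono'
    (((hg.mul hh).mul (by fun_prop)).aestronglyMeasurable measurableSet_Ioi) ?_
  refine (ae_restrict_iff' measurableSet_Ioi).2 (Eventually.of_forall fun s hs => ?_)
  have hs0 : 0 < s := hs
  rw [norm_eq_abs, abs_mul, abs_mul, abs_of_pos (by positivity : 0 < s ^ 5)]
  simp only [Pi.add_apply]
  rw [← add_mul, ← sq_abs (g s), ← sq_abs (h s)]
  gcongr
  nlinarith [sq_nonneg (|g s| - |h s|), sq_nonneg |g s|, sq_nonneg |h s|]

lemma integral_annulus_le {g : ℝ → ℝ} {R : ℝ} (hR : 0 < R) (hg : IntegrableOn g (Ioi 0))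
    (h0 : ∀ s, 0 < s → 0 ≤ g s) : ∫ s in R..2 * R, g s ≤ ∫ s in Ioi 0, g s := by
  rw [intervalIntegral.integral_of_le (by linarith)]
  refine setIntegral_mono_set hg ((ae_restrict_iff' measurableSet_Ioi).2
    (Eventually.of_forall h0)) (LE.le.eventuallyLE fun s hs => hR.trans hs.1)

/-- The exterior energy estimate for even radial waves, in polar coordinates. -/
theorem RadWave.even_channels : ∃ C, 0 < C ∧ ∀ (c : ℝ) (f ft fr ftt ftr frr : ℝ → ℝ → ℝ)
    (E K' : ℝ), RadWave c f ft fr ftt ftr frr → (∀ t r, f (-t) r = f t r) →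
    Tendsto (fun r => r ^ 2 * |f 0 r|) atTop (𝓝 0) → (∀ r, 0 < r → r ≤ 1 → |f 0 r| ≤ K') →
    0 < E → (∀ᶠ T in atTop, ∀ x y, T ≤ x → x ≤ y →
      ∫ r in x..y, (ft T r ^ 2 + fr T r ^ 2) * r ^ 5 ≤ E) →
    IntegrableOn (fun s => fr 0 s ^ 2 * s ^ 5) (Ioi 0) → ∀ R, 0 < R →
    ∫ s in R..2 * R, (fr 0 s - (∫ s in Ioi 0, fr 0 s * φR1 s * s ^ 5) / normφ * φR1 s) ^ 2 * s ^ 5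
      ≤ C * E * (1 + log R ^ 2) := by
  obtain ⟨C, hC, H⟩ := RadWave.exists_modeRem
  have hD := normφ_pos
  obtain ⟨B, hB⟩ : ∃ B, B = C * 4 * 10 ^ 8 / normφ := ⟨_, rfl⟩
  refine ⟨2 * (420 * C ^ 2) + 2 * B ^ 2 * normφ, by positivity,
    fun c f ft fr ftt ftr frr E K' h he hlim hK' hE hext hint R hR => ?_⟩
  obtain ⟨a, ha⟩ := H c f ft fr ftt ftr frr E K' h he hlim hK' hE hext
  have hEE : √E ^ 2 = E := sq_sqrt hE.le
  have c1 := h.d2.continuousOn_r 0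
  have c2 : ContinuousOn φR1 (Ioi 0) := φR1_continuous.continuousOn
  have i1 := integrableOn_mul_weight c1 c2 hint integrableOn_φR1_weight
  have e1 : ∀ s, (fr 0 s - a * φR1 s) * φR1 s * s ^ 5 =
      fr 0 s * φR1 s * s ^ 5 - a * (φR1 s ^ 2 * s ^ 5) := fun s => by ring
  have i2 : IntegrableOn (fun s => (fr 0 s - a * φR1 s) * φR1 s * s ^ 5) (Ioi 0) := by
    simp only [e1]
    exact i1.sub (integrableOn_φR1_weight.const_mul a)
  have hb := abs_integral_Ioi_le i2 fun x y hx hxy => ha.pairing hC hE hx hxy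
  simp only [e1] at hb
  rw [integral_sub i1 (integrableOn_φR1_weight.const_mul a), integral_const_mul] at hb
  change |_ - a * normφ| ≤ _ at hb
  obtain ⟨l, hl⟩ : ∃ l, l = (∫ s in Ioi 0, fr 0 s * φR1 s * s ^ 5) / normφ := ⟨_, rfl⟩
  rw [← hl]
  have hla : |l - a| ≤ B * √E := by
    have : l - a = ((∫ s in Ioi 0, fr 0 s * φR1 s * s ^ 5) - a * normφ) / normφ := by
      rw [hl]; field_simp
    rw [this, abs_div, abs_of_pos hD, hB, div_le_iff₀ hD]
    calc _ ≤ _ := hb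
      _ = _ := by field_simp
  have hla2 : (l - a) ^ 2 ≤ B ^ 2 * E := by
    rw [← sq_abs]
    calc _ ≤ (B * √E) ^ 2 := by gcongr
      _ = _ := by rw [mul_pow, hEE]
  have hRR : R ≤ 2 * R := by linarith
  have j1 : IntervalIntegrable (fun s => (fr 0 s - a * φR1 s) ^ 2 * s ^ 5) volume R (2 * R) :=
    ((ha.cont.pow 2).mul (by fun_prop)).intervalIntegrable_Ioi hR (by linarith)
  have j2 : IntervalIntegrable (fun s => φR1 s ^ 2 * s ^ 5) volume R (2 * R) :=
    ((c2.pow 2).mul (by fun_prop)).intervalIntegrable_Ioi hR (by linarith)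
  calc _ ≤ ∫ s in R..2 * R, (2 * ((fr 0 s - a * φR1 s) ^ 2 * s ^ 5) +
        2 * (l - a) ^ 2 * (φR1 s ^ 2 * s ^ 5)) := by
        refine intervalIntegral.integral_mono_on hRR
          ((((c1.sub (continuousOn_const.mul c2)).pow 2).mul (by fun_prop)).intervalIntegrable_Ioi
            hR (by linarith)) ((j1.const_mul 2).add (j2.const_mul _)) fun s hs => ?_
        have hs0 : 0 < s := hR.trans_le hs.1
        have h5 : 0 < s ^ 5 := by positivity
        have : (fr 0 s - l * φR1 s) ^ 2 ≤
            2 * (fr 0 s - a * φR1 s) ^ 2 + 2 * (l - a) ^ 2 * φR1 s ^ 2 := by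
          nlinarith [sq_nonneg ((fr 0 s - a * φR1 s) + (l - a) * φR1 s)]
        have := mul_le_mul_of_nonneg_right this h5.le
        linarith
    _ = 2 * (∫ s in R..2 * R, (fr 0 s - a * φR1 s) ^ 2 * s ^ 5) +
        2 * (l - a) ^ 2 * ∫ s in R..2 * R, φR1 s ^ 2 * s ^ 5 := by
        rw [intervalIntegral.integral_add (j1.const_mul 2) (j2.const_mul _),
          intervalIntegral.integral_const_mul, intervalIntegral.integral_const_mul]
    _ ≤ 2 * (420 * C ^ 2 * E * (1 + log R ^ 2)) + 2 * (B ^ 2 * E) * normφ := by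
        refine add_le_add (mul_le_mul_of_nonneg_left (ha.annulus hC hE hR) (by norm_num)) ?_
        refine mul_le_mul (by linarith) (integral_annulus_le hR integrableOn_φR1_weight fun s hs =>
          by positivity) ?_ (by positivity)
        exact intervalIntegral.integral_nonneg hRR fun s hs => by
          have : 0 < s := hR.trans_le hs.1
          positivity
    _ ≤ _ := by
        have : 0 ≤ 2 * B ^ 2 * normφ * E * log R ^ 2 := by positivity
        linarith

lemma hasDerivAt_integral_growing {f fp : ℝ → ℝ → ℝ}
    (hf : Continuous fun x : ℝ × ℝ => f x.1 x.2) (hfp : Continuous fun x : ℝ × ℝ => fp x.1 x.2)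
    (hd : ∀ p q, HasDerivAt (fun p => f p q) (fp p q) p) {p L : ℝ} (hp : 0 ≤ p) (hL : 0 ≤ L) :
    HasDerivAt (fun x => ∫ q in (0:ℝ)..(x + L), f x q)
      (f p (p + L) + ∫ q in (0:ℝ)..(p + L), fp p q) p := by
  have sh : Continuous fun x : ℝ × ℝ => ((x.1 - 1, x.2 - 1) : ℝ × ℝ) := by fun_prop
  have cf := hf.comp sh
  have cfp := hfp.comp sh
  have hpL : 0 < p + L + 1 := by linarith
  have h1 := hasDerivAt_integral_fixed (f := fun x q => f (x - 1) (q - 1))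
    (fp := fun x q => fp (x - 1) (q - 1)) cf.continuousOn cfp.continuousOn
    (fun x q _ _ => (hd (x - 1) (q - 1)).comp_sub_const x 1) (p := p + 1) (by linarith)
    one_pos hpL
  have h2 := hasDerivAt_integral_endpoint (f := fun x q => f (x - 1) (q - 1)) cf.continuousOn
    (p := p + 1) (by linarith) hpL
  refine ((h2.add h1).comp_add_const p 1).congr_of_eventuallyEq (Eventually.of_forall fun x => ?_)
    |>.congr_deriv ?_
  · have ci : ∀ a b, IntervalIntegrable (fun q => f (x + 1 - 1) (q - 1)) volume a b := fun a b =>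
      (cf.comp (f := fun q : ℝ => (x + 1, q)) (by fun_prop)).intervalIntegrable a b
    simp only [Pi.add_apply]
    rw [add_comm (∫ q in (p + L + 1).._, _), intervalIntegral.integral_add_adjacent_intervals (ci _ _) (ci _ _),
      intervalIntegral.integral_comp_sub_right (fun q => f (x + 1 - 1) q) 1]
    simp only [add_sub_cancel_right, sub_self]
    congr 1; ring
  · rw [intervalIntegral.integral_comp_sub_right (fun q => fp (p + 1 - 1) q) 1]
    simp

/-- `g` is differentiable on `ℝ × ℝ` with partial derivatives `gt, gr`. -/
def FullGrad (g gt gr : ℝ → ℝ → ℝ) : Prop :=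
  ∀ t r, HasFDerivAt (fun x : ℝ × ℝ => g x.1 x.2) (lin2 (gt t r) (gr t r)) (t, r)

section
variable {g gt gr : ℝ → ℝ → ℝ}

lemma FullGrad.hasGrad (h : FullGrad g gt gr) : HasGrad g gt gr := fun t r _ => h t r

lemma FullGrad.continuous (h : FullGrad g gt gr) : Continuous fun x : ℝ × ℝ => g x.1 x.2 :=
  continuous_iff_continuousAt.2 fun x => (h x.1 x.2).continuousAt

lemma FullGrad.deriv_t (h : FullGrad g gt gr) (t r : ℝ) :
    HasDerivAt (fun t => g t r) (gt t r) t := by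
  have := (h t r).comp_hasDerivAt t ((hasDerivAt_id' t).prodMk (hasDerivAt_const t r))
  exact this.congr_deriv (by simp)

lemma FullGrad.deriv_r (h : FullGrad g gt gr) (t r : ℝ) :
    HasDerivAt (fun r => g t r) (gr t r) r := by
  have := (h t r).comp_hasDerivAt r ((hasDerivAt_const r t).prodMk (hasDerivAt_id' r))
  exact this.congr_deriv (by simp)

lemma FullGrad.reflect (h : FullGrad g gt gr) :
    FullGrad (fun t r => g (-t) r) (fun t r => -gt (-t) r) (fun t r => gr (-t) r) := fun t r => by
  have h1 : HasFDerivAt (fun x : ℝ × ℝ => ((-x.1, x.2) : ℝ × ℝ))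
      ((-ContinuousLinearMap.fst ℝ ℝ ℝ).prod (ContinuousLinearMap.snd ℝ ℝ ℝ)) (t, r) :=
    hasFDerivAt_fst.neg.prodMk hasFDerivAt_snd
  refine ((h (-t) r).comp (t, r) h1).congr_fderiv ?_
  ext <;> simp

lemma FullGrad.neg (h : FullGrad g gt gr) :
    FullGrad (fun t r => -g t r) (fun t r => -gt t r) (fun t r => -gr t r) := fun t r => by
  refine (h t r).neg.congr_fderiv ?_
  ext <;> simp
end

/-- A twice continuously differentiable function on `ℝ × ℝ` solving the linearized radial equation
for `r > 0`. -/
structure FullWave (U Ut Ur Utt Utr Urr : ℝ → ℝ → ℝ) : Prop where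
  d0 : FullGrad U Ut Ur
  d1 : FullGrad Ut Utt Utr
  d2 : FullGrad Ur Utr Urr
  ctt : Continuous fun x : ℝ × ℝ => Utt x.1 x.2
  ctr : Continuous fun x : ℝ × ℝ => Utr x.1 x.2
  crr : Continuous fun x : ℝ × ℝ => Urr x.1 x.2
  pde : ∀ t r, 0 < r → Utt t r = Urr t r + 5 / r * Ur t r - Vrad r * U t r

section
variable {U Ut Ur Utt Utr Urr : ℝ → ℝ → ℝ}

lemma FullWave.reflect (h : FullWave U Ut Ur Utt Utr Urr) :
    FullWave (fun t r => U (-t) r) (fun t r => -Ut (-t) r) (fun t r => Ur (-t) r)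
      (fun t r => Utt (-t) r) (fun t r => -Utr (-t) r) (fun t r => Urr (-t) r) := by
  have cn : Continuous fun x : ℝ × ℝ => ((-x.1, x.2) : ℝ × ℝ) := by fun_prop
  refine ⟨h.d0.reflect, ?_, h.d2.reflect, h.ctt.comp cn, (h.ctr.comp cn).neg, h.crr.comp cn,
    fun t r hr => h.pde (-t) r hr⟩
  simpa using h.d1.reflect.neg

/-- Energy density with a positive zeroth order term. -/
def dens (U Ut Ur : ℝ → ℝ → ℝ) (t r : ℝ) : ℝ :=
  1 / 2 * (Ut t r ^ 2 + Ur t r ^ 2 + Vrad r ^ 2 * U t r ^ 2) * r ^ 5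

lemma FullWave.energy_growth (h : FullWave U Ut Ur Utt Utr Urr) {T L : ℝ} (hT : 0 ≤ T)
    (hL : 0 ≤ L) : ∫ r in (0:ℝ)..L, dens U Ut Ur T r ≤
      Real.exp (3 * T) * ∫ r in (0:ℝ)..(T + L), dens U Ut Ur 0 r := by
  have cV := Vrad_continuous
  have c0 := h.d0.continuous
  have c1 := h.d1.continuous
  have c2 := h.d2.continuous
  have ctt := h.ctt
  have ctr := h.ctr
  have crr := h.crr
  obtain ⟨et, het⟩ : ∃ et : ℝ → ℝ → ℝ, et = fun t r =>
    (Ut t r * Utt t r + Ur t r * Utr t r + Vrad r ^ 2 * U t r * Ut t r) * r ^ 5 := ⟨_, rfl⟩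
  have cV2 : Continuous fun x : ℝ × ℝ => Vrad x.2 := cV.comp continuous_snd
  have ce : Continuous fun x : ℝ × ℝ => dens U Ut Ur x.1 x.2 := by
    unfold dens; fun_prop
  have cet : Continuous fun x : ℝ × ℝ => et x.1 x.2 := by rw [het]; fun_prop
  have hd : ∀ t r, HasDerivAt (fun t => dens U Ut Ur t r) (et t r) t := fun t r => by
    have a0 := (h.d0.deriv_t t r).fun_pow 2
    have a1 := (h.d1.deriv_t t r).fun_pow 2
    have a2 := (h.d2.deriv_t t r).fun_pow 2
    refine ((((a1.add a2).add (a0.const_mul (Vrad r ^ 2))).const_mul (1 / 2)).mul_const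
      (r ^ 5)).congr_deriv ?_
    rw [het]; ring
  have rev : Continuous fun x : ℝ × ℝ => ((T - x.1, x.2) : ℝ × ℝ) := by fun_prop
  have hI : ∀ p, 0 ≤ p → HasDerivAt (fun x => ∫ q in (0:ℝ)..(x + L), dens U Ut Ur (T - x) q)
      (dens U Ut Ur (T - p) (p + L) + ∫ q in (0:ℝ)..(p + L), -et (T - p) q) p := fun p hp =>
    hasDerivAt_integral_growing (f := fun x q => dens U Ut Ur (T - x) q)
      (fp := fun x q => -et (T - x) q) (ce.comp rev) (cet.comp rev).neg
      (fun p q => (hd (T - p) q).comp_const_sub T p) hp hL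
  have slice : ∀ {k : ℝ → ℝ → ℝ}, (Continuous fun x : ℝ × ℝ => k x.1 x.2) → ∀ t, Continuous (k t) :=
    fun hk t => hk.comp (f := fun r => (t, r)) (by fun_prop)
  have hineq : ∀ t ρ, 0 ≤ ρ →
      ∫ q in (0:ℝ)..ρ, et t q ≤ dens U Ut Ur t ρ + 3 * ∫ q in (0:ℝ)..ρ, dens U Ut Ur t q := by
    intro t ρ hρ
    have k0 := slice c0 t
    have k1 := slice c1 t
    have k2 := slice c2 t
    have ktr := slice ctr t
    have krr := slice crr t
    obtain ⟨mr, hmr⟩ : ∃ mr : ℝ → ℝ, mr = fun r =>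
      (Utr t r * Ur t r + Ut t r * Urr t r) * r ^ 5 + Ut t r * Ur t r * (5 * r ^ 4) := ⟨_, rfl⟩
    have cm : Continuous mr := by rw [hmr]; fun_prop
    have hm : ∫ r in (0:ℝ)..ρ, mr r = Ut t ρ * Ur t ρ * ρ ^ 5 := by
      rw [intervalIntegral.integral_eq_sub_of_hasDerivAt
        (f := fun r => Ut t r * Ur t r * r ^ 5) (fun r _ => ?_) (cm.intervalIntegrable _ _)]
      · simp
      · refine (((h.d1.deriv_r t r).mul (h.d2.deriv_r t r)).mul (hasDerivAt_pow 5 r)).congr_deriv ?_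
        rw [hmr]; norm_num
    have hpt : ∀ r ∈ Icc 0 ρ, et t r ≤ mr r + 3 * dens U Ut Ur t r := by
      intro r hr
      rcases hr.1.eq_or_lt with h0 | h0
      · rw [← h0, het, hmr]; simp [dens]
      · have e1 : et t r = mr r + (Vrad r ^ 2 - Vrad r) * U t r * Ut t r * r ^ 5 := by
          rw [het, hmr]; simp only [h.pde t r h0]; field_simp; ring
        rw [e1]
        have hV : |Vrad r ^ 2 - Vrad r| ≤ 3 * |Vrad r| := by
          have : Vrad r ^ 2 - Vrad r = Vrad r * (Vrad r - 1) := by ring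
          rw [this, abs_mul, mul_comm]
          refine mul_le_mul_of_nonneg_right ?_ (abs_nonneg _)
          have := abs_le.1 (Vrad_abs_le_two r)
          have v0 : Vrad r ≤ 0 := by
            unfold Vrad
            exact mul_nonpos_of_nonpos_of_nonneg (by norm_num) (by positivity)
          rw [abs_le]; constructor <;> linarith
        have : (Vrad r ^ 2 - Vrad r) * U t r * Ut t r ≤
            3 * (1 / 2 * (Ut t r ^ 2 + Ur t r ^ 2 + Vrad r ^ 2 * U t r ^ 2)) := by
          refine (le_abs_self _).trans ?_
          rw [abs_mul, abs_mul]
          have := mul_le_mul_of_nonneg_right (mul_le_mul_of_nonneg_right hV (abs_nonneg (U t r)))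
            (abs_nonneg (Ut t r))
          refine this.trans ?_
          rw [← sq_abs (Ut t r), ← sq_abs (U t r), ← sq_abs (Vrad r)]
          nlinarith [sq_nonneg (|Ut t r| - |Vrad r| * |U t r|), sq_nonneg (Ur t r)]
        have := mul_le_mul_of_nonneg_right this (by positivity : 0 ≤ r ^ 5)
        unfold dens
        linarith
    have ce' := slice ce t
    have := intervalIntegral.integral_mono_on (μ := volume) hρ ((slice cet t).intervalIntegrable 0 ρ)
      ((by fun_prop : Continuous fun r => mr r + 3 * dens U Ut Ur t r).intervalIntegrable 0 ρ) hpt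
    rw [intervalIntegral.integral_add (cm.intervalIntegrable _ _)
      ((ce'.const_mul 3).intervalIntegrable _ _), intervalIntegral.integral_const_mul, hm] at this
    refine this.trans (add_le_add_left ?_ _)
    unfold dens
    refine mul_le_mul_of_nonneg_right ?_ (by positivity)
    nlinarith [sq_nonneg (Ut t ρ - Ur t ρ), mul_nonneg (sq_nonneg (Vrad ρ)) (sq_nonneg (U t ρ))]
  have hexp : ∀ p, HasDerivAt (fun x : ℝ => Real.exp (3 * x)) (Real.exp (3 * p) * 3) p := fun p => by
    simpa using (((hasDerivAt_id' p).const_mul 3).exp)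
  have hG := fun p hp => (hexp p).mul (hI p hp)
  have mono : MonotoneOn (fun x => Real.exp (3 * x) *
      ∫ q in (0:ℝ)..(x + L), dens U Ut Ur (T - x) q) (Icc 0 T) := by
    refine monotoneOn_of_hasDerivWithinAt_nonneg (convex_Icc 0 T)
      (fun p hp => (hG p hp.1).continuousAt.continuousWithinAt)
      (fun p hp => (hG p (interior_subset hp).1).hasDerivWithinAt) fun p hp => ?_
    have hp0 : 0 ≤ p := (interior_subset hp).1
    have := hineq (T - p) (p + L) (by linarith)
    rw [intervalIntegral.integral_neg]
    have h2 : 0 ≤ Real.exp (3 * p) := (Real.exp_pos _).le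
    nlinarith
  have := mono (left_mem_Icc.2 hT) (right_mem_Icc.2 hT) hT
  simpa using this

end

lemma eventually_tail_le {g : ℝ → ℝ} (hg : IntegrableOn g (Ioi 0)) (h0 : ∀ r, 0 < r → 0 ≤ g r)
    {δ : ℝ} (hδ : 0 < δ) : ∀ᶠ x in atTop, ∀ y, x ≤ y → ∫ r in x..y, g r ≤ δ := by
  have h1 : IntegrableOn g (Ioi 1) := hg.mono_set (Ioi_subset_Ioi zero_le_one)
  have ht := intervalIntegral_tendsto_integral_Ioi 1 h1 tendsto_id
  filter_upwards [ht.eventually (lt_mem_nhds (sub_lt_self _ hδ)), eventually_ge_atTop 1]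
    with x hx hx1 y hxy
  have ii : ∀ a b : ℝ, 1 ≤ a → a ≤ b → IntervalIntegrable g volume a b := fun a b ha hab =>
    (intervalIntegrable_iff_integrableOn_Ioc_of_le hab).2
      (h1.mono_set (Ioc_subset_Ioi_self.trans (Ioi_subset_Ioi ha)))
  have e := intervalIntegral.integral_add_adjacent_intervals (ii 1 x le_rfl hx1) (ii x y hx1 hxy)
  have hy : ∫ r in (1:ℝ)..y, g r ≤ ∫ r in Ioi 1, g r := by
    rw [intervalIntegral.integral_of_le (hx1.trans hxy)]
    refine setIntegral_mono_set h1 ((ae_restrict_iff' measurableSet_Ioi).2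
      (Eventually.of_forall fun r hr => h0 r (one_pos.trans hr)))
      (LE.le.eventuallyLE Ioc_subset_Ioi_self)
  simp only [id] at hx
  linarith

section
variable {U Ut Ur Utt Utr Urr : ℝ → ℝ → ℝ}

/-- Energy density in polar coordinates. -/
def ener (Ut Ur : ℝ → ℝ → ℝ) (t r : ℝ) : ℝ := (Ut t r ^ 2 + Ur t r ^ 2) * r ^ 5

lemma ener_nonneg (t : ℝ) {r : ℝ} (hr : 0 < r) : 0 ≤ ener Ut Ur t r := by
  unfold ener; positivity

lemma FullWave.continuous_slice (h : FullWave U Ut Ur Utt Utr Urr) (t : ℝ) :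
    Continuous (U t) ∧ Continuous (Ut t) ∧ Continuous (Ur t) := by
  have hc : Continuous fun r : ℝ => (t, r) := by fun_prop
  exact ⟨h.d0.continuous.comp hc, h.d1.continuous.comp hc, h.d2.continuous.comp hc⟩

lemma FullWave.integrableOn_Ur (h : FullWave U Ut Ur Utt Utr Urr) {t : ℝ}
    (hi : IntegrableOn (ener Ut Ur t) (Ioi 0)) :
    IntegrableOn (fun r => Ur t r ^ 2 * r ^ 5) (Ioi 0) := by
  have := (h.continuous_slice t).2.2
  refine hi.mono' (by fun_prop : Continuous fun r => Ur t r ^ 2 * r ^ 5).aestronglyMeasurable ?_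
  refine (ae_restrict_iff' measurableSet_Ioi).2 (Eventually.of_forall fun r hr => ?_)
  have hr0 : 0 < r := hr
  rw [norm_eq_abs, abs_of_nonneg (by positivity)]
  unfold ener
  nlinarith [mul_nonneg (sq_nonneg (Ut t r)) (pow_pos hr0 5).le]

lemma FullWave.eventually_abs_sub_le (h : FullWave U Ut Ur Utt Utr Urr) {t : ℝ}
    (hi : IntegrableOn (ener Ut Ur t) (Ioi 0)) {ε : ℝ} (hε : 0 < ε) :
    ∀ᶠ x in atTop, ∀ y, x ≤ y → |U t y - U t x| ≤ 1 / 2 * ε / x ^ 2 := by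
  filter_upwards [eventually_tail_le (h.integrableOn_Ur hi) (fun r hr => by positivity)
    (sq_pos_of_pos hε), eventually_gt_atTop 0] with x hx hx0 y hxy
  have := h.d0.hasGrad.abs_sub_le h.d2.hasGrad hx0 hxy (sq_pos_of_pos hε) (hx y hxy)
  rwa [sqrt_sq hε.le] at this

lemma FullWave.exists_limit (h : FullWave U Ut Ur Utt Utr Urr) {t : ℝ}
    (hi : IntegrableOn (ener Ut Ur t) (Ioi 0)) :
    ∃ c, Tendsto (fun r => r ^ 2 * |U t r - c|) atTop (𝓝 0) ∧ Tendsto (U t) atTop (𝓝 c) := by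
  have hC : CauchySeq (U t) := by
    refine Metric.cauchySeq_iff'.2 fun ε hε => ?_
    obtain ⟨N, hN, hN1⟩ := ((h.eventually_abs_sub_le hi hε).and (eventually_ge_atTop 1)).exists
    refine ⟨N, fun n hn => (hN n hn).trans_lt ?_⟩
    rw [div_lt_iff₀ (by positivity)]
    nlinarith [mul_le_mul_of_nonneg_left (one_le_pow₀ hN1 (n := 2)) hε.le]
  obtain ⟨c, hc⟩ := cauchySeq_tendsto_of_complete hC
  refine ⟨c, ?_, hc⟩
  refine Metric.tendsto_nhds.2 fun ε hε => ?_
  filter_upwards [h.eventually_abs_sub_le hi hε, eventually_gt_atTop 0] with x hx hx0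
  have : |c - U t x| ≤ 1 / 2 * ε / x ^ 2 :=
    le_of_tendsto (hc.sub_const (U t x)).abs ((eventually_ge_atTop x).mono hx)
  rw [le_div_iff₀ (by positivity), abs_sub_comm] at this
  rw [dist_zero_right, norm_eq_abs, abs_of_nonneg (by positivity)]
  linarith

lemma FullWave.exists_bound (h : FullWave U Ut Ur Utt Utr Urr) {t : ℝ}
    (hi : IntegrableOn (ener Ut Ur t) (Ioi 0)) : ∃ K, ∀ r, 0 ≤ r → |U t r| ≤ K := by
  obtain ⟨c, -, hc⟩ := h.exists_limit hi
  obtain ⟨X, hX⟩ := eventually_atTop.1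
    (hc.abs.eventually (gt_mem_nhds (lt_add_one |c|)))
  obtain ⟨B, hB⟩ := isCompact_Icc.exists_bound_of_continuousOn
    (h.continuous_slice t).1.continuousOn (s := Icc 0 X)
  refine ⟨max B (|c| + 1), fun r hr => ?_⟩
  rcases le_total r X with hx | hx
  · exact (hB r ⟨hr, hx⟩).trans (le_max_left _ _)
  · exact (hX r hx).le.trans (le_max_right _ _)

lemma Vrad_weight {r : ℝ} (hr : 0 < r) : Vrad r ^ 2 * r ^ 5 ≤ 1152 ^ 2 * (1 + r ^ 2)⁻¹ := by
  rw [← sq_abs, Vrad_abs, div_pow, ← div_eq_mul_inv, div_mul_eq_mul_div,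
    div_le_div_iff₀ (by positivity) (by positivity), mul_assoc]
  refine mul_le_mul_of_nonneg_left ?_ (by positivity)
  rw [← pow_mul]
  have h1 : r ≤ 24 + r ^ 2 := by nlinarith [sq_nonneg (r - 1)]
  calc r ^ 5 * (1 + r ^ 2) = r ^ 2 * r ^ 2 * r * (1 + r ^ 2) := by ring
    _ ≤ (24 + r ^ 2) * (24 + r ^ 2) * (24 + r ^ 2) * (24 + r ^ 2) := by gcongr <;> linarith
    _ = _ := by ring

lemma FullWave.integrableOn_ener_of_nonneg (h : FullWave U Ut Ur Utt Utr Urr)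
    (hi : IntegrableOn (ener Ut Ur 0) (Ioi 0)) {T : ℝ} (hT : 0 ≤ T) :
    IntegrableOn (ener Ut Ur T) (Ioi 0) := by
  have cV := Vrad_continuous
  obtain ⟨K, hK⟩ := h.exists_bound hi
  obtain ⟨a0, a1, a2⟩ := h.continuous_slice 0
  obtain ⟨b0, b1, b2⟩ := h.continuous_slice T
  have cd0 : Continuous (dens U Ut Ur 0) := by unfold dens; fun_prop
  have cdT : Continuous (dens U Ut Ur T) := by unfold dens; fun_prop
  have ceT : Continuous (ener Ut Ur T) := by unfold ener; fun_prop
  have d0 : ∀ t r, 0 < r → 0 ≤ dens U Ut Ur t r := fun t r hr => by unfold dens; positivity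
  have hd : IntegrableOn (dens U Ut Ur 0) (Ioi 0) := by
    refine ((hi.const_mul (1 / 2)).add ((integrable_inv_one_add_sq.integrableOn
      (s := Ioi 0)).const_mul (1152 ^ 2 * K ^ 2))).mono' cd0.aestronglyMeasurable ?_
    refine (ae_restrict_iff' measurableSet_Ioi).2 (Eventually.of_forall fun r hr => ?_)
    have hr0 : 0 < r := hr
    rw [norm_eq_abs, abs_of_nonneg (d0 0 r hr0)]
    have h1 : U 0 r ^ 2 ≤ K ^ 2 := by
      rw [← sq_abs]; exact pow_le_pow_left₀ (abs_nonneg _) (hK r hr0.le) 2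
    have h2 : Vrad r ^ 2 * r ^ 5 * U 0 r ^ 2 ≤ 1152 ^ 2 * (1 + r ^ 2)⁻¹ * K ^ 2 :=
      mul_le_mul (Vrad_weight hr0) h1 (by positivity) (by positivity)
    have h3 : 0 ≤ 1152 ^ 2 * (1 + r ^ 2)⁻¹ * K ^ 2 := by positivity
    simp only [Pi.add_apply, dens, ener]
    nlinarith
  refine integrableOn_Ioi_of_intervalIntegral_norm_bounded
    (2 * (Real.exp (3 * T) * ∫ r in Ioi 0, dens U Ut Ur 0 r)) 0
    (fun L => ceT.integrableOn_Ioc) tendsto_id (eventually_ge_atTop 0 |>.mono fun L hL => ?_)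
  simp only [id]
  have e1 : ∫ r in (0:ℝ)..L, ‖ener Ut Ur T r‖ ≤ ∫ r in (0:ℝ)..L, 2 * dens U Ut Ur T r := by
    refine intervalIntegral.integral_mono_on hL (ceT.norm.intervalIntegrable _ _)
      ((cdT.const_mul 2).intervalIntegrable _ _) fun r hr => ?_
    have hr0 : 0 ≤ r := hr.1
    unfold ener dens
    rw [norm_eq_abs, abs_of_nonneg (by positivity)]
    have : 0 ≤ Vrad r ^ 2 * U T r ^ 2 * r ^ 5 := by positivity
    linarith
  refine e1.trans ?_
  rw [intervalIntegral.integral_const_mul]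
  refine mul_le_mul_of_nonneg_left ((h.energy_growth hT hL).trans
    (mul_le_mul_of_nonneg_left ?_ (Real.exp_pos _).le)) zero_le_two
  rw [intervalIntegral.integral_of_le (by linarith)]
  exact setIntegral_mono_set hd ((ae_restrict_iff' measurableSet_Ioi).2
    (Eventually.of_forall (d0 0))) (LE.le.eventuallyLE Ioc_subset_Ioi_self)

lemma FullWave.integrableOn_ener (h : FullWave U Ut Ur Utt Utr Urr)
    (hi : IntegrableOn (ener Ut Ur 0) (Ioi 0)) (T : ℝ) :
    IntegrableOn (ener Ut Ur T) (Ioi 0) := by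
  rcases le_total 0 T with hT | hT
  · exact h.integrableOn_ener_of_nonneg hi hT
  · have e : ∀ t, ener (fun t r => -Ut (-t) r) (fun t r => Ur (-t) r) t = ener Ut Ur (-t) :=
      fun t => funext fun r => by simp [ener]
    have := h.reflect.integrableOn_ener_of_nonneg (T := -T) (by rwa [e, neg_zero]) (by linarith)
    rwa [e, neg_neg] at this

lemma FullWave.evenWave (h : FullWave U Ut Ur Utt Utr Urr) (c : ℝ) :
    RadWave c (fun t r => 1 / 2 * (U t r + U (-t) r) - c)
      (fun t r => 1 / 2 * (Ut t r - Ut (-t) r)) (fun t r => 1 / 2 * (Ur t r + Ur (-t) r))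
      (fun t r => 1 / 2 * (Utt t r + Utt (-t) r)) (fun t r => 1 / 2 * (Utr t r - Utr (-t) r))
      (fun t r => 1 / 2 * (Urr t r + Urr (-t) r)) := by
  have hr := h.reflect
  refine ⟨?_, ?_, (h.d2.hasGrad.add hr.d2.hasGrad).const_mul _, fun t r h0 => ?_⟩
  · have hc : HasGrad (fun _ _ => c) (fun _ _ => 0) fun _ _ => 0 := fun t r _ => by
      refine (hasFDerivAt_const c (t, r)).congr_fderiv ?_
      ext <;> simp
    have := ((h.d0.hasGrad.add hr.d0.hasGrad).const_mul (1 / 2)).sub hc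
    simpa [sub_eq_add_neg] using this
  · simpa [sub_eq_add_neg] using (h.d1.hasGrad.add hr.d1.hasGrad).const_mul (1 / 2)
  · rw [h.pde t r h0, h.pde (-t) r h0]; ring

/-- The exterior energy estimate in polar coordinates, in terms of the exterior energies in both
time directions. -/
theorem FullWave.channels : ∃ C, 0 < C ∧ ∀ (U Ut Ur Utt Utr Urr : ℝ → ℝ → ℝ) (Ep Em : ℝ),
    FullWave U Ut Ur Utt Utr Urr → IntegrableOn (ener Ut Ur 0) (Ioi 0) →
    Tendsto (fun t => ∫ r in Ioi |t|, ener Ut Ur t r) atTop (𝓝 Ep) →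
    Tendsto (fun t => ∫ r in Ioi |t|, ener Ut Ur t r) atBot (𝓝 Em) → ∀ R, 0 < R →
    ∫ s in R..2 * R, (Ur 0 s - (∫ s in Ioi 0, Ur 0 s * φR1 s * s ^ 5) / normφ * φR1 s) ^ 2 * s ^ 5
      ≤ C * (Ep + Em) * (1 + log R ^ 2) := by
  obtain ⟨C, hC, H⟩ := RadWave.even_channels
  refine ⟨C, hC, fun U Ut Ur Utt Utr Urr Ep Em h hi hp hm R hR => ?_⟩
  have nn : ∀ t, 0 ≤ ∫ r in Ioi |t|, ener Ut Ur t r := fun t =>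
    setIntegral_nonneg measurableSet_Ioi fun r hr => ener_nonneg t ((abs_nonneg t).trans_lt hr)
  have hEp : 0 ≤ Ep := ge_of_tendsto' hp nn
  have hEm : 0 ≤ Em := ge_of_tendsto' hm nn
  obtain ⟨c, hc, -⟩ := h.exists_limit hi
  obtain ⟨K, hK⟩ := h.exists_bound hi
  have e0 : ∀ r, 1 / 2 * (U 0 r + U (-0) r) - c = U 0 r - c := fun r => by rw [neg_zero]; ring
  have e0' : ∀ r, 1 / 2 * (Ur 0 r + Ur (-0) r) = Ur 0 r := fun r => by rw [neg_zero]; ring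
  have key : ∀ E, Ep + Em < E → ∫ s in R..2 * R,
      (Ur 0 s - (∫ s in Ioi 0, Ur 0 s * φR1 s * s ^ 5) / normφ * φR1 s) ^ 2 * s ^ 5
      ≤ C * E * (1 + log R ^ 2) := by
    intro E hE
    have := H c _ _ _ _ _ _ E (K + |c|) (h.evenWave c) (fun t r => by rw [neg_neg]; ring)
      (by simpa only [e0] using hc) (fun r h0 _ => ?_) (by linarith) ?_
      (by simpa only [e0'] using h.integrableOn_Ur hi) R hR
    · simpa only [e0'] using this
    · rw [e0]
      exact (abs_sub _ _).trans (by linarith [hK r h0.le])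
    · have hs := hp.add (hm.comp tendsto_neg_atTop_atBot)
      filter_upwards [hs.eventually (gt_mem_nhds hE), eventually_gt_atTop 0] with T hT hT0 x y hx hxy
      refine le_trans ?_ hT.le
      simp only [Function.comp_apply, abs_neg, abs_of_pos hT0]
      have hx0 : 0 < x := hT0.trans_le hx
      have i1 := (h.integrableOn_ener hi T).mono_set (Ioi_subset_Ioi hT0.le)
      have i2 := (h.integrableOn_ener hi (-T)).mono_set (Ioi_subset_Ioi hT0.le)
      rw [← integral_add i1 i2, intervalIntegral.integral_of_le hxy]
      obtain ⟨-, a1, a2⟩ := h.continuous_slice T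
      obtain ⟨-, b1, b2⟩ := h.continuous_slice (-T)
      have hsub : Ioc x y ⊆ Ioi T := fun r hr => hx.trans_lt hr.1
      refine (setIntegral_mono_on (Continuous.integrableOn_Ioc (by fun_prop))
        ((i1.add i2).mono_set hsub) measurableSet_Ioc fun r hr => ?_).trans
        (setIntegral_mono_set (i1.add i2) ((ae_restrict_iff' measurableSet_Ioi).2
          (Eventually.of_forall fun r hr => ?_)) (LE.le.eventuallyLE hsub))
      · have hr0 : 0 < r := hx0.trans hr.1
        simp only [Pi.add_apply, ener]
        rw [← add_mul]
        refine mul_le_mul_of_nonneg_right ?_ (by positivity)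
        nlinarith [sq_nonneg (Ut T r + Ut (-T) r), sq_nonneg (Ur T r - Ur (-T) r),
          sq_nonneg (Ut T r), sq_nonneg (Ut (-T) r), sq_nonneg (Ur T r), sq_nonneg (Ur (-T) r)]
      · have hr0 : 0 < r := hT0.trans hr
        exact add_nonneg (ener_nonneg _ hr0) (ener_nonneg _ hr0)
  have hlim : Tendsto (fun E => C * E * (1 + log R ^ 2)) (𝓝[>] (Ep + Em))
      (𝓝 (C * (Ep + Em) * (1 + log R ^ 2))) :=
    (Continuous.tendsto (by fun_prop) _).mono_left nhdsWithin_le_nhds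
  exact ge_of_tendsto hlim (eventually_nhdsWithin_of_forall fun E hE => key E hE)

end

/-- The area of the unit sphere of `ℝ⁶`. -/
def κ6 : ℝ := 6 * (volume : Measure E6).real (Metric.ball 0 1)

lemma κ6_pos : 0 < κ6 := by
  have : 0 < (volume : Measure E6).real (Metric.ball 0 1) :=
    ENNReal.toReal_pos (Metric.measure_ball_pos _ _ one_pos).ne' measure_ball_lt_top.ne
  unfold κ6; positivity

lemma integral_radial (g : ℝ → ℝ) :
    ∫ x : E6, g ‖x‖ = κ6 * ∫ r in Ioi 0, g r * r ^ 5 := by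
  rw [integral_fun_norm_addHaar volume g]
  simp only [finrank_euclideanSpace, Fintype.card_fin, nsmul_eq_mul, smul_eq_mul, κ6]
  rw [mul_assoc]
  congr 2
  exact integral_congr_ae (Eventually.of_forall fun r => mul_comm _ _)

lemma integrable_radial {g : ℝ → ℝ} (h : Integrable fun x : E6 => g ‖x‖) :
    IntegrableOn (fun r => g r * r ^ 5) (Ioi 0) := by
  rw [integrable_fun_norm_addHaar volume (f := g)] at h
  simpa [mul_comm] using h

lemma setIntegral_radial (g : ℝ → ℝ) {S : Set ℝ} (hS : MeasurableSet S) :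
    ∫ x in {x : E6 | ‖x‖ ∈ S}, g ‖x‖ = κ6 * ∫ r in Ioi 0 ∩ S, g r * r ^ 5 := by
  have hm : MeasurableSet {x : E6 | ‖x‖ ∈ S} := measurable_norm hS
  rw [← integral_indicator hm]
  have := integral_radial (S.indicator g)
  have e1 : (fun x : E6 => S.indicator g ‖x‖) = {x : E6 | ‖x‖ ∈ S}.indicator fun x => g ‖x‖ := by
    ext x; simp [indicator]
  have e2 : (fun r => S.indicator g r * r ^ 5) = S.indicator fun r => g r * r ^ 5 := by
    ext r; by_cases h : r ∈ S <;> simp [h]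
  rw [← e1, this, e2, setIntegral_indicator hS]

lemma hasFDerivAt_norm6 {x : E6} (hx : x ≠ 0) :
    HasFDerivAt (fun y : E6 => ‖y‖) (‖x‖⁻¹ • innerSL ℝ x) x := by
  have h0 : 0 < ‖x‖ := norm_pos_iff.2 hx
  have h1 := (hasStrictFDerivAt_norm_sq x).hasFDerivAt.sqrt (by positivity)
  have e : (fun y : E6 => √(‖y‖ ^ 2)) = fun y => ‖y‖ := funext fun y => sqrt_sq (norm_nonneg y)
  simp only [e] at h1
  refine h1.congr_fderiv ?_
  rw [sqrt_sq h0.le]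
  ext y
  simp
  field_simp

section
variable {F F' : ℝ → ℝ} {f : E6 → ℝ}

lemma hasFDerivAt_radial (hf : ∀ y, f y = F ‖y‖) {x : E6} (hx : x ≠ 0) {d : ℝ}
    (hF : HasDerivAt F d ‖x‖) : HasFDerivAt f ((d / ‖x‖) • innerSL ℝ x) x := by
  have e : f = fun y => F ‖y‖ := funext hf
  rw [e]
  refine (hF.comp_hasFDerivAt x (hasFDerivAt_norm6 hx)).congr_fderiv ?_
  rw [smul_smul, div_eq_mul_inv]

lemma gradient_radial (hf : ∀ y, f y = F ‖y‖) {x : E6} (hx : x ≠ 0) {d : ℝ}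
    (hF : HasDerivAt F d ‖x‖) : gradient f x = (d / ‖x‖) • x := by
  refine HasGradientAt.gradient (hasGradientAt_iff_hasFDerivAt.2 ?_)
  refine (hasFDerivAt_radial hf hx hF).congr_fderiv ?_
  ext y
  simp [InnerProductSpace.toDual_apply_apply]

lemma norm_gradient_radial_sq (hf : ∀ y, f y = F ‖y‖) {x : E6} (hx : x ≠ 0) {d : ℝ}
    (hF : HasDerivAt F d ‖x‖) : ‖gradient f x‖ ^ 2 = d ^ 2 := by
  have h0 : 0 < ‖x‖ := norm_pos_iff.2 hx
  rw [gradient_radial hf hx hF, norm_smul, mul_pow, norm_eq_abs, sq_abs]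
  field_simp

lemma inner_gradient_radial {g : E6 → ℝ} {G : ℝ → ℝ} (hf : ∀ y, f y = F ‖y‖)
    (hg : ∀ y, g y = G ‖y‖) {x : E6} (hx : x ≠ 0) {a b : ℝ} (hF : HasDerivAt F a ‖x‖)
    (hG : HasDerivAt G b ‖x‖) : ⟪gradient f x, gradient g x⟫ = a * b := by
  have h0 : 0 < ‖x‖ := norm_pos_iff.2 hx
  rw [gradient_radial hf hx hF, gradient_radial hg hx hG, real_inner_smul_left,
    real_inner_smul_right, real_inner_self_eq_norm_sq]
  field_simp

lemma lap6_radial (hf : ∀ y, f y = F ‖y‖) (hF : ∀ r, 0 < r → HasDerivAt F (F' r) r) {x : E6}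
    (hx : x ≠ 0) {d : ℝ} (hF' : HasDerivAt F' d ‖x‖) :
    lap6 f x = d + 5 / ‖x‖ * F' ‖x‖ := by
  have h0 : 0 < ‖x‖ := norm_pos_iff.2 hx
  have hk : HasDerivAt (fun r => F' r / r) ((d * ‖x‖ - F' ‖x‖ * 1) / ‖x‖ ^ 2) ‖x‖ :=
    hF'.div (hasDerivAt_id' _) h0.ne'
  have hi : ∀ i : Fin 6, fderiv ℝ (fun y => fderiv ℝ f y (EuclideanSpace.single i 1)) x
      (EuclideanSpace.single i 1) =
      (d * ‖x‖ - F' ‖x‖) / ‖x‖ ^ 3 * x i ^ 2 + F' ‖x‖ / ‖x‖ := by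
    intro i
    have e : (fun y => fderiv ℝ f y (EuclideanSpace.single i 1)) =ᶠ[𝓝 x]
        fun y => F' ‖y‖ / ‖y‖ * y i := by
      filter_upwards [isOpen_ne.mem_nhds hx] with y hy
      rw [(hasFDerivAt_radial hf hy (hF _ (norm_pos_iff.2 hy))).fderiv]
      simp [EuclideanSpace.inner_single_right]
    rw [e.fderiv_eq]
    have h1 := hk.comp_hasFDerivAt x (hasFDerivAt_norm6 hx)
    have h2 : HasFDerivAt (fun y : E6 => y i) (EuclideanSpace.proj i : E6 →L[ℝ] ℝ) x :=
      (EuclideanSpace.proj i : E6 →L[ℝ] ℝ).hasFDerivAt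
    have h3 : HasFDerivAt (fun y : E6 => F' ‖y‖ / ‖y‖ * y i) _ x := h1.mul h2
    rw [h3.fderiv]
    simp [EuclideanSpace.inner_single_right]
    field_simp
    ring
  unfold lap6
  simp only [hi]
  rw [Finset.sum_add_distrib, ← Finset.mul_sum, ← EuclideanSpace.real_norm_sq_eq]
  simp
  field_simp
  ring

end

lemma hasFDerivAt_W6 (x : E6) :
    HasFDerivAt W6 ((-(1 / 6) * ((1 + ‖x‖ ^ 2 / 24) ^ 3)⁻¹) • innerSL ℝ x) x := by
  have h0 : 0 < 1 + ‖x‖ ^ 2 / 24 := by positivity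
  have h1 := (hasStrictFDerivAt_norm_sq x).hasFDerivAt
  have h2 : HasDerivAt (fun s : ℝ => ((1 + s / 24) ^ 2)⁻¹)
      (-(1 / 12) * ((1 + ‖x‖ ^ 2 / 24) ^ 3)⁻¹) (‖x‖ ^ 2) := by
    have := ((((hasDerivAt_id' (‖x‖ ^ 2)).div_const 24).const_add 1).fun_pow 2).fun_inv
      (pow_pos h0 2).ne'
    refine this.congr_deriv ?_
    norm_num; field_simp; ring
  refine (h2.comp_hasFDerivAt x h1).congr_fderiv ?_
  ext y
  simp
  ring

lemma LW6_eq (x : E6) : LW6 x = φR ‖x‖ := by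
  unfold LW6
  rw [(hasFDerivAt_W6 x).fderiv]
  simp [W6, φR, φY]
  field_simp
  ring

lemma fullGrad_of_contDiff {g : ℝ × ℝ → ℝ} (hg : ContDiff ℝ 1 g) :
    FullGrad (fun t r => g (t, r)) (fun t r => fderiv ℝ g (t, r) (1, 0))
      (fun t r => fderiv ℝ g (t, r) (0, 1)) := fun t r => by
  refine ((hg.differentiable one_ne_zero).differentiableAt (x := (t, r))).hasFDerivAt.congr_fderiv ?_
  ext <;> simp

/-- The restriction of a radial function to a half line, extended evenly. -/
def prof (u : ℝ → E6 → ℝ) (t r : ℝ) : ℝ := u t (r • EuclideanSpace.single 0 1)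

section
variable {u : ℝ → E6 → ℝ} {Ut Ur Utt Utr Urr : ℝ → ℝ → ℝ}

lemma IsRadSolOf.eq_prof {P : E6 → ℝ} (h : IsRadSolOf P u) (t : ℝ) (x : E6) :
    u t x = prof u t ‖x‖ :=
  h.2.1 t _ _ (by simp [norm_smul])

lemma dtu_eq (hu : ∀ t x, u t x = prof u t ‖x‖) (h : FullGrad (prof u) Ut Ur) (t : ℝ) (x : E6) :
    dtu u t x = Ut t ‖x‖ := by
  unfold dtu
  simp only [hu _ x]
  exact (h.deriv_t t ‖x‖).deriv

lemma eDensity_eq (hu : ∀ t x, u t x = prof u t ‖x‖) (h : FullGrad (prof u) Ut Ur) (t : ℝ)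
    {x : E6} (hx : x ≠ 0) : eDensity u t x = Ut t ‖x‖ ^ 2 + Ur t ‖x‖ ^ 2 := by
  unfold eDensity
  rw [dtu_eq hu h, norm_gradient_radial_sq (hu t) hx (h.deriv_r t ‖x‖)]

lemma IsRadSolOf.exists_fullWave (h : IsRadSolOf V6 u) :
    ∃ Ut Ur Utt Utr Urr, FullWave (prof u) Ut Ur Utt Utr Urr := by
  have hu := h.eq_prof
  obtain ⟨g, hg⟩ : ∃ g : ℝ × ℝ → ℝ, g = fun y => prof u y.1 y.2 := ⟨_, rfl⟩
  have cg : ContDiff ℝ 2 g := by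
    rw [hg]
    exact h.1.comp (f := fun y : ℝ × ℝ => (y.1, y.2 • (EuclideanSpace.single 0 1 : E6)))
      (by fun_prop)
  have cd : ContDiff ℝ 1 (fderiv ℝ g) := cg.fderiv_right (by norm_num)
  have c1 : ContDiff ℝ 1 fun y => fderiv ℝ g y (1, 0) := cd.clm_apply contDiff_const
  have c2 : ContDiff ℝ 1 fun y => fderiv ℝ g y (0, 1) := cd.clm_apply contDiff_const
  have d0 := fullGrad_of_contDiff (cg.of_le one_le_two)
  have d1 := fullGrad_of_contDiff c1
  have d2 := fullGrad_of_contDiff c2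
  have hsym : ∀ y, fderiv ℝ (fun y => fderiv ℝ g y (0, 1)) y (1, 0) =
      fderiv ℝ (fun y => fderiv ℝ g y (1, 0)) y (0, 1) := fun y => by
    have hd : DifferentiableAt ℝ (fderiv ℝ g) y := cd.differentiable one_ne_zero y
    rw [fderiv_clm_apply hd (differentiableAt_const _),
      fderiv_clm_apply hd (differentiableAt_const _)]
    simpa using (cg.contDiffAt.isSymmSndFDerivAt (by simp)).eq (1, 0) (0, 1)
  simp only [hsym] at d2
  have k1 := fun v => (c1.continuous_fderiv one_ne_zero).clm_apply (continuous_const (y := v))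
  have k2 := fun v => (c2.continuous_fderiv one_ne_zero).clm_apply (continuous_const (y := v))
  have eg : (fun t r => g (t, r)) = prof u := by rw [hg]
  rw [eg] at d0
  refine ⟨_, _, _, _, _, d0, d1, d2, k1 (1, 0), k1 (0, 1), k2 (0, 1), fun t r hr => ?_⟩
  have hx : (r • EuclideanSpace.single 0 1 : E6) ≠ 0 := by simp [hr.ne']
  have hn : ‖(r • EuclideanSpace.single 0 1 : E6)‖ = r := by simp [norm_smul, abs_of_pos hr]
  have e := h.2.2.1 t (r • EuclideanSpace.single 0 1)
  have e1 : ∀ x, dttu u t x = _ := fun x => by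
    unfold dttu
    simp only [dtu_eq hu d0]
    exact (d1.deriv_t t ‖x‖).deriv
  rw [e1, lap6_radial (hu t) (fun r _ => d0.deriv_r t r) hx (d2.deriv_r t _), hu t] at e
  simp only [hn, V6, W6] at e
  unfold Vrad
  linarith

lemma ae_ne_zero : ∀ᵐ x : E6, x ≠ 0 := compl_mem_ae_iff.2 (measure_singleton 0)

lemma setIntegral_eDensity (hu : ∀ t x, u t x = prof u t ‖x‖) (h : FullGrad (prof u) Ut Ur)
    (t : ℝ) : ∫ x in {x : E6 | |t| ≤ ‖x‖}, eDensity u t x =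
      κ6 * ∫ r in Ioi |t|, ener Ut Ur t r := by
  have e : (Ioi 0 ∩ Ici |t| : Set ℝ) =ᵐ[volume] Ioi |t| := by
    rcases (abs_nonneg t).eq_or_lt with h0 | h0
    · rw [← h0, inter_eq_left.2 Ioi_subset_Ici_self]; rfl
    · have : Ici |t| ⊆ Ioi 0 := fun x hx => h0.trans_le hx
      rw [inter_eq_right.2 this]
      exact Ioi_ae_eq_Ici.symm
  have := setIntegral_radial (fun r => Ut t r ^ 2 + Ur t r ^ 2) (measurableSet_Ici (a := |t|))
  rw [setIntegral_congr_set e] at this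
  refine Eq.trans ?_ this
  exact integral_congr_ae (ae_restrict_of_ae (ae_ne_zero.mono fun x hx => eDensity_eq hu h t hx))

lemma integrableOn_ener_zero (hu : ∀ t x, u t x = prof u t ‖x‖) (h : FullGrad (prof u) Ut Ur)
    (hi : Integrable fun x => eDensity u 0 x) : IntegrableOn (ener Ut Ur 0) (Ioi 0) :=
  integrable_radial (g := fun r => Ut 0 r ^ 2 + Ur 0 r ^ 2)
    (hi.congr (ae_ne_zero.mono fun _ hx => eDensity_eq hu h 0 hx))

lemma gradient_PiH1perp (hu : ∀ t x, u t x = prof u t ‖x‖) (h : FullGrad (prof u) Ut Ur) {x : E6}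
    (hx : x ≠ 0) : ‖gradient (PiH1perp (u 0)) x‖ ^ 2 =
      (Ur 0 ‖x‖ - (∫ s in Ioi 0, Ur 0 s * φR1 s * s ^ 5) / normφ * φR1 ‖x‖) ^ 2 := by
  have h1 : ∫ y, ⟪gradient (u 0) y, gradient LW6 y⟫ =
      κ6 * ∫ s in Ioi 0, Ur 0 s * φR1 s * s ^ 5 := by
    rw [← integral_radial fun r => Ur 0 r * φR1 r]
    exact integral_congr_ae (ae_ne_zero.mono fun y hy =>
      inner_gradient_radial (hu 0) LW6_eq hy (h.deriv_r 0 _) (φR_hasDerivAt _))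
  have h2 : ∫ y, ‖gradient LW6 y‖ ^ 2 = κ6 * normφ := by
    unfold normφ
    rw [← integral_radial fun r => φR1 r ^ 2]
    exact integral_congr_ae (ae_ne_zero.mono fun y hy =>
      norm_gradient_radial_sq LW6_eq hy (φR_hasDerivAt _))
  refine norm_gradient_radial_sq (F := fun r => prof u 0 r -
    (∫ s in Ioi 0, Ur 0 s * φR1 s * s ^ 5) / normφ * φR r) (fun y => ?_) hx
    ((h.deriv_r 0 _).sub ((φR_hasDerivAt _).const_mul _))
  unfold PiH1perp
  rw [h1, h2, mul_div_mul_left _ _ κ6_pos.ne', LW6_eq, hu 0 y]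

lemma setIntegral_ann (hu : ∀ t x, u t x = prof u t ‖x‖) (h : FullGrad (prof u) Ut Ur) {R : ℝ}
    (hR : 0 < R) : ∫ x in ann R, ‖gradient (PiH1perp (u 0)) x‖ ^ 2 =
      κ6 * ∫ s in R..2 * R, (Ur 0 s -
        (∫ s in Ioi 0, Ur 0 s * φR1 s * s ^ 5) / normφ * φR1 s) ^ 2 * s ^ 5 := by
  have hs : (Ioi 0 ∩ Ioo R (2 * R) : Set ℝ) = Ioo R (2 * R) :=
    inter_eq_right.2 fun x hx => hR.trans hx.1
  have := setIntegral_radial (fun s => (Ur 0 s -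
    (∫ s in Ioi 0, Ur 0 s * φR1 s * s ^ 5) / normφ * φR1 s) ^ 2)
    (measurableSet_Ioo (a := R) (b := 2 * R))
  rw [hs, ← setIntegral_congr_set Ioo_ae_eq_Ioc.symm,
    ← intervalIntegral.integral_of_le (by linarith)] at this
  refine Eq.trans ?_ this
  exact integral_congr_ae (ae_restrict_of_ae (ae_ne_zero.mono fun x hx => gradient_PiH1perp hu h hx))

end

/-- Channels of energy for the even part around the ground state in six dimensions. -/
theorem stmt5 :
    ∃ C : ℝ, 0 < C ∧
      ∀ (u : ℝ → E6 → ℝ) (Ep Em : ℝ), IsRadSolOf V6 u →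
        Tendsto (fun t => ∫ x in {x : E6 | |t| ≤ ‖x‖}, eDensity u t x) atTop (𝓝 Ep) →
        Tendsto (fun t => ∫ x in {x : E6 | |t| ≤ ‖x‖}, eDensity u t x) atBot (𝓝 Em) →
        Zm3 (fun x => ‖gradient (PiH1perp (u 0)) x‖) ^ 2 ≤ ENNReal.ofReal (C * (Ep + Em)) := by
  obtain ⟨C, hC, H⟩ := FullWave.channels
  refine ⟨C, hC, fun u Ep Em h hp hm => ?_⟩
  have hu := h.eq_prof
  obtain ⟨Ut, Ur, Utt, Utr, Urr, hw⟩ := h.exists_fullWave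
  have hκ := κ6_pos
  simp only [setIntegral_eDensity hu hw.d0] at hp hm
  have nn : ∀ t, 0 ≤ κ6 * ∫ r in Ioi |t|, ener Ut Ur t r := fun t =>
    mul_nonneg hκ.le (setIntegral_nonneg measurableSet_Ioi fun r hr =>
      ener_nonneg t ((abs_nonneg t).trans_lt hr))
  have hEp : 0 ≤ Ep := ge_of_tendsto' hp nn
  have hEm : 0 ≤ Em := ge_of_tendsto' hm nn
  have hE : 0 ≤ C * (Ep + Em) := by positivity
  have hp' := hp.const_mul κ6⁻¹
  have hm' := hm.const_mul κ6⁻¹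
  simp only [inv_mul_cancel_left₀ hκ.ne'] at hp' hm'
  have main := H _ _ _ _ _ _ _ _ hw (integrableOn_ener_zero hu hw.d0 h.2.2.2) hp' hm'
  have hZ : Zm3 (fun x => ‖gradient (PiH1perp (u 0)) x‖) ≤ ENNReal.ofReal √(C * (Ep + Em)) := by
    refine iSup_le fun ⟨R, hR⟩ => ENNReal.ofReal_le_ofReal ?_
    simp only
    have hL : 0 < 1 + Real.log R ^ 2 := by positivity
    rw [setIntegral_ann hu hw.d0 hR, inv_mul_le_iff₀ (sqrt_pos.2 hL), ← sqrt_mul hL.le]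
    refine sqrt_le_sqrt ?_
    refine (mul_le_mul_of_nonneg_left (main R hR) hκ.le).trans_eq ?_
    field_simp
  calc _ ≤ ENNReal.ofReal √(C * (Ep + Em)) ^ 2 := pow_le_pow_left₀ zero_le hZ 2
    _ = _ := by rw [← ENNReal.ofReal_pow (sqrt_nonneg _), sq_sqrt hE]

end
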